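/- arXiv:1101.1219 — 4 statements merged into one kernel-verified Lean document; each statement's English description precedes it below -/
import Mathlib

section
/- Let n, k ≥ 1 and let K ⊆ ℝ^n be a self-similar set generated by contracting similarities φ_1,…,φ_k (i.e. K is the unique nonempty compact set with K = ⋃_{i=1}^k φ_i(K)). If the convex hull of K is a polytope, then the set of critical values of K, i.e. {dist(x,K) : x ∈ ℝ^n is a critical point of K}, is countable. -/
open scoped RealInnerProductSpace

section Flats

variable {E : Type*} [NormedAddCommGroup E] [InnerProductSpace ℝ E]

theorem vectorSpan_le_of_sub_mem {s : Set E} {U : Submodule ℝ E} {p : E}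
    (h : ∀ v ∈ s, v - p ∈ U) : vectorSpan ℝ s ≤ U := by
  rw [vectorSpan_def, Submodule.span_le]
  rintro _ ⟨v, hv, w, hw, rfl⟩
  simpa using U.sub_mem (h v hv) (h w hw)

/-- Points of `Y` outside a flat spanned by a subset of `X` have distance at least `δ` from it. -/
def FlatSeparated (X Y : Set E) (δ : ℝ) : Prop :=
  ∀ T ⊆ X, ∀ p ∈ T, ∀ v ∈ Y, v - p ∉ vectorSpan ℝ T → ∀ y ∈ vectorSpan ℝ T, δ ≤ ‖v - p - y‖

variable [FiniteDimensional ℝ E]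

/-- The flat `p + U`, spanned by points of `S`, is almost orthogonal to `u`, and the points of `S`
lie above it with a definite slope in the direction `u`. -/
def SlopeFlat (S : Set E) (u : E) (σ q η : ℝ) (p : E) (U : Submodule ℝ E) : Prop :=
  (∃ T ⊆ S, p ∈ T ∧ U = vectorSpan ℝ T) ∧ (∀ x ∈ U, |⟪x, u⟫| ≤ η * ‖x‖) ∧
    ∀ v ∈ S, σ * ‖Uᗮ.starProjection (v - p)‖ ≤
      q ^ Module.finrank ℝ U * ⟪Uᗮ.starProjection (v - p), u⟫

theorem FlatSeparated.le_norm_starProjection {X Y : Set E} {δ : ℝ} (h : FlatSeparated X Y δ)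
    {T : Set E} (hT : T ⊆ X) {p v : E} (hp : p ∈ T) (hv : v ∈ Y) (hvp : v - p ∉ vectorSpan ℝ T) :
    δ ≤ ‖(vectorSpan ℝ T)ᗮ.starProjection (v - p)‖ := by
  rw [Submodule.starProjection_orthogonal_val]
  exact h T hT p hp v hv hvp _ (Submodule.starProjection_apply_mem _ _)

theorem abs_inner_le_of_mem_vectorSpan_insert {T : Set E} {p v u : E} {η β : ℝ} (hp : p ∈ T)
    (hη : ∀ x ∈ vectorSpan ℝ T, |⟪x, u⟫| ≤ η * ‖x‖) (hη0 : 0 ≤ η) (hβ0 : 0 ≤ β)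
    (hβ : |⟪(vectorSpan ℝ T)ᗮ.starProjection (v - p), u⟫| ≤
      β * ‖(vectorSpan ℝ T)ᗮ.starProjection (v - p)‖) :
    ∀ x ∈ vectorSpan ℝ (insert v T), |⟪x, u⟫| ≤ (η + β) * ‖x‖ := by
  intro x hx
  set U := vectorSpan ℝ T with hU
  have hle : vectorSpan ℝ (insert v T) ≤ U ⊔ Submodule.span ℝ {v - p} := by
    refine vectorSpan_le_of_sub_mem (p := p) ?_
    rintro w (rfl | hw)
    · exact Submodule.mem_sup_right (Submodule.mem_span_singleton_self _)
    · exact Submodule.mem_sup_left (vsub_mem_vectorSpan ℝ hw hp)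
  obtain ⟨y, hy, z, hz, rfl⟩ := Submodule.mem_sup.1 (hle hx)
  obtain ⟨t, rfl⟩ := Submodule.mem_span_singleton.1 hz
  set e := Uᗮ.starProjection (v - p) with he
  have hdecomp : y + t • (v - p) = (y + t • U.starProjection (v - p)) + t • e := by
    rw [he, Submodule.starProjection_orthogonal_val]; module
  set y' := y + t • U.starProjection (v - p) with hy'
  have hy'U : y' ∈ U := U.add_mem hy (U.smul_mem _ (Submodule.starProjection_apply_mem _ _))
  have hort : ⟪y', t • e⟫ = 0 :=
    Submodule.inner_right_of_mem_orthogonal hy'U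
      (Uᗮ.smul_mem _ (Submodule.starProjection_apply_mem _ _))
  rw [hdecomp]
  have hpyth := norm_add_sq_eq_norm_sq_add_norm_sq_of_inner_eq_zero y' (t • e) hort
  have h1 : ‖y'‖ ≤ ‖y' + t • e‖ := by
    apply le_of_sq_le_sq _ (norm_nonneg _); nlinarith [sq_nonneg ‖t • e‖]
  have h2 : ‖t • e‖ ≤ ‖y' + t • e‖ := by
    apply le_of_sq_le_sq _ (norm_nonneg _); nlinarith [sq_nonneg ‖y'‖]
  have h3 : |⟪t • e, u⟫| ≤ β * ‖t • e‖ := by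
    rw [real_inner_smul_left, abs_mul, norm_smul, Real.norm_eq_abs]
    nlinarith [abs_nonneg t]
  rw [inner_add_left]
  calc _ ≤ |⟪y', u⟫| + |⟪t • e, u⟫| := abs_add_le _ _
    _ ≤ η * ‖y'‖ + β * ‖t • e‖ := add_le_add (hη _ hy'U) h3
    _ ≤ η * ‖y' + t • e‖ + β * ‖y' + t • e‖ := by gcongr
    _ = _ := by ring

theorem exists_slopeFlat {δ D : ℝ} (hδ : 0 < δ) (hδD : δ ≤ D) :
    ∃ θ : ℝ, 0 < θ ∧ ∀ (S : Set E) (u : E) (ρ : ℝ), S.Finite → S.Nonempty → 0 < ρ →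
      FlatSeparated S S (δ * ρ) → (∀ v ∈ S, ∀ w ∈ S, ‖v - w‖ ≤ D * ρ) →
      ∃ η, θ ≤ η ∧ η ≤ 1 / 2 ∧
        ∃ p U, SlopeFlat S u (2 * η * D / δ) (δ / (2 * D)) η p U := by
  set n := Module.finrank ℝ E with hn
  set β := D / δ with hβ
  have hβ1 : 1 ≤ β := (one_le_div hδ).2 hδD
  set A := 1 + 2 * β * (2 * β) ^ n with hA
  have hA1 : 1 ≤ A := by rw [hA]; linarith [show 0 ≤ 2 * β * (2 * β) ^ n by positivity]
  have hA0 : 0 < A := by linarith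
  refine ⟨1 / (2 * A ^ n), by positivity, fun S u ρ hfin hne hρ hsep hdiam => ?_⟩
  set θ := 1 / (2 * A ^ n) with hθ
  have hθ0 : 0 < θ := by positivity
  obtain ⟨v₀, hv₀, hmin⟩ := hfin.exists_minimalFor (fun v => ⟪v, u⟫) S hne
  replace hmin : ∀ v ∈ S, 0 ≤ ⟪v - v₀, u⟫ := by
    intro v hv
    rw [inner_sub_left, sub_nonneg]
    rcases le_total ⟪v₀, u⟫ ⟪v, u⟫ with h | h
    · exact h
    · exact hmin hv h
  let 𝒯 : Set (Set E) := {T | T ⊆ S ∧ v₀ ∈ T ∧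
    ∀ x ∈ vectorSpan ℝ T, |⟪x, u⟫| ≤ θ * A ^ Module.finrank ℝ (vectorSpan ℝ T) * ‖x‖}
  have h𝒯fin : 𝒯.Finite := hfin.finite_subsets.subset fun T hT => hT.1
  have h𝒯ne : 𝒯.Nonempty := by
    refine ⟨{v₀}, by simpa using hv₀, rfl, fun x hx => ?_⟩
    rw [vectorSpan_singleton, Submodule.mem_bot] at hx
    simp [hx]
  obtain ⟨T, ⟨hTS, hv₀T, hT⟩, hmax⟩ :=
    𝒯.exists_max_image (fun T => Module.finrank ℝ (vectorSpan ℝ T)) h𝒯fin h𝒯ne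
  set U := vectorSpan ℝ T with hU
  set d := Module.finrank ℝ U with hd
  have hdn : d ≤ n := Submodule.finrank_le _
  set η := θ * A ^ d with hη
  have hη0 : 0 < η := by positivity
  refine ⟨η, le_mul_of_one_le_right hθ0.le (one_le_pow₀ hA1), ?_, v₀, U,
    ⟨T, hTS, hv₀T, rfl⟩, hT, ?_⟩
  · calc η ≤ θ * A ^ n := by rw [hη]; gcongr
      _ = 1 / 2 := by rw [hθ]; field_simp
  by_contra! hcon
  obtain ⟨v, hv, hlt⟩ := hcon
  set e := Uᗮ.starProjection (v - v₀) with he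
  have hvU : v - v₀ ∉ U := by
    intro h
    have : e = 0 := by
      rw [he, Submodule.starProjection_orthogonal_val,
        Submodule.starProjection_eq_self_iff.2 h, sub_self]
    simp [this] at hlt
  have hele : δ * ρ ≤ ‖e‖ := hsep.le_norm_starProjection hTS hv₀T hv hvU
  have hDδ : D = β * δ := by rw [hβ]; field_simp
  have hup : ⟪e, u⟫ ≤ 2 * η * β * (2 * β) ^ n * ‖e‖ := by
    have h1 : (δ / (2 * D)) ^ d = ((2 * β) ^ d)⁻¹ := by
      rw [hβ, ← inv_pow]; congr 1; field_simp
    rw [h1, show 2 * η * D / δ = 2 * η * β by rw [hβ]; ring, inv_mul_lt_iff₀ (by positivity)] at hlt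
    calc _ ≤ (2 * β) ^ d * (2 * η * β * ‖e‖) := hlt.le
      _ ≤ (2 * β) ^ n * (2 * η * β * ‖e‖) := by gcongr; linarith
      _ = _ := by ring
  have hlow : -(η * β * ‖e‖) ≤ ⟪e, u⟫ := by
    have h1 : ⟪e, u⟫ = ⟪v - v₀, u⟫ - ⟪U.starProjection (v - v₀), u⟫ := by
      rw [he, Submodule.starProjection_orthogonal_val, inner_sub_left]
    have h2 := (abs_le.1 (hT _ (Submodule.starProjection_apply_mem U (v - v₀)))).2
    have h3 : ‖U.starProjection (v - v₀)‖ ≤ D * ρ :=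
      (Submodule.norm_starProjection_apply_le _ _).trans (hdiam v hv v₀ hv₀)
    have h4 : η * ‖U.starProjection (v - v₀)‖ ≤ η * (β * ‖e‖) := by
      gcongr
      calc _ ≤ D * ρ := h3
        _ = β * (δ * ρ) := by rw [hDδ]; ring
        _ ≤ _ := by gcongr
    linarith [hmin v hv]
  have hpow : 1 ≤ (2 * β) ^ n := one_le_pow₀ (by linarith)
  have habs : |⟪e, u⟫| ≤ η * (2 * β * (2 * β) ^ n) * ‖e‖ := by
    refine abs_le.2 ⟨le_trans (neg_le_neg ?_) hlow, by linarith⟩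
    have : η * β * ‖e‖ * 1 ≤ η * β * ‖e‖ * (2 * (2 * β) ^ n) := by
      gcongr; linarith
    linarith
  have hnew := abs_inner_le_of_mem_vectorSpan_insert hv₀T hT hη0.le (by positivity) habs
  have hlt' : d < Module.finrank ℝ (vectorSpan ℝ (insert v T)) := by
    apply Submodule.finrank_lt_finrank_of_lt
    refine lt_of_le_of_ne (vectorSpan_mono ℝ (Set.subset_insert _ _)) fun h => hvU ?_
    rw [h]
    exact vsub_mem_vectorSpan ℝ (Set.mem_insert _ _) (Set.mem_insert_of_mem _ hv₀T)
  refine absurd (hmax (insert v T) ⟨Set.insert_subset hv hTS, Set.mem_insert_of_mem _ hv₀T, ?_⟩)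
    (not_le.2 hlt')
  intro x hx
  calc _ ≤ (η + η * (2 * β * (2 * β) ^ n)) * ‖x‖ := hnew x hx
    _ = θ * A ^ (d + 1) * ‖x‖ := by rw [hη, hA, pow_succ]; ring
    _ ≤ _ := by gcongr; exact hlt'

theorem convex_slope (U : Submodule ℝ E) (p u : E) {σ c : ℝ} (hσ : 0 ≤ σ) :
    Convex ℝ {z | σ * ‖Uᗮ.starProjection (z - p)‖ ≤ c * ⟪Uᗮ.starProjection (z - p), u⟫} := by
  intro x hx y hy s t hs ht hst
  simp only [Set.mem_ofPred_eq] at *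
  have h : s • x + t • y - p = s • (x - p) + t • (y - p) := by
    rw [show s • (x - p) + t • (y - p) = s • x + t • y - (s + t) • p by module, hst, one_smul]
  rw [h, map_add, map_smul, map_smul, inner_add_left, real_inner_smul_left, real_inner_smul_left]
  have := norm_add_le (s • Uᗮ.starProjection (x - p)) (t • Uᗮ.starProjection (y - p))
  rw [norm_smul, norm_smul, Real.norm_of_nonneg hs, Real.norm_of_nonneg ht] at this
  nlinarith [mul_le_mul_of_nonneg_left this hσ, mul_le_mul_of_nonneg_left hx hs,
    mul_le_mul_of_nonneg_left hy ht]

theorem SlopeFlat.exists_succ {S S' : Set E} {a u p : E} {U : Submodule ℝ E} {δ D ε σ η ρ : ℝ}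
    (hδ : 0 < δ) (hδD : δ ≤ D) (hρ : 0 < ρ) (hη : 0 < η) (hσ : σ = 2 * η * D / δ)
    (hε : ε < η * D) (h : SlopeFlat S u σ (δ / (2 * D)) η p U)
    (haS' : a ∈ convexHull ℝ S') (hS' : S' ⊆ convexHull ℝ S)
    (hsep : FlatSeparated S S' (δ * ρ)) (hdiam : ∀ v ∈ S, ‖a - v‖ ≤ D * ρ)
    (hdiam' : ∀ v ∈ S', ∀ w ∈ S', ‖v - w‖ ≤ D * ρ)
    (hu : ∀ v ∈ S, -(ε * ρ) ≤ ⟪v - a, u⟫) :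
    ∃ p' U', SlopeFlat S' u σ (δ / (2 * D)) η p' U' ∧ U' ≤ U ∧ p' - p ∈ U := by
  obtain ⟨⟨T, hTS, hpT, hUT⟩, htan, hslope⟩ := h
  have hD : 0 < D := hδ.trans_le hδD
  set q := δ / (2 * D) with hq
  have hq0 : 0 < q := by positivity
  have hq1 : q ≤ 1 := by rw [hq, div_le_one (by positivity)]; linarith
  have hσδ : σ * δ = 2 * η * D := by rw [hσ]; field_simp
  have hσ0 : 0 < σ := by rw [hσ]; positivity
  set d := Module.finrank ℝ U with hd
  have hqd : q ^ d ≤ 1 := pow_le_one₀ hq0.le hq1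
  have hslope' : ∀ v ∈ S', σ * ‖Uᗮ.starProjection (v - p)‖ ≤
      q ^ d * ⟪Uᗮ.starProjection (v - p), u⟫ := fun v hv =>
    convexHull_min (s := S) hslope (convex_slope U p u hσ0.le) (hS' hv)
  have hfar : ∀ v ∈ S', v - p ∉ U → δ * ρ ≤ ‖Uᗮ.starProjection (v - p)‖ := by
    subst hUT
    exact fun v hv hvp => hsep.le_norm_starProjection hTS hpT hv hvp
  have hne : ∃ p' ∈ S', p' - p ∈ U := by
    by_contra! hcon
    have hhalf : Convex ℝ {z | q ^ d * ⟪Uᗮ.starProjection p, u⟫ + σ * (δ * ρ) ≤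
        q ^ d * ⟪Uᗮ.starProjection z, u⟫} :=
      convex_halfSpace_ge (f := fun z => q ^ d * ⟪Uᗮ.starProjection z, u⟫)
        ⟨fun x y => by rw [map_add, inner_add_left, mul_add],
          fun c x => by rw [map_smul, real_inner_smul_left, smul_eq_mul]; ring⟩ _
    have ha := convexHull_min (s := S') (fun v hv => by
      have h1 := hslope' v hv
      have h2 := mul_le_mul_of_nonneg_left (hfar v hv (hcon v hv)) hσ0.le
      rw [map_sub, inner_sub_left] at h1
      simp only [Set.mem_ofPred_eq]
      rw [map_sub] at h2
      linarith) hhalf haS'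
    simp only [Set.mem_ofPred_eq] at ha
    set b := ⟪Uᗮ.starProjection (a - p), u⟫ with hb
    have hb' : σ * (δ * ρ) ≤ q ^ d * b := by
      rw [hb, map_sub, inner_sub_left]; linarith
    have hb0 : 0 ≤ b := by
      by_contra! hneg
      have : q ^ d * b ≤ 0 := mul_nonpos_of_nonneg_of_nonpos (by positivity) hneg.le
      have : 0 < σ * (δ * ρ) := by positivity
      linarith
    have hb1 : σ * (δ * ρ) ≤ b := hb'.trans (mul_le_of_le_one_left hb0 hqd)
    have h1 : b = ⟪a - p, u⟫ - ⟪U.starProjection (a - p), u⟫ := by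
      rw [hb, Submodule.starProjection_orthogonal_val, inner_sub_left]
    have h2 := (abs_le.1 (htan _ (Submodule.starProjection_apply_mem U (a - p)))).1
    have h3 : η * ‖U.starProjection (a - p)‖ ≤ η * (D * ρ) := by
      gcongr
      exact (Submodule.norm_starProjection_apply_le _ _).trans (hdiam p (hTS hpT))
    have h4 := hu p (hTS hpT)
    rw [← neg_sub a p, inner_neg_left] at h4
    have h5 : σ * (δ * ρ) = 2 * (η * D) * ρ := by rw [← mul_assoc, hσδ]; ring
    nlinarith
  obtain ⟨p', hp'S, hp'U⟩ := hne
  set T' : Set E := {v ∈ S' | v - p ∈ U} with hT'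
  have hp'T : p' ∈ T' := ⟨hp'S, hp'U⟩
  set U' := vectorSpan ℝ T' with hU'
  have hle : U' ≤ U := vectorSpan_le_of_sub_mem (p := p) fun v hv => hv.2
  refine ⟨p', U', ⟨⟨T', fun v hv => hv.1, hp'T, rfl⟩, fun x hx => htan x (hle hx), ?_⟩, hle, hp'U⟩
  have hQ : ∀ v, Uᗮ.starProjection (v - p') = Uᗮ.starProjection (v - p) := by
    intro v
    have : Uᗮ.starProjection (p' - p) = 0 := by
      rw [Submodule.starProjection_orthogonal_val,
        Submodule.starProjection_eq_self_iff.2 hp'U, sub_self]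
    rw [show v - p' = (v - p) - (p' - p) by abel, map_sub, this, sub_zero]
  intro v hv
  rcases hle.eq_or_lt with heq | hlt
  · rw [heq, hQ]; exact hslope' v hv
  by_cases hvU : v - p ∈ U
  · have hv' : v - p' ∈ U' := vsub_mem_vectorSpan ℝ (show v ∈ T' from ⟨hv, hvU⟩) hp'T
    rw [Submodule.starProjection_orthogonal_val, Submodule.starProjection_eq_self_iff.2 hv']
    simp
  set y := v - p' with hy
  have hyD : ‖y‖ ≤ D * ρ := hdiam' v hv p' hp'S
  have hQ'y : ‖U'ᗮ.starProjection y‖ ≤ D * ρ :=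
    (Submodule.norm_starProjection_apply_le _ _).trans hyD
  set x := U.starProjection (U'ᗮ.starProjection y) with hx
  have hxeq : U'ᗮ.starProjection y = Uᗮ.starProjection y + x := by
    have h1 : U.starProjection (U'.starProjection y) = U'.starProjection y :=
      Submodule.starProjection_eq_self_iff.2 (hle (Submodule.starProjection_apply_mem _ _))
    rw [hx, Submodule.starProjection_orthogonal_val, Submodule.starProjection_orthogonal_val,
      map_sub U.starProjection y (U'.starProjection y), h1]
    abel
  have hxD : ‖x‖ ≤ D * ρ := (Submodule.norm_starProjection_apply_le _ _).trans hQ'y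
  have hxu := (abs_le.1 (htan x (Submodule.starProjection_apply_mem _ _))).1
  have hmain := hslope' v hv
  rw [← hQ] at hmain
  have hfv := hfar v hv hvU
  rw [← hQ] at hfv
  have hd' : Module.finrank ℝ U' + 1 ≤ d := Submodule.finrank_lt_finrank_of_lt hlt
  set b := ⟪U'ᗮ.starProjection y, u⟫ with hb
  have hbe : b = ⟪Uᗮ.starProjection y, u⟫ + ⟪x, u⟫ := by rw [hb, hxeq, inner_add_left]
  have hqd0 : 0 < q ^ d := by positivity
  have h1 : -(η * D * ρ) ≤ q ^ d * ⟪x, u⟫ := by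
    have : -(η * D * ρ) ≤ ⟪x, u⟫ := by nlinarith
    nlinarith [show 0 ≤ η * D * ρ by positivity]
  have h2 : η * D * ρ ≤ q ^ d * b := by
    have h3 : σ * (δ * ρ) ≤ q ^ d * ⟪Uᗮ.starProjection y, u⟫ :=
      (mul_le_mul_of_nonneg_left hfv hσ0.le).trans hmain
    have h5 : σ * (δ * ρ) = 2 * (η * D) * ρ := by rw [← mul_assoc, hσδ]; ring
    rw [hbe]; nlinarith
  have hb0 : 0 ≤ b := by
    by_contra! hneg
    have : q ^ d * b ≤ 0 := mul_nonpos_of_nonneg_of_nonpos hqd0.le hneg.le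
    have : 0 < η * D * ρ := by positivity
    linarith
  have h3 : q ^ d * b ≤ q ^ (Module.finrank ℝ U' + 1) * b :=
    mul_le_mul_of_nonneg_right (pow_le_pow_of_le_one hq0.le hq1 hd') hb0
  have h4 : σ * ‖U'ᗮ.starProjection y‖ ≤ σ * (D * ρ) := by gcongr
  have h5 : q * (σ * (D * ρ)) = η * D * ρ := by rw [hσ, hq]; field_simp
  have h6 : q * (σ * (D * ρ)) ≤ q * (q ^ Module.finrank ℝ U' * b) := by
    rw [h5]; refine h2.trans (h3.trans (le_of_eq ?_)); ring
  exact h4.trans (le_of_mul_le_mul_left h6 hq0)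

theorem exists_exposing_linearMap {S : ℕ → Set E} {a u : E} {ρ : ℕ → ℝ} {δ D : ℝ}
    (hδ : 0 < δ) (hδD : δ ≤ D) (hρ : ∀ k, 0 < ρ k) (hρ' : ∀ k, ρ (k + 1) ≤ ρ k)
    (hρ0 : Filter.Tendsto ρ Filter.atTop (nhds 0))
    (hfin : ∀ k, (S k).Finite) (ha : ∀ k, a ∈ convexHull ℝ (S k))
    (hS : ∀ k, S (k + 1) ⊆ convexHull ℝ (S k))
    (hsep : ∀ k, FlatSeparated (S k) (S k) (δ * ρ k))
    (hsep' : ∀ k, FlatSeparated (S k) (S (k + 1)) (δ * ρ k))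
    (hdiam : ∀ k, ∀ v ∈ S k, ∀ w ∈ S k, ‖v - w‖ ≤ D * ρ k)
    (hdiama : ∀ k, ∀ v ∈ S k, ‖a - v‖ ≤ D * ρ k)
    (hlow : ∀ ε > 0, ∃ N, ∀ k ≥ N, ∀ v ∈ S k, -(ε * ρ k) ≤ ⟪v - a, u⟫)
    (hu : ‖u‖ = 1) (huS : ∀ k, u ∈ vectorSpan ℝ (S k)) :
    ∃ k, ∃ g : E →ₗ[ℝ] ℝ, (∀ v ∈ S k, 0 ≤ g (v - a)) ∧ ∃ v ∈ S k, 0 < g (v - a) := by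
  have hD : 0 < D := hδ.trans_le hδD
  obtain ⟨θ, hθ, hA⟩ := exists_slopeFlat (E := E) hδ hδD
  obtain ⟨N, hN⟩ := hlow (θ * D / 2) (by positivity)
  obtain ⟨η, hθη, hη1, p, U, hpU⟩ := hA (S N) u (ρ N) (hfin N)
    (convexHull_nonempty_iff.1 ⟨a, ha N⟩) (hρ N) (hsep N) (hdiam N)
  have hη0 : 0 < η := hθ.trans_le hθη
  have hε : θ * D / 2 < η * D := by nlinarith
  have hchain : ∀ j, ∃ p' U', SlopeFlat (S (N + j)) u (2 * η * D / δ) (δ / (2 * D)) η p' U' ∧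
      U' ≤ U ∧ p' - p ∈ U := by
    intro j
    induction j with
    | zero => exact ⟨p, U, hpU, le_rfl, by simp⟩
    | succ j ih =>
      obtain ⟨p₁, U₁, h₁, hU₁, hp₁⟩ := ih
      obtain ⟨p₂, U₂, h₂, hU₂, hp₂⟩ := h₁.exists_succ hδ hδD (hρ (N + j)) hη0 rfl hε
        (ha (N + j + 1)) (hS _) (hsep' _) (hdiama _)
        (fun v hv w hw => (hdiam _ v hv w hw).trans (by gcongr; exact hρ' _))
        (hN _ (Nat.le_add_right _ _))
      refine ⟨p₂, U₂, h₂, hU₂.trans hU₁, ?_⟩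
      simpa using U.add_mem (hU₁ hp₂) hp₁
  have hap : a - p ∈ U := by
    choose p' U' h' _ hp' using hchain
    have hlim : Filter.Tendsto p' Filter.atTop (nhds a) := by
      rw [tendsto_iff_norm_sub_tendsto_zero]
      have h0 : Filter.Tendsto (fun j => D * ρ (N + j)) Filter.atTop (nhds 0) := by
        have := (hρ0.comp (Filter.tendsto_add_atTop_nat N)).const_mul D
        simpa [Function.comp_def, add_comm] using this
      refine squeeze_zero (fun _ => norm_nonneg _) (fun j => ?_) h0
      obtain ⟨T, hT, hpT, -⟩ := (h' j).1
      rw [norm_sub_rev]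
      exact hdiama _ _ (hT hpT)
    exact U.closed_of_finiteDimensional.mem_of_tendsto (hlim.sub_const p)
      (Filter.Eventually.of_forall hp')
  obtain ⟨-, htan, hslope⟩ := hpU
  have hQ : ∀ v, Uᗮ.starProjection (v - p) = Uᗮ.starProjection (v - a) := by
    intro v
    have : Uᗮ.starProjection (a - p) = 0 := by
      rw [Submodule.starProjection_orthogonal_val,
        Submodule.starProjection_eq_self_iff.2 hap, sub_self]
    rw [show v - p = (v - a) + (a - p) by abel, map_add, this, add_zero]
  have hpos : ∀ v ∈ S N, ‖Uᗮ.starProjection (v - a)‖ * (2 * η * D / δ) ≤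
      (δ / (2 * D)) ^ Module.finrank ℝ U * ⟪Uᗮ.starProjection (v - a), u⟫ := fun v hv => by
    rw [← hQ, mul_comm]; exact hslope v hv
  have hσ : 0 < 2 * η * D / δ := by positivity
  have hq : 0 < (δ / (2 * D)) ^ Module.finrank ℝ U := by positivity
  refine ⟨N, (innerₗ E u).comp (Uᗮ.starProjection : E →ₗ[ℝ] E), fun v hv => ?_, ?_⟩
  · simp only [LinearMap.comp_apply, innerₗ_apply_apply, ContinuousLinearMap.coe_coe]
    rw [real_inner_comm]
    exact nonneg_of_mul_nonneg_right ((by positivity : (0 : ℝ) ≤ _).trans (hpos v hv)) hq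
  · have : ∃ v ∈ S N, v - a ∉ U := by
      by_contra! hcon
      have h1 := htan u (vectorSpan_le_of_sub_mem hcon (huS N))
      rw [real_inner_self_eq_norm_sq, hu] at h1
      norm_num at h1
      linarith
    obtain ⟨v, hv, hvU⟩ := this
    refine ⟨v, hv, ?_⟩
    simp only [LinearMap.comp_apply, innerₗ_apply_apply, ContinuousLinearMap.coe_coe]
    rw [real_inner_comm]
    have hne : Uᗮ.starProjection (v - a) ≠ 0 := by
      rwa [Ne, Submodule.starProjection_apply_eq_zero_iff, Submodule.orthogonal_orthogonal]
    exact pos_of_mul_pos_right ((mul_pos (norm_pos_iff.2 hne) hσ).trans_le (hpos v hv)) hq.le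

omit [FiniteDimensional ℝ E] in
theorem mem_convexHull_face {V : Set E} {a z : E} {g : E →ₗ[ℝ] ℝ} (hg : ∀ v ∈ V, 0 ≤ g (v - a))
    (hz : z ∈ convexHull ℝ V) :
    0 ≤ g (z - a) ∧ (g (z - a) = 0 → z ∈ convexHull ℝ {v ∈ V | g (v - a) = 0}) := by
  refine convexHull_min (s := V) (t := {z | 0 ≤ g (z - a) ∧
    (g (z - a) = 0 → z ∈ convexHull ℝ {v ∈ V | g (v - a) = 0})})
    (fun v hv => ⟨hg v hv, fun h => subset_convexHull ℝ _ ⟨hv, h⟩⟩) ?_ hz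
  rintro x ⟨hx0, hx⟩ y ⟨hy0, hy⟩ s t hs ht hst
  have h : g (s • x + t • y - a) = s * g (x - a) + t * g (y - a) := by
    rw [show s • x + t • y - a = s • (x - a) + t • (y - a) by
      rw [show s • (x - a) + t • (y - a) = s • x + t • y - (s + t) • a by module, hst, one_smul],
      map_add, map_smul, map_smul, smul_eq_mul, smul_eq_mul]
  have h1 := mul_nonneg hs hx0
  have h2 := mul_nonneg ht hy0
  refine ⟨by rw [h]; exact add_nonneg h1 h2, fun h0 => ?_⟩
  rw [h] at h0
  have h3 : s * g (x - a) = 0 := by linarith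
  have h4 : t * g (y - a) = 0 := by linarith
  rcases mul_eq_zero.1 h3 with rfl | h3
  · obtain rfl : t = 1 := by linarith
    simpa using hy (by simpa using h4)
  rcases mul_eq_zero.1 h4 with rfl | h4
  · obtain rfl : s = 1 := by linarith
    simpa using hx (by simpa using h3)
  exact convex_convexHull ℝ _ (hx h3) (hy h4) hs ht hst

omit [FiniteDimensional ℝ E] in
theorem FlatSeparated.mono {X X' Y Y' : Set E} {δ : ℝ} (h : FlatSeparated X Y δ) (hX : X' ⊆ X)
    (hY : Y' ⊆ Y) : FlatSeparated X' Y' δ :=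
  fun T hT p hp v hv => h T (hT.trans hX) p hp v (hY hv)

omit [FiniteDimensional ℝ E] in
theorem sub_mem_vectorSpan_of_mem_convexHull {S : Set E} {x y : E} (hx : x ∈ convexHull ℝ S)
    (hy : y ∈ convexHull ℝ S) : x - y ∈ vectorSpan ℝ S :=
  vsub_mem_vectorSpan_of_mem_affineSpan_of_mem_affineSpan
    (convexHull_subset_affineSpan S hx) (convexHull_subset_affineSpan S hy)

omit [NormedAddCommGroup E] [InnerProductSpace ℝ E] [FiniteDimensional ℝ E] in
/-- For two functions, `f` nonnegative on a finite set and `g` nonnegative on the zeros of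
`f`, a combination is nonnegative and vanishes only on common zeros. -/
theorem exists_combination_nonneg {V : Set E} (hV : V.Finite) {f g : E → ℝ}
    (hf : ∀ v ∈ V, 0 ≤ f v) (hg : ∀ v ∈ V, f v = 0 → 0 ≤ g v) :
    ∃ c : ℝ, ∀ v ∈ V, 0 ≤ c * f v + g v ∧ (c * f v + g v = 0 → f v = 0 ∧ g v = 0) := by
  obtain ⟨c, hc⟩ := (hV.image fun v => -g v / f v).bddAbove
  refine ⟨c + 1, fun v hv => ?_⟩
  rcases (hf v hv).eq_or_lt with h | h
  · rw [← h]
    simpa using hg v hv h.symm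
  · have h1 : -g v / f v ≤ c := hc ⟨v, hv, rfl⟩
    rw [div_le_iff₀ h] at h1
    have : 0 < (c + 1) * f v + g v := by linarith
    exact ⟨this.le, fun h0 => absurd h0 this.ne'⟩

theorem exists_affineSpan_orthogonal {V : ℕ → Set E} {a u : E} {ρ : ℕ → ℝ} {δ D : ℝ}
    (hδ : 0 < δ) (hδD : δ ≤ D) (hρ : ∀ k, 0 < ρ k) (hρ' : ∀ k, ρ (k + 1) ≤ ρ k)
    (hρ0 : Filter.Tendsto ρ Filter.atTop (nhds 0))
    (hfin : ∀ k, (V k).Finite) (ha : ∀ k, a ∈ convexHull ℝ (V k))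
    (hV : ∀ k, V (k + 1) ⊆ convexHull ℝ (V k))
    (hsep : ∀ k, FlatSeparated (V k) (V k) (δ * ρ k))
    (hsep' : ∀ k, FlatSeparated (V k) (V (k + 1)) (δ * ρ k))
    (hdiam : ∀ k, ∀ v ∈ V k, ∀ w ∈ V k, ‖v - w‖ ≤ D * ρ k)
    (hdiama : ∀ k, ∀ v ∈ V k, ‖a - v‖ ≤ D * ρ k)
    (hlow : ∀ ε > 0, ∃ N, ∀ k ≥ N, ∀ v ∈ V k, -(ε * ρ k) ≤ ⟪v - a, u⟫) :
    ∃ k, ∃ S ⊆ V k, a ∈ affineSpan ℝ S ∧ ∀ y ∈ vectorSpan ℝ S, ⟪y, u⟫ = 0 := by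
  classical
  let Adm : ℕ → (E →ₗ[ℝ] ℝ) → Prop := fun k g => ∀ v ∈ V k, 0 ≤ g (v - a)
  let F : ℕ → (E →ₗ[ℝ] ℝ) → Set E := fun k g => {v ∈ V k | g (v - a) = 0}
  have hex : ∃ d, ∃ k g, Adm k g ∧ Module.finrank ℝ (vectorSpan ℝ (F k g)) = d :=
    ⟨_, 0, 0, fun v _ => by simp, rfl⟩
  obtain ⟨K, g, hadm, hd⟩ := Nat.find_spec hex
  have hmin : ∀ k f, Adm k f → Module.finrank ℝ (vectorSpan ℝ (F K g)) ≤
      Module.finrank ℝ (vectorSpan ℝ (F k f)) := fun k f hf => by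
    rw [hd]; exact Nat.find_min' hex ⟨k, f, hf, rfl⟩
  have hadm' : ∀ j, Adm (K + j) g := by
    intro j
    induction j with
    | zero => exact hadm
    | succ j ih => exact fun v hv => (mem_convexHull_face ih (hV _ hv)).1
  have haF : ∀ j, a ∈ convexHull ℝ (F (K + j) g) := fun j =>
    (mem_convexHull_face (hadm' j) (ha _)).2 (by simp)
  have hF : ∀ j, F (K + (j + 1)) g ⊆ convexHull ℝ (F (K + j) g) := fun j v hv =>
    (mem_convexHull_face (hadm' j) (hV _ hv.1)).2 hv.2
  set W := vectorSpan ℝ (F K g) with hW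
  have hspan : ∀ j, vectorSpan ℝ (F (K + j) g) = W := by
    intro j
    induction j with
    | zero => rfl
    | succ j ih =>
      refine Submodule.eq_of_le_of_finrank_le ?_ (hmin _ _ (hadm' _))
      rw [← ih]
      exact vectorSpan_le_of_sub_mem fun v hv =>
        sub_mem_vectorSpan_of_mem_convexHull (hF j hv) (haF j)
  refine ⟨K, F K g, fun v hv => hv.1, convexHull_subset_affineSpan _ (haF 0), ?_⟩
  by_contra! hcon
  obtain ⟨y, hy, hyu⟩ := hcon
  set w := W.starProjection u with hw
  have hinner : ∀ z ∈ W, ⟪z, u⟫ = ⟪z, w⟫ := by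
    intro z hz
    rw [hw, ← Submodule.inner_starProjection_left_eq_right,
      Submodule.starProjection_eq_self_iff.2 hz]
  have hw0 : w ≠ 0 := by
    intro h
    rw [hinner y hy, h, inner_zero_right] at hyu
    exact hyu rfl
  have hwn : 0 < ‖w‖ := norm_pos_iff.2 hw0
  have hsubW : ∀ j, ∀ v ∈ F (K + j) g, v - a ∈ W := fun j v hv => by
    rw [← hspan j]
    exact sub_mem_vectorSpan_of_mem_convexHull (subset_convexHull ℝ _ hv) (haF j)
  obtain ⟨j, f, hf, v, hv, hvf⟩ := exists_exposing_linearMap (S := fun j => F (K + j) g) (a := a)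
    (u := ‖w‖⁻¹ • w) (ρ := fun j => ρ (K + j)) hδ hδD (fun _ => hρ _) (fun _ => hρ' _)
    (by simpa [Function.comp_def, add_comm] using hρ0.comp (Filter.tendsto_add_atTop_nat K))
    (fun j => (hfin _).subset fun v hv => hv.1) haF hF
    (fun j => (hsep _).mono (fun v hv => hv.1) fun v hv => hv.1)
    (fun j => (hsep' _).mono (fun v hv => hv.1) fun v hv => hv.1)
    (fun j v hv z hz => hdiam _ v hv.1 z hz.1) (fun j v hv => hdiama _ v hv.1)
    (fun ε hε => by
      obtain ⟨N, hN⟩ := hlow (ε * ‖w‖) (by positivity)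
      refine ⟨N, fun k hk v hv => ?_⟩
      have h1 := hN (K + k) (hk.trans (Nat.le_add_left _ _)) v hv.1
      rw [hinner _ (hsubW k v hv)] at h1
      rw [real_inner_smul_right, inv_mul_eq_div, le_div_iff₀ hwn]
      linarith)
    (by rw [norm_smul, norm_inv, norm_norm, inv_mul_cancel₀ hwn.ne'])
    (fun j => by
      rw [hspan]; exact W.smul_mem _ (Submodule.starProjection_apply_mem _ _))
  obtain ⟨c, hc⟩ := exists_combination_nonneg (hfin (K + j)) (f := fun v => g (v - a))
    (g := fun v => f (v - a)) (hadm' j) fun v hv h => hf v ⟨hv, h⟩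
  have hadm₂ : Adm (K + j) (c • g + f) := fun v hv => by simpa using (hc v hv).1
  have hle := hmin _ _ hadm₂
  have ha₂ : a ∈ convexHull ℝ (F (K + j) (c • g + f)) :=
    (mem_convexHull_face hadm₂ (ha _)).2 (by simp)
  have hker : vectorSpan ℝ (F (K + j) (c • g + f)) ≤ LinearMap.ker f :=
    vectorSpan_le_of_sub_mem fun v hv => ((hc v hv.1).2 (by simpa using hv.2)).2
  have hleW : vectorSpan ℝ (F (K + j) (c • g + f)) ≤ W := by
    rw [← hspan j]
    exact vectorSpan_mono ℝ fun v hv => ⟨hv.1, ((hc v hv.1).2 (by simpa using hv.2)).1⟩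
  have heq := Submodule.eq_of_le_of_finrank_le hleW hle
  exact hvf.ne' (hker (heq ▸ hsubW j v hv))

theorem exists_flatSeparated {X : Set E} (hX : X.Finite) : ∃ δ > 0, FlatSeparated X X δ := by
  let P : Set (Set E × E × E) :=
    {t | t ∈ 𝒫 X ×ˢ X ×ˢ X ∧ t.2.2 - t.2.1 ∉ vectorSpan ℝ t.1}
  let f : Set E × E × E → ℝ := fun t => ‖(vectorSpan ℝ t.1)ᗮ.starProjection (t.2.2 - t.2.1)‖
  have hP : P.Finite := (hX.powerset.prod (hX.prod hX)).subset fun t ht => ht.1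
  have hfpos : ∀ t ∈ P, 0 < f t := by
    intro t ht
    refine norm_pos_iff.2 fun h => ht.2 ?_
    rwa [Submodule.starProjection_apply_eq_zero_iff, Submodule.orthogonal_orthogonal] at h
  have hδ : ∃ δ > 0, ∀ t ∈ P, δ ≤ f t := by
    rcases P.eq_empty_or_nonempty with h | h
    · exact ⟨1, one_pos, by simp [h]⟩
    · obtain ⟨t, ht, hmin⟩ := P.exists_min_image f hP h
      exact ⟨f t, hfpos t ht, hmin⟩
  obtain ⟨δ, hδ0, hδ⟩ := hδ
  refine ⟨δ, hδ0, fun T hT p hp v hv hvp y hy => ?_⟩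
  refine (hδ (T, p, v) ⟨⟨hT, hT hp, hv⟩, hvp⟩).trans ?_
  have h0 : (vectorSpan ℝ T)ᗮ.starProjection y = 0 := by
    rwa [Submodule.starProjection_apply_eq_zero_iff, Submodule.orthogonal_orthogonal]
  have h1 := Submodule.norm_starProjection_apply_le (vectorSpan ℝ T)ᗮ (v - p - y)
  rwa [map_sub, h0, sub_zero] at h1

omit [FiniteDimensional ℝ E] in
theorem FlatSeparated.image {X Y : Set E} {δ ρ : ℝ} (h : FlatSeparated X Y δ) (hρ : 0 ≤ ρ)
    (f : E →ᵃ[ℝ] E) (hf : ∀ x y, dist (f x) (f y) = ρ * dist x y) :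
    FlatSeparated (f '' X) (f '' Y) (δ * ρ) := by
  have hlin : ∀ z, ‖f.linear z‖ = ρ * ‖z‖ := fun z => by
    have h1 := hf z 0
    rw [dist_eq_norm, dist_eq_norm, ← vsub_eq_sub, ← f.linearMap_vsub] at h1
    simpa using h1
  rintro T hT p hp _ ⟨v, hv, rfl⟩ hvp y hy
  obtain ⟨T, hTX, rfl⟩ := Set.subset_image_iff.1 hT
  obtain ⟨p, hp, rfl⟩ := hp
  have hsub : f v - f p = f.linear (v - p) := (f.linearMap_vsub v p).symm
  rw [hsub, ← AffineMap.map_vectorSpan] at hvp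
  rw [← AffineMap.map_vectorSpan] at hy
  obtain ⟨y, hy, rfl⟩ := hy
  rw [hsub, ← map_sub, hlin, mul_comm]
  gcongr
  exact h T hTX p hp v hv (fun hmem => hvp (Submodule.mem_map_of_mem hmem)) y hy

end Flats

section SelfSimilar

variable {E : Type*} [NormedAddCommGroup E] [InnerProductSpace ℝ E] {ι : Type*}

/-- The composition `A iₘ ∘ ⋯ ∘ A i₁` along the word `[i₁, …, iₘ]`. -/
def wordMap (A : ι → E →ᵃ[ℝ] E) : List ι → E →ᵃ[ℝ] E
  | [] => AffineMap.id ℝ E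
  | i :: w => (wordMap A w).comp (A i)

theorem dist_wordMap {A : ι → E →ᵃ[ℝ] E} {r : ι → ℝ}
    (hA : ∀ i x y, dist (A i x) (A i y) = r i * dist x y) (w : List ι) (x y : E) :
    dist (wordMap A w x) (wordMap A w y) = (w.map r).prod * dist x y := by
  induction w generalizing x y with
  | nil => simp [wordMap]
  | cons i w ih => simp [wordMap, ih, hA]; ring

theorem wordMap_mem {A : ι → E →ᵃ[ℝ] E} {K : Set E} (hA : ∀ i, ∀ x ∈ K, A i x ∈ K)
    (w : List ι) {x : E} (hx : x ∈ K) : wordMap A w x ∈ K := by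
  induction w generalizing x with
  | nil => simpa [wordMap]
  | cons i w ih => exact ih (hA i x hx)

theorem exists_countable_orthogonal_flats [FiniteDimensional ℝ E] [Finite ι]
    {A : ι → E →ᵃ[ℝ] E} {r : ι → ℝ} (hr : ∀ i, r i ∈ Set.Ioo (0 : ℝ) 1)
    (hA : ∀ i x y, dist (A i x) (A i y) = r i * dist x y)
    {K V : Set E} (hK : Bornology.IsBounded K) (hKeq : K = ⋃ i, A i '' K)
    (hV : V.Finite) (hVK : V ⊆ K) (hKV : K ⊆ convexHull ℝ V) :
    ∃ 𝓛 : Set (AffineSubspace ℝ E), 𝓛.Countable ∧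
      ∀ a ∈ K, ∀ u : E, (∀ z ∈ K, -(‖z - a‖ ^ 2 / 2) ≤ ⟪z - a, u⟫) →
        ∃ L ∈ 𝓛, a ∈ L ∧ ∀ y ∈ L.direction, ⟪y, u⟫ = 0 := by
  have hAK : ∀ i, ∀ x ∈ K, A i x ∈ K := fun i x hx => by
    rw [hKeq]; exact Set.mem_iUnion.2 ⟨i, x, hx, rfl⟩
  refine ⟨(fun t : List ι × Set E => affineSpan ℝ (wordMap A t.1 '' t.2)) ''
    (Set.univ ×ˢ 𝒫 V), ((Set.countable_univ).prod hV.powerset.countable).image _, ?_⟩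
  intro a ha u hu
  have hpre : ∀ x : K, ∃ i, ∃ y : K, A i y = x := by
    rintro ⟨x, hx⟩
    rw [hKeq] at hx
    obtain ⟨i, y, hy, rfl⟩ := Set.mem_iUnion.1 hx
    exact ⟨i, ⟨y, hy⟩, rfl⟩
  choose idx pre hidx using hpre
  let x : ℕ → K := fun j => pre^[j] ⟨a, ha⟩
  let w : ℕ → List ι := fun j => Nat.rec [] (fun j w => idx (x j) :: w) j
  have hw : ∀ j, w (j + 1) = idx (x j) :: w j := fun j => rfl
  have hx : ∀ j, wordMap A (w j) (x j) = a := by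
    intro j
    induction j with
    | zero => rfl
    | succ j ih =>
      rw [hw, show x (j + 1) = pre (x j) from Function.iterate_succ_apply' _ _ _]
      simp [wordMap, hidx, ih]
  let ρ : ℕ → ℝ := fun j => ((w j).map r).prod
  have hρs : ∀ j, ρ (j + 1) = r (idx (x j)) * ρ j := fun j => by
    simp [ρ, hw]
  have hρ : ∀ j, 0 < ρ j := by
    intro j
    induction j with
    | zero => exact one_pos
    | succ j ih => rw [hρs]; exact mul_pos (hr _).1 ih
  have hρ0 : Filter.Tendsto ρ Filter.atTop (nhds 0) := by
    have : Nonempty ι := ⟨idx ⟨a, ha⟩⟩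
    obtain ⟨m, hm⟩ := Finite.exists_max r
    refine squeeze_zero (fun j => (hρ j).le) (fun j => ?_)
      (tendsto_pow_atTop_nhds_zero_of_lt_one (hr m).1.le (hr m).2)
    induction j with
    | zero => exact le_rfl
    | succ j ih =>
      rw [hρs, pow_succ']
      exact mul_le_mul (hm _) ih (hρ j).le (hr m).1.le
  obtain ⟨δ, hδ, hsep⟩ := exists_flatSeparated
    (hV.union (Set.finite_iUnion fun i => hV.image (A i)))
  obtain ⟨D₀, hD₀⟩ := Metric.isBounded_iff.1 hK
  set D := max D₀ δ with hD
  have hDpos : 0 < D := lt_max_of_lt_right hδ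
  have hdist : ∀ j, ∀ y ∈ K, ∀ z ∈ K, ‖wordMap A (w j) y - wordMap A (w j) z‖ ≤ D * ρ j := by
    intro j y hy z hz
    rw [← dist_eq_norm, dist_wordMap hA, mul_comm]
    exact mul_le_mul_of_nonneg_right ((hD₀ hy hz).trans (le_max_left _ _)) (hρ j).le
  have himg : ∀ j, ∀ y ∈ K, wordMap A (w j) y ∈ convexHull ℝ (wordMap A (w j) '' V) := by
    intro j y hy
    rw [← AffineMap.image_convexHull]
    exact ⟨y, hKV hy, rfl⟩
  have hsep' := fun j => hsep.image (hρ j).le (wordMap A (w j)) (dist_wordMap hA (w j))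
  have hVX : ∀ j, wordMap A (w j) '' V ⊆ wordMap A (w j) '' (V ∪ ⋃ i, A i '' V) := fun j =>
    Set.image_mono Set.subset_union_left
  obtain ⟨j, S, hS, haS, hort⟩ := exists_affineSpan_orthogonal
    (V := fun j => wordMap A (w j) '' V) (a := a) (u := u) hδ (le_max_right D₀ δ) hρ
    (fun j => by rw [hρs]; exact mul_le_of_le_one_left (hρ j).le (hr _).2.le) hρ0
    (fun j => hV.image _)
    (fun j => by have := himg j (x j) (x j).2; rwa [hx] at this)
    (fun j => by
      rintro _ ⟨v, hv, rfl⟩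
      exact himg j _ (hAK _ v (hVK hv)))
    (fun j => (hsep' j).mono (hVX j) (hVX j))
    (fun j => (hsep' j).mono (hVX j) (by
      rintro _ ⟨v, hv, rfl⟩
      exact ⟨A (idx (x j)) v, Or.inr (Set.mem_iUnion.2 ⟨_, v, hv, rfl⟩), rfl⟩))
    (fun j => by
      rintro _ ⟨v, hv, rfl⟩ _ ⟨z, hz, rfl⟩
      exact hdist j v (hVK hv) z (hVK hz))
    (fun j => by
      rintro _ ⟨v, hv, rfl⟩
      have := hdist j (x j) (x j).2 v (hVK hv)
      rwa [hx] at this)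
    (fun ε hε => by
      have hev : ∀ᶠ j in Filter.atTop, ρ j < 2 * ε / D ^ 2 :=
        hρ0.eventually_lt_const (by positivity)
      obtain ⟨N, hN⟩ := Filter.eventually_atTop.1 hev
      refine ⟨N, fun j hj => ?_⟩
      rintro _ ⟨v, hv, rfl⟩
      refine le_trans (neg_le_neg ?_) (hu _ (wordMap_mem hAK _ (hVK hv)))
      have h1 := hdist j v (hVK hv) (x j) (x j).2
      rw [hx] at h1
      have h2 := hN j hj
      rw [lt_div_iff₀ (by positivity)] at h2
      calc _ ≤ (D * ρ j) ^ 2 / 2 := by gcongr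
        _ = ρ j * D ^ 2 / 2 * ρ j := by ring
        _ ≤ ε * ρ j := by
          have := hρ j
          gcongr
          linarith)
  obtain ⟨T, hT, rfl⟩ := Set.subset_image_iff.1 hS
  exact ⟨_, ⟨(w j, T), ⟨trivial, hT⟩, rfl⟩, haS, by rwa [direction_affineSpan]⟩

/-- A similarity of a strictly convex space is an affine map. -/
theorem exists_affineMap_of_dist_eq {f : E → E} {r : ℝ} (hr : 0 < r)
    (hf : ∀ x y, dist (f x) (f y) = r * dist x y) : ∃ A : E →ᵃ[ℝ] E, ∀ x, A x = f x := by
  have hiso : Isometry fun x => r⁻¹ • f x := Isometry.of_dist_eq fun x y => by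
    rw [dist_smul₀, hf, norm_inv, Real.norm_of_nonneg hr.le, inv_mul_cancel_left₀ hr.ne']
  refine ⟨r • hiso.affineIsometryOfStrictConvexSpace.toAffineMap, fun x => ?_⟩
  simp [smul_inv_smul₀ hr.ne']

theorem exists_finite_convexHull_eq [FiniteDimensional ℝ E] {K F : Set E} (hF : F.Finite)
    (h : convexHull ℝ K = convexHull ℝ F) : ∃ V ⊆ K, V.Finite ∧ K ⊆ convexHull ℝ V := by
  refine ⟨(convexHull ℝ K).extremePoints ℝ, extremePoints_convexHull_subset, ?_, ?_⟩
  · rw [h]; exact hF.subset extremePoints_convexHull_subset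
  · have hfin : ((convexHull ℝ K).extremePoints ℝ).Finite := by
      rw [h]; exact hF.subset extremePoints_convexHull_subset
    have hcomp : IsCompact (convexHull ℝ K) := h ▸ hF.isCompact_convexHull ℝ
    have := closure_convexHull_extremePoints hcomp (convex_convexHull ℝ K)
    rw [(hfin.isCompact_convexHull ℝ).isClosed.closure_eq] at this
    rw [this]; exact subset_convexHull ℝ K

/-- If `x` lies in the convex hull of the points where the sphere of radius `σ` about `x` is tangent
to flats of `𝓕`, and every flat of `𝓕` meets the sphere of radius `ρ` about `y`, then `σ² ≤ ρ²`. -/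
theorem sq_le_sq_of_mem_convexHull_feet {𝓕 : Set (AffineSubspace ℝ E)} {x y : E} {σ ρ : ℝ}
    (hx : x ∈ convexHull ℝ {a | ∃ L ∈ 𝓕, a ∈ L ∧ (∀ z ∈ L.direction, ⟪z, a - x⟫ = 0) ∧
      dist x a = σ}) (hy : ∀ L ∈ 𝓕, ∃ b ∈ L, dist y b = ρ) : σ ^ 2 ≤ ρ ^ 2 := by
  have hconv : Convex ℝ {a | ⟪x, y - x⟫ - (ρ ^ 2 - σ ^ 2) / 2 ≤ ⟪a, y - x⟫} :=
    convex_halfSpace_ge (f := fun a => ⟪a, y - x⟫)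
      ⟨fun a b => inner_add_left _ _ _, fun c a => real_inner_smul_left _ _ _⟩ _
  have := convexHull_min (fun a ha => ?_) hconv hx
  · simp only [Set.mem_ofPred_eq] at this
    linarith
  obtain ⟨L, hL, haL, hort, hσ⟩ := ha
  obtain ⟨b, hbL, hρ⟩ := hy L hL
  have h1 := hort (b - a) (AffineSubspace.vsub_mem_direction hbL haL)
  rw [dist_eq_norm] at hσ hρ
  have h2 : y - b = (x - a) + ((y - x) - (b - a)) := by abel
  have h3 : ⟪y - b, x - a⟫ = ‖x - a‖ ^ 2 + ⟪y - x, x - a⟫ := by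
    have h1' : ⟪b - a, x - a⟫ = 0 := by rw [← neg_sub a x, inner_neg_right, h1, neg_zero]
    rw [h2, inner_add_left, real_inner_self_eq_norm_sq, inner_sub_left (y - x) (b - a), h1',
      sub_zero]
  have h4 := norm_sub_sq_real (y - b) (x - a)
  rw [h3, hσ, hρ] at h4
  have h5 : ⟪y - x, x - a⟫ = ⟪x, y - x⟫ - ⟪a, y - x⟫ := by
    rw [real_inner_comm, inner_sub_left]
  simp only [Set.mem_ofPred_eq]
  nlinarith [sq_nonneg ‖y - b - (x - a)‖]

end SelfSimilar

/-- **Theorem (countably many critical values).** If `K ⊆ ℝⁿ` is a self-similar set (the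
unique nonempty compact set invariant under the contracting similarities `φ₁, …, φ_k`) whose
convex hull is a polytope, then the set of critical values of `K` is countable.
A point `x` is critical if `x ∈ conv {a ∈ K | dist(x,K) = |x − a|}`, in which case
`dist(x,K)` is a critical value. -/
theorem stmt0 (n k : ℕ) (hn : 1 ≤ n) (hk : 1 ≤ k)
    (φ : Fin k → EuclideanSpace ℝ (Fin n) → EuclideanSpace ℝ (Fin n))
    (r : Fin k → ℝ) (hr : ∀ i, r i ∈ Set.Ioo (0:ℝ) 1)
    (hφ : ∀ i x y, dist (φ i x) (φ i y) = r i * dist x y)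
    (K : Set (EuclideanSpace ℝ (Fin n))) (hKc : IsCompact K) (hKne : K.Nonempty)
    (hKeq : K = ⋃ i : Fin k, φ i '' K)
    (huniq : ∀ K' : Set (EuclideanSpace ℝ (Fin n)), IsCompact K' → K'.Nonempty →
      K' = ⋃ i : Fin k, φ i '' K' → K' = K)
    (hpoly : ∃ F : Finset (EuclideanSpace ℝ (Fin n)),
      (convexHull ℝ K : Set (EuclideanSpace ℝ (Fin n))) =
        convexHull ℝ (F : Set (EuclideanSpace ℝ (Fin n)))) :
    Set.Countable {ρ : ℝ | ∃ x : EuclideanSpace ℝ (Fin n),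
      x ∈ convexHull ℝ {a ∈ K | Metric.infDist x K = dist x a} ∧
      Metric.infDist x K = ρ} := by
  choose A hA using fun i => exists_affineMap_of_dist_eq (hr i).1 (hφ i)
  obtain ⟨F, hF⟩ := hpoly
  obtain ⟨V, hVK, hV, hKV⟩ := exists_finite_convexHull_eq F.finite_toSet hF
  have hKeq' : K = ⋃ i, A i '' K :=
    hKeq.trans (Set.iUnion_congr fun i => Set.image_congr fun x _ => (hA i x).symm)
  obtain ⟨𝓛, h𝓛, hflat⟩ := exists_countable_orthogonal_flats hr
    (fun i x y => by rw [hA, hA, hφ]) hKc.isBounded hKeq' hV hVK hKV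
  have hfoot : ∀ x, ∀ a ∈ K, Metric.infDist x K = dist x a →
      ∃ L ∈ 𝓛, a ∈ L ∧ ∀ y ∈ L.direction, ⟪y, a - x⟫ = 0 := by
    intro x a ha hxa
    refine hflat a ha _ fun z hz => ?_
    have h1 : ‖a - x‖ ≤ ‖(z - a) + (a - x)‖ := by
      rw [sub_add_sub_cancel, ← dist_eq_norm, ← dist_eq_norm, dist_comm a, dist_comm z, ← hxa]
      exact Metric.infDist_le_dist_of_mem hz
    have h2 := norm_add_sq_real (z - a) (a - x)
    nlinarith [norm_nonneg (a - x)]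
  let R : Set (AffineSubspace ℝ (EuclideanSpace ℝ (Fin n))) → Set ℝ := fun 𝓕 =>
    {ρ | 0 ≤ ρ ∧ ∃ x, x ∈ convexHull ℝ {a | ∃ L ∈ 𝓕, a ∈ L ∧
      (∀ z ∈ L.direction, ⟪z, a - x⟫ = 0) ∧ dist x a = ρ} ∧ ∀ L ∈ 𝓕, ∃ b ∈ L, dist x b = ρ}
  have hR : ∀ 𝓕, (R 𝓕).Subsingleton := by
    rintro 𝓕 ρ ⟨hρ, x, hx, hx'⟩ σ ⟨hσ, y, hy, hy'⟩
    exact le_antisymm (le_of_sq_le_sq (sq_le_sq_of_mem_convexHull_feet hx hy') hσ)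
      (le_of_sq_le_sq (sq_le_sq_of_mem_convexHull_feet hy hx') hρ)
  refine ((Set.countable_ofPred_finite_subset h𝓛).biUnion fun 𝓕 _ => (hR 𝓕).countable).mono ?_
  rintro ρ ⟨x, hx, rfl⟩
  rw [convexHull_eq_union_convexHull_finite_subsets] at hx
  obtain ⟨t, ht, hxt⟩ := Set.mem_iUnion₂.1 hx
  choose! L hL𝓛 hL hort using fun a (ha : a ∈ t) => hfoot x a (ht ha).1 (ht ha).2
  refine Set.mem_biUnion (x := L '' t) ⟨t.finite_toSet.image _, ?_⟩
    ⟨Metric.infDist_nonneg, x, convexHull_mono (fun a ha => ?_) hxt, ?_⟩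
  · rintro _ ⟨a, ha, rfl⟩
    exact hL𝓛 a ha
  · exact ⟨L a, ⟨a, ha, rfl⟩, hL a ha, hort a ha, (ht ha).2.symm⟩
  · rintro _ ⟨a, ha, rfl⟩
    exact ⟨a, hL a ha, (ht ha).2.symm⟩
end

section
/- Let k, m, d ≥ 1 and for every i ∈ {1,…,k}, j ∈ {1,…,m} let K^i_j ⊆ ℝ^d be a nonempty compact set whose convex hull is a polytope. Let Γ assign to every finite word I over the alphabet {1,…,k} a nonempty compact set Γ(I) ⊆ ℝ^d, let c > 0 and 0 < q < 1, and for every finite word I let φ^I : ℝ^d → ℝ^d be a similarity (a map with |φ^I(x) − φ^I(y)| = s_I|x−y| for some s_I > 0) and j(I) ∈ {1,…,m}, such that for every finite word I the following hold: (a) Γ(I) = ⋃_{i=1}^k Γ(I*i); (b) Γ(I*i) = φ^I(K^i_{j(I)}) for every i = 1,…,k; (c) diam Γ(I) ≤ c·q^{|I|}. Then there exists γ > 0 such that for every finite word I and every x ∈ Γ(I): dist(x, ∂(conv Γ(I))) ≥ γ · dist(x, Γ(I) ∩ ∂(conv Γ(I))), where ∂ denotes the topological frontier in ℝ^d. -/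
open Set Metric Filter Topology

section FaceBound

variable {E : Type*} [NormedAddCommGroup E] [InnerProductSpace ℝ E]

lemma affineMap_convexComb (f : E →ᵃ[ℝ] ℝ) {a b : ℝ} (hab : a + b = 1) (x y : E) :
    f (a • x + b • y) = a * f x + b * f y := by
  simpa using Convex.combo_affine_apply (f := f) (x := x) (y := y) hab

lemma le_affineMap_of_mem_convexHull {f : E →ᵃ[ℝ] ℝ} {V : Set E} {t : ℝ}
    (hV : ∀ v ∈ V, t ≤ f v) {u : E} (hu : u ∈ convexHull ℝ V) : t ≤ f u :=
  convexHull_min (t := f ⁻¹' Ici t) hV ((convex_Ici t).affine_preimage f) hu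

/-- A zero of an affine functional that is nonnegative on `V` and lies in the convex hull of `V`
is a convex combination of zeros in `V`. -/
lemma mem_convexHull_zeros {f : E →ᵃ[ℝ] ℝ} {V : Set E} (hV : ∀ v ∈ V, 0 ≤ f v) {u : E}
    (hu : u ∈ convexHull ℝ V) (hfu : f u = 0) : u ∈ convexHull ℝ {v ∈ V | f v = 0} := by
  have key : convexHull ℝ V ⊆
      {u | 0 ≤ f u ∧ (f u = 0 → u ∈ convexHull ℝ {v ∈ V | f v = 0})} := by
    refine convexHull_min (fun v hv => ⟨hV v hv, fun h => subset_convexHull ℝ _ ⟨hv, h⟩⟩) ?_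
    rintro x ⟨hx0, hx⟩ y ⟨hy0, hy⟩ a b ha hb hab
    have hax := mul_nonneg ha hx0
    have hby := mul_nonneg hb hy0
    rw [mem_ofPred_eq, affineMap_convexComb f hab]
    refine ⟨by positivity, fun h => ?_⟩
    rcases mul_eq_zero.1 (show a * f x = 0 by linarith) with rfl | hx1
    · obtain rfl : b = 1 := by linarith
      simpa using hy (by linarith)
    rcases mul_eq_zero.1 (show b * f y = 0 by linarith) with rfl | hy1
    · obtain rfl : a = 1 := by linarith
      simpa using hx hx1
    exact convex_convexHull ℝ _ (hx hx1) (hy hy1) ha hb hab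
  exact (key hu).2 hfu

/-- The functional `f` grows on `G` at least at rate `a` with the distance to the affine span of
the zero set of `f` in `G`. -/
def FaceBound (f : E →ᵃ[ℝ] ℝ) (G : Set E) (a : ℝ) : Prop :=
  ∀ u ∈ G, ∀ w ∈ G, f w = 0 → ∃ z ∈ vectorSpan ℝ {v ∈ G | f v = 0}, a * ‖u - w - z‖ ≤ f u

/-- The points of `V` that are off the face `{v ∈ G | f v = 0}` keep a distance from the affine
span of that face which is at least `κ` times the diameter of `G`. -/
def FaceSeparated (f : E →ᵃ[ℝ] ℝ) (V G : Set E) (κ : ℝ) : Prop :=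
  ∀ v ∈ V, f v ≠ 0 → ∀ w ∈ G, f w = 0 → ∀ z ∈ vectorSpan ℝ {v ∈ G | f v = 0},
    ∀ u ∈ G, ∀ u' ∈ G, κ * ‖u - u'‖ ≤ ‖v - w - z‖

lemma FaceBound.subset_of_vectorSpan_eq {f : E →ᵃ[ℝ] ℝ} {G K : Set E} {a : ℝ}
    (h : FaceBound f G a) (hKG : K ⊆ G)
    (hN : vectorSpan ℝ {v ∈ K | f v = 0} = vectorSpan ℝ {v ∈ G | f v = 0}) :
    FaceBound f K a := fun u hu w hw hfw => by
  rw [hN]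
  exact h u (hKG hu) w (hKG hw) hfw

lemma FaceBound.subset {f : E →ᵃ[ℝ] ℝ} {G K V : Set E} {a κ : ℝ}
    (h : FaceBound f G a) (ha : 0 ≤ a) (hκ : 0 ≤ κ) (hKG : K ⊆ G) (hVK : V ⊆ K)
    (hKV : K ⊆ convexHull ℝ V) (hsep : FaceSeparated f V G κ) :
    FaceBound f K (a * κ) := by
  intro u hu w hw hfw
  set N := vectorSpan ℝ {v ∈ K | f v = 0}
  have key : convexHull ℝ V ⊆ {u | ∃ z ∈ N, a * κ * ‖u - w - z‖ ≤ f u} := by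
    refine convexHull_min (fun v hv => ?_) ?_
    · by_cases hfv : f v = 0
      · refine ⟨v - w, vsub_mem_vectorSpan ℝ ⟨hVK hv, hfv⟩ ⟨hw, hfw⟩, ?_⟩
        simp [hfv]
      · obtain ⟨z, hz, hle⟩ := h v (hKG (hVK hv)) w (hKG hw) hfw
        refine ⟨0, N.zero_mem, le_trans ?_ hle⟩
        rw [sub_zero, mul_assoc]
        exact mul_le_mul_of_nonneg_left
          (hsep v hv hfv w (hKG hw) hfw z hz v (hKG (hVK hv)) w (hKG hw)) ha
    · rintro x ⟨z, hz, hx⟩ y ⟨z', hz', hy⟩ s t hs ht hst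
      refine ⟨s • z + t • z', N.add_mem (N.smul_mem s hz) (N.smul_mem t hz'), ?_⟩
      have e : s • x + t • y - w - (s • z + t • z') = s • (x - w - z) + t • (y - w - z') := by
        have : w = s • w + t • w := by rw [← add_smul, hst, one_smul]
        nth_rewrite 1 [this]
        module
      rw [e, affineMap_convexComb f hst]
      calc _ ≤ a * κ * (s * ‖x - w - z‖ + t * ‖y - w - z'‖) := by
            gcongr
            refine (norm_add_le _ _).trans_eq ?_
            rw [norm_smul, norm_smul, Real.norm_of_nonneg hs, Real.norm_of_nonneg ht]
        _ = s * (a * κ * ‖x - w - z‖) + t * (a * κ * ‖y - w - z'‖) := by ring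
        _ ≤ _ := by gcongr
  exact key (hKV hu)

lemma FaceBound.le_of_disjoint {f : E →ᵃ[ℝ] ℝ} {G V : Set E} {a κ : ℝ}
    (h : FaceBound f G a) (ha : 0 ≤ a) (hVG : V ⊆ G) (hsep : FaceSeparated f V G κ)
    (hV : ∀ v ∈ V, f v ≠ 0) {x w : E} (hx : x ∈ convexHull ℝ V) (hxG : x ∈ G)
    (hw : w ∈ G) (hfw : f w = 0) :
    a * κ * ‖x - w‖ ≤ f x := by
  refine le_affineMap_of_mem_convexHull (fun v hv => ?_) hx
  obtain ⟨z, hz, hle⟩ := h v (hVG hv) w hw hfw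
  refine le_trans ?_ hle
  rw [mul_assoc]
  exact mul_le_mul_of_nonneg_left (hsep v hv (hV v hv) w hw hfw z hz x hxG w hw) ha

lemma affineSpan_zeros_eq {f : E →ᵃ[ℝ] ℝ} {V G : Set E} (hf : ∀ v ∈ G, 0 ≤ f v)
    (hVG : V ⊆ G) (hGV : G ⊆ convexHull ℝ V) :
    affineSpan ℝ {v ∈ G | f v = 0} = affineSpan ℝ {v ∈ V | f v = 0} := by
  refine le_antisymm ?_ (affineSpan_mono ℝ fun v hv => ⟨hVG hv.1, hv.2⟩)
  rw [← affineSpan_convexHull {v ∈ V | f v = 0}]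
  exact affineSpan_mono ℝ fun v hv =>
    mem_convexHull_zeros (fun v hv => hf v (hVG hv)) (hGV hv.1) hv.2

/-- Separation constants for finitely generated sets can be chosen uniformly over all
functionals and all similar copies. -/
lemma exists_faceSeparated [FiniteDimensional ℝ E] {L V V' : Set E} (hV : V.Finite)
    (hV' : V'.Finite) (hVL : V ⊆ L) (hLV : L ⊆ convexHull ℝ V) (hL : Bornology.IsBounded L) :
    ∀ᶠ κ in 𝓝[>] (0 : ℝ), ∀ (φ : E →ᵃ[ℝ] E) (s : ℝ), 0 < s →
      (∀ x y, ‖φ x - φ y‖ = s * ‖x - y‖) → ∀ f : E →ᵃ[ℝ] ℝ, (∀ v ∈ φ '' L, 0 ≤ f v) →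
      FaceSeparated f (φ '' V') (φ '' L) κ := by
  obtain ⟨D, hD0, hD⟩ := hL.subset_closedBall_lt 0 0
  have hD' : ∀ u ∈ L, ∀ u' ∈ L, ‖u - u'‖ ≤ 2 * D := fun u hu u' hu' => by
    have h1 := hD hu
    have h2 := hD hu'
    simp only [mem_closedBall, dist_zero_right] at h1 h2
    linarith [norm_sub_le u u']
  have key : ∀ᶠ κ in 𝓝[>] (0 : ℝ), ∀ F ∈ {F : Set E | F ⊆ V}, ∀ v ∈ V', v ∉ affineSpan ℝ F →
      ∀ p ∈ affineSpan ℝ F, κ * (2 * D) ≤ ‖v - p‖ := by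
    rw [eventually_all_finite hV.finite_subsets]
    intro F _
    rw [eventually_all_finite hV']
    intro v _
    by_cases hv : v ∈ affineSpan ℝ F
    · simp [hv]
    have hcl : IsClosed (affineSpan ℝ F : Set E) := AffineSubspace.closed_of_finiteDimensional _
    obtain ⟨ε, hε, hball⟩ := Metric.isOpen_iff.1 hcl.isOpen_compl v hv
    filter_upwards [Ioo_mem_nhdsGT (show (0 : ℝ) < ε / (2 * D) by positivity)] with κ hκ _ p hp
    by_contra! hlt
    refine hball ?_ hp
    rw [mem_ball, dist_comm, dist_eq_norm]
    have := (lt_div_iff₀ (by positivity)).1 hκ.2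
    linarith
  filter_upwards [key, self_mem_nhdsWithin] with κ hκ hκ0 φ s hs hφ f hf
  rintro _ ⟨v, hv, rfl⟩ hfv _ ⟨w, hw, rfl⟩ hfw z hz _ ⟨u, hu, rfl⟩ _ ⟨u', hu', rfl⟩
  set g : E →ᵃ[ℝ] ℝ := f.comp φ
  have hg : ∀ v ∈ L, 0 ≤ g v := fun v hv => hf _ (mem_image_of_mem _ hv)
  set F : Set E := {v ∈ V | g v = 0}
  have hspan := affineSpan_zeros_eq hg hVL hLV
  have himg : {v ∈ φ '' L | f v = 0} = φ '' {v ∈ L | g v = 0} := by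
    ext y; constructor
    · rintro ⟨⟨x, hx, rfl⟩, h⟩
      exact ⟨x, ⟨hx, h⟩, rfl⟩
    · rintro ⟨x, ⟨hx, h⟩, rfl⟩
      exact ⟨⟨x, hx, rfl⟩, h⟩
  rw [himg, ← AffineMap.map_vectorSpan] at hz
  obtain ⟨z, hz, rfl⟩ := hz
  have hp : z + w ∈ affineSpan ℝ F := by
    rw [← hspan]
    exact vadd_mem_affineSpan_of_mem_affineSpan_of_mem_vectorSpan
      (mem_affineSpan ℝ (show w ∈ {v ∈ L | g v = 0} from ⟨hw, hfw⟩)) hz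
  have hvF : v ∉ affineSpan ℝ F := fun hmem => by
    refine hfv ?_
    have h1 : affineSpan ℝ F ≤ (AffineSubspace.mk' (0 : ℝ) ⊥).comap g :=
      affineSpan_le.2 fun x hx => by simpa using hx.2
    have h2 : g v = 0 := by simpa using h1 hmem
    exact h2
  have hle := hκ F (fun x hx => hx.1) v hv hvF _ hp
  have e : φ v - φ w - φ.linear z = φ v - φ (z + w) := by
    have : φ (z + w) = φ.linear z + φ w := φ.map_vadd w z
    rw [this]; abel
  rw [e, hφ, hφ]
  have := mul_le_mul_of_nonneg_left (hD' u hu u' hu') (le_of_lt hκ0)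
  calc κ * (s * ‖u - u'‖) = s * (κ * ‖u - u'‖) := by ring
    _ ≤ s * ‖v - (z + w)‖ := by gcongr; exact this.trans hle

lemma exists_finite_subset_convexHull_eq [FiniteDimensional ℝ E] {K : Set E} {F : Set E}
    (hF : F.Finite) (h : convexHull ℝ K = convexHull ℝ F) :
    ∃ V : Set E, V.Finite ∧ V ⊆ K ∧ K ⊆ convexHull ℝ V := by
  have hfin : ((convexHull ℝ K).extremePoints ℝ).Finite :=
    hF.subset (by rw [h]; exact extremePoints_convexHull_subset)
  refine ⟨_, hfin, extremePoints_convexHull_subset, ?_⟩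
  have hc : IsCompact (convexHull ℝ K) := h ▸ hF.isCompact_convexHull (𝕜 := ℝ)
  have := closure_convexHull_extremePoints hc (convex_convexHull ℝ K)
  rw [(hfin.isClosed_convexHull (𝕜 := ℝ)).closure_eq] at this
  rw [this]
  exact subset_convexHull ℝ K

/-- The point of the frontier closest to an interior point `x` of a polytope determines a facet;
the normalized functional vanishing there satisfies `FaceBound` with constant `1`. -/
lemma exists_facet_functional [FiniteDimensional ℝ E] {V G : Set E} (hV : V.Finite)
    (hVG : V ⊆ G) (hGV : G ⊆ convexHull ℝ V) {x : E} (hx : x ∈ interior (convexHull ℝ G))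
    (hne : (frontier (convexHull ℝ G)).Nonempty) :
    ∃ f : E →ᵃ[ℝ] ℝ, (∀ u ∈ G, 0 ≤ f u) ∧ (∃ w ∈ G, f w = 0) ∧
      (∀ w ∈ G, f w = 0 → w ∈ frontier (convexHull ℝ G)) ∧ FaceBound f G 1 ∧
      f x ≤ infDist x (frontier (convexHull ℝ G)) := by
  have hPV : convexHull ℝ G = convexHull ℝ V :=
    (convexHull_min hGV (convex_convexHull ℝ V)).antisymm (convexHull_mono hVG)
  set P := convexHull ℝ G with hP
  have hPconv : Convex ℝ P := convex_convexHull ℝ G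
  have hPcl : IsClosed P := by
    rw [hPV]
    exact hV.isClosed_convexHull (𝕜 := ℝ)
  have hPuniv : P ≠ univ := fun h => by simp [h] at hne
  obtain ⟨y, hy, hxy⟩ := exists_mem_frontier_infDist_compl_eq_dist (interior_subset hx) hPuniv
  set r := dist x y with hr
  have hball : ball x r ⊆ P := by
    rw [← hxy]
    exact ball_infDist_compl_subset
  have hballi : ball x r ⊆ interior P := interior_maximal hball isOpen_ball
  have hr0 : 0 < r := dist_pos.2 fun h => hy.2 (h ▸ hx)
  have hyP : y ∈ P := hPcl.frontier_subset hy
  obtain ⟨n, hn⟩ : ∃ n : E, n = r⁻¹ • (x - y) := ⟨_, rfl⟩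
  have hxn : x - y = r • n := by rw [hn, smul_inv_smul₀ hr0.ne']
  have hn1 : ‖n‖ = 1 := by
    rw [hn, norm_smul, ← dist_eq_norm, ← hr, Real.norm_of_nonneg (by positivity),
      inv_mul_cancel₀ hr0.ne']
  have hnn : inner ℝ n n = 1 := by rw [real_inner_self_eq_norm_sq, hn1, one_pow]
  let f : E →ᵃ[ℝ] ℝ := (innerₛₗ ℝ n).toAffineMap - AffineMap.const ℝ E (inner ℝ n y)
  have hf : ∀ u, f u = inner ℝ n (u - y) := fun u => by simp [f, inner_sub_right]
  have hfP : ∀ p ∈ P, 0 ≤ f p := by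
    intro p hp
    by_contra! hlt
    rw [hf] at hlt
    have hpy : 0 < ‖p - y‖ := norm_pos_iff.2 fun h => by simp [h] at hlt
    set b := inner ℝ n (p - y) with hb
    set t := -(r * b) / ‖p - y‖ ^ 2 with ht
    have ht0 : 0 < t := by
      have : 0 < -(r * b) := by nlinarith
      positivity
    have htS : t * ‖p - y‖ ^ 2 = -(r * b) := by rw [ht]; field_simp
    have hq : y - t • (p - y) ∈ ball x r := by
      rw [mem_ball, dist_eq_norm]
      have e : y - t • (p - y) - x = -(t • (p - y) + r • n) := by rw [← hxn]; abel
      rw [e, norm_neg]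
      refine lt_of_pow_lt_pow_left₀ 2 hr0.le ?_
      rw [norm_add_sq_real, norm_smul, norm_smul, hn1, inner_smul_left, inner_smul_right,
        real_inner_comm, ← hb, Real.norm_of_nonneg ht0.le, Real.norm_of_nonneg hr0.le]
      simp only [conj_trivial]
      have : t * (r * b) < 0 := mul_neg_of_pos_of_neg ht0 (mul_neg_of_pos_of_neg hr0 hlt)
      nlinarith
    refine hy.2 (hPconv.openSegment_interior_self_subset_interior (hballi hq) hp ?_)
    refine ⟨1 / (1 + t), t / (1 + t), by positivity, by positivity, by field_simp, ?_⟩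
    rw [show (1 / (1 + t)) • (y - t • (p - y)) + (t / (1 + t)) • p
      = ((1 / (1 + t)) * (1 + t)) • y by module, one_div_mul_cancel (by positivity), one_smul]
  have hGP : G ⊆ P := subset_convexHull ℝ G
  have hVP : V ⊆ P := hVG.trans hGP
  have hfy : f y = 0 := by simp [hf]
  have hyF := mem_convexHull_zeros (fun v hv => hfP v (hVP hv)) (hPV ▸ hyP) hfy
  set N := vectorSpan ℝ {v ∈ G | f v = 0}
  have hN : ∀ z ∈ N, inner ℝ n z = 0 := by
    have : N ≤ LinearMap.ker (innerₛₗ ℝ n) := by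
      refine Submodule.span_le.2 ?_
      rintro _ ⟨a, ha, b, hb, rfl⟩
      have h1 := ha.2
      have h2 := hb.2
      rw [hf, inner_sub_right] at h1 h2
      simp only [vsub_eq_sub, SetLike.mem_coe, LinearMap.mem_ker, innerₛₗ_apply_apply,
        inner_sub_right]
      linarith
    exact fun z hz => by simpa using this hz
  have hNV : ∀ v ∈ V, f v = 0 → v - y ∈ N := by
    intro v hv hfv
    have hVGf : {v ∈ V | f v = 0} ⊆ {v ∈ G | f v = 0} := fun v hv => ⟨hVG hv.1, hv.2⟩
    have h1 : y ∈ affineSpan ℝ {v ∈ G | f v = 0} :=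
      affineSpan_mono ℝ hVGf (convexHull_subset_affineSpan _ hyF)
    have h2 : v ∈ affineSpan ℝ {v ∈ G | f v = 0} :=
      mem_affineSpan ℝ (show v ∈ {v ∈ G | f v = 0} from ⟨hVG hv, hfv⟩)
    have := AffineSubspace.vsub_mem_direction h2 h1
    rwa [direction_affineSpan] at this
  have hperp : ∀ e ∈ Nᗮ, inner ℝ n e = 0 → e = 0 := by
    intro e he hne
    by_contra he0
    have hS : 0 < ‖e‖ ^ 2 := by positivity
    have hev : ∀ᶠ ε in 𝓝[>] (0 : ℝ), ∀ v ∈ V, ε * inner ℝ e (v - y) ≤ f v := by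
      rw [eventually_all_finite hV]
      intro v hv
      rcases (hfP v (hVP hv)).eq_or_lt with h0 | hpos
      · rw [← h0, Submodule.inner_left_of_mem_orthogonal (hNV v hv h0.symm) he]
        simp
      · have : Tendsto (fun ε : ℝ => ε * inner ℝ e (v - y)) (𝓝[>] 0) (𝓝 0) := by
          refine tendsto_nhdsWithin_of_tendsto_nhds ?_
          simpa using (continuous_id.mul continuous_const).tendsto (0 : ℝ)
            (f := fun ε : ℝ => ε * inner ℝ e (v - y))
        exact (this.eventually_lt_const hpos).mono fun _ h => h.le
    obtain ⟨ε, hε, hε0⟩ := (hev.and self_mem_nhdsWithin).exists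
    replace hε0 : 0 < ε := hε0
    let f' : E →ᵃ[ℝ] ℝ :=
      f - ε • ((innerₛₗ ℝ e).toAffineMap - AffineMap.const ℝ E (inner ℝ e y))
    have hf' : ∀ u, f' u = f u - ε * inner ℝ e (u - y) := fun u => by
      simp [f', inner_sub_right]
    have hf'P : ∀ p ∈ P, 0 ≤ f' p := fun p hp => by
      refine le_affineMap_of_mem_convexHull (V := V) (fun v hv => ?_) (hPV ▸ hp)
      rw [hf']
      linarith [hε v hv]
    set S := ‖e‖ ^ 2 with hSdef
    set τ := r * ε / (2 * (1 + ε ^ 2 * S / 4)) with hτ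
    have hτ0 : 0 < τ := by positivity
    have hτe : τ * (1 + ε ^ 2 * S / 4) = r * ε / 2 := by rw [hτ]; field_simp
    set η := ε * τ * S / 2 with hη
    have hq : y + (τ • e + η • n) ∈ ball x r := by
      rw [mem_ball, dist_eq_norm]
      have e1 : y + (τ • e + η • n) - x = τ • e + (η - r) • n := by
        rw [sub_smul, ← hxn]; abel
      rw [e1]
      refine lt_of_pow_lt_pow_left₀ 2 hr0.le ?_
      rw [norm_add_sq_real, norm_smul, norm_smul, hn1, inner_smul_left, inner_smul_right,
        real_inner_comm, hne, mul_pow, mul_pow, Real.norm_eq_abs, Real.norm_eq_abs, sq_abs, sq_abs,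
        ← hSdef]
      have h1 : τ * S * (τ * (1 + ε ^ 2 * S / 4)) = τ * S * (r * ε / 2) := by rw [hτe]
      have h2 : 0 < τ * S * (r * ε / 2) := by positivity
      rw [hη]
      nlinarith
    have := hf'P _ (hball hq)
    rw [hf', hf, add_sub_cancel_left, inner_add_right, inner_add_right, inner_smul_right,
      inner_smul_right, inner_smul_right, inner_smul_right, hne, hnn, real_inner_comm n e, hne,
      real_inner_self_eq_norm_sq, ← hSdef, hη] at this
    have : 0 < ε * τ * S := by positivity
    nlinarith
  have hNn : ∀ e, inner ℝ n e = 0 → e ∈ N := by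
    intro e he
    obtain ⟨p, hp, e', he', rfl⟩ := N.exists_add_mem_mem_orthogonal e
    rw [inner_add_right, hN p hp, zero_add] at he
    rw [hperp e' he' he, add_zero]
    exact hp
  refine ⟨f, fun u hu => hfP u (hGP hu), ?_, ?_, ?_, ?_⟩
  · obtain ⟨v, hv⟩ := convexHull_nonempty_iff.1 ⟨y, hyF⟩
    exact ⟨v, hVG hv.1, hv.2⟩
  · intro w hw hfw
    refine ⟨subset_closure (hGP hw), fun hwi => ?_⟩
    have hcont : Tendsto (fun t : ℝ => w - t • n) (𝓝[>] 0) (𝓝 w) := by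
      refine tendsto_nhdsWithin_of_tendsto_nhds ?_
      have : Continuous fun t : ℝ => w - t • n := by fun_prop
      simpa using this.tendsto 0
    obtain ⟨t, ht, ht0⟩ := ((hcont.eventually (isOpen_interior.mem_nhds hwi)).and
      self_mem_nhdsWithin).exists
    replace ht0 : 0 < t := ht0
    have h1 := hfP _ (interior_subset ht)
    rw [hf, inner_sub_right, inner_sub_right, inner_smul_right, hnn] at h1
    rw [hf, inner_sub_right] at hfw
    linarith
  · intro u hu w hw hfw
    rw [hf] at hfw
    have h1 : inner ℝ n (u - w) = f u := by
      rw [hf, ← sub_sub_sub_cancel_right u w y, inner_sub_right, hfw, sub_zero]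
    refine ⟨u - w - f u • n, hNn _ ?_, ?_⟩
    · rw [inner_sub_right, inner_smul_right, hnn, h1, mul_one, sub_self]
    · rw [sub_sub_cancel, norm_smul, hn1, Real.norm_of_nonneg (hfP u (hGP hu))]
      simp
  · have hfx : f x = r := by rw [hf, hxn, inner_smul_right, hnn, mul_one]
    rw [hfx, le_infDist hne]
    intro z hz
    by_contra! hlt
    exact hz.2 (hballi (by rwa [mem_ball, dist_comm]))

/-- In a tree of nested sets, the distance to a face is controlled by the functional defining the
face, with a constant that only degrades when the dimension of the face drops. -/
lemma infDist_zeros_le_of_tree [FiniteDimensional ℝ E] {ι : Type*} {Γ : List ι → Set E}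
    (hΓ : ∀ I, Bornology.IsBounded (Γ I)) (ha : ∀ I, Γ I = ⋃ i, Γ (I ++ [i])) {c q : ℝ}
    (hc : 0 < c) (hq0 : 0 < q) (hq1 : q < 1) (hdiam : ∀ I, diam (Γ I) ≤ c * q ^ I.length)
    {V : List ι → ι → Set E} (hVΓ : ∀ I i, V I i ⊆ Γ (I ++ [i]))
    (hΓV : ∀ I i, Γ (I ++ [i]) ⊆ convexHull ℝ (V I i)) {κ : ℝ} (hκ0 : 0 < κ) (hκ1 : κ ≤ 1)
    (hsep : ∀ I i (f : E →ᵃ[ℝ] ℝ), (∀ u ∈ Γ I, 0 ≤ f u) → FaceSeparated f (V I i) (Γ I) κ)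
    {I : List ι} {f : E →ᵃ[ℝ] ℝ} {a : ℝ} (ha0 : 0 ≤ a) (hf : ∀ u ∈ Γ I, 0 ≤ f u)
    (hZ : ∃ w ∈ Γ I, f w = 0) (hb : FaceBound f (Γ I) a) {x : E} (hx : x ∈ Γ I) :
    a * κ ^ (Module.finrank ℝ E + 1) * infDist x {w ∈ Γ I | f w = 0} ≤ f x := by
  have key : ∀ (n : ℕ) (I : List ι) (a : ℝ), 0 ≤ a → (∀ u ∈ Γ I, 0 ≤ f u) →
      (∃ w ∈ Γ I, f w = 0) → FaceBound f (Γ I) a → ∀ x ∈ Γ I,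
      a * κ ^ (Module.finrank ℝ (vectorSpan ℝ {w ∈ Γ I | f w = 0}) + 1) *
        (infDist x {w ∈ Γ I | f w = 0} - c * q ^ (I.length + n)) ≤ f x := by
    intro n
    induction n with
    | zero =>
      rintro I a ha0 hf ⟨w, hw, hfw⟩ - x hx
      have h1 : infDist x {w ∈ Γ I | f w = 0} ≤ c * q ^ (I.length + 0) :=
        (infDist_le_dist_of_mem (show w ∈ {w ∈ Γ I | f w = 0} from ⟨hw, hfw⟩)).trans
          ((dist_le_diam_of_mem (hΓ I) hx hw).trans (hdiam I))
      exact (mul_nonpos_of_nonneg_of_nonpos (by positivity) (by linarith)).trans (hf x hx)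
    | succ n ih =>
      rintro I a ha0 hf ⟨w, hw, hfw⟩ hb x hx
      rcases le_total (infDist x {w ∈ Γ I | f w = 0} - c * q ^ (I.length + (n + 1))) 0
        with hneg | hpos
      · exact (mul_nonpos_of_nonneg_of_nonpos (by positivity) hneg).trans (hf x hx)
      obtain ⟨i, hi⟩ := mem_iUnion.1 (ha I ▸ hx)
      have hsub : Γ (I ++ [i]) ⊆ Γ I := by
        rw [ha I]
        exact subset_iUnion (fun i => Γ (I ++ [i])) i
      have hsep' := hsep I i f hf
      by_cases ht : ∃ w ∈ Γ (I ++ [i]), f w = 0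
      · have hzsub : {w ∈ Γ (I ++ [i]) | f w = 0} ⊆ {w ∈ Γ I | f w = 0} :=
          fun w hw => ⟨hsub hw.1, hw.2⟩
        have hle := vectorSpan_mono ℝ hzsub
        have hbr : infDist x {w ∈ Γ I | f w = 0} - c * q ^ (I.length + (n + 1)) ≤
            infDist x {w ∈ Γ (I ++ [i]) | f w = 0} - c * q ^ ((I ++ [i]).length + n) := by
          rw [List.length_append, List.length_singleton, add_assoc, add_comm 1 n]
          exact sub_le_sub_right (infDist_le_infDist_of_subset hzsub ht) _
        rcases (Submodule.finrank_mono hle).eq_or_lt with heq | hlt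
        · have hN := Submodule.eq_of_le_of_finrank_eq hle heq
          have := ih (I ++ [i]) a ha0 (fun u hu => hf u (hsub hu)) ht
            (hb.subset_of_vectorSpan_eq hsub hN) x hi
          rw [hN] at this
          exact (mul_le_mul_of_nonneg_left hbr (by positivity)).trans this
        · refine le_trans ?_ (ih (I ++ [i]) (a * κ) (by positivity) (fun u hu => hf u (hsub hu)) ht
            (hb.subset ha0 hκ0.le hsub (hVΓ I i) (hΓV I i) hsep') x hi)
          refine mul_le_mul ?_ hbr hpos (by positivity)
          rw [mul_assoc, ← pow_succ']
          exact mul_le_mul_of_nonneg_left (pow_le_pow_of_le_one hκ0.le hκ1 (by omega)) ha0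
      · push Not at ht
        refine le_trans ?_ (hb.le_of_disjoint ha0 ((hVΓ I i).trans hsub) hsep'
          (fun v hv => ht v (hVΓ I i hv)) (hΓV I i hi) hx hw hfw)
        have h1 : infDist x {w ∈ Γ I | f w = 0} ≤ ‖x - w‖ := by
          rw [← dist_eq_norm]
          exact infDist_le_dist_of_mem (show w ∈ {w ∈ Γ I | f w = 0} from ⟨hw, hfw⟩)
        have h2 : 0 < c * q ^ (I.length + (n + 1)) := by positivity
        refine mul_le_mul ?_ (by linarith) hpos (by positivity)
        exact mul_le_mul_of_nonneg_left (pow_le_of_le_one hκ0.le hκ1 (by omega)) ha0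
  set N := vectorSpan ℝ {w ∈ Γ I | f w = 0}
  have hlim : Tendsto (fun n : ℕ => a * κ ^ (Module.finrank ℝ N + 1) *
      (infDist x {w ∈ Γ I | f w = 0} - c * q ^ (I.length + n))) atTop
      (𝓝 (a * κ ^ (Module.finrank ℝ N + 1) * (infDist x {w ∈ Γ I | f w = 0} - c * 0))) := by
    refine ((((tendsto_pow_atTop_nhds_zero_of_lt_one hq0.le hq1).comp ?_).const_mul c).const_sub
      _).const_mul _
    exact tendsto_atTop_mono (fun n => Nat.le_add_left n _) tendsto_id
  have hle := le_of_tendsto' hlim fun n => key n I a ha0 hf hZ hb x hx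
  rw [mul_zero, sub_zero] at hle
  refine le_trans ?_ hle
  refine mul_le_mul_of_nonneg_right ?_ infDist_nonneg
  exact mul_le_mul_of_nonneg_left
    (pow_le_pow_of_le_one hκ0.le hκ1 (Nat.add_le_add_right N.finrank_le 1)) ha0

/-- A similarity is an affine map. -/
lemma exists_affineMap_eq_of_similarity {φ : E → E} {s : ℝ} (hs : 0 < s)
    (hφ : ∀ x y, dist (φ x) (φ y) = s * dist x y) : ∃ A : E →ᵃ[ℝ] E, ⇑A = φ := by
  have hi : Isometry fun x => s⁻¹ • φ x := Isometry.of_dist_eq fun x y => by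
    rw [dist_smul₀, hφ, Real.norm_of_nonneg (by positivity), inv_mul_cancel_left₀ hs.ne']
  refine ⟨s • hi.affineIsometryOfStrictConvexSpace.toAffineMap, ?_⟩
  ext x
  simp [smul_inv_smul₀ hs.ne']

end FaceBound


/-- **Lemma (uniform polytope estimate).** Under conditions (a)–(c) on the set-valued map `Γ`
(driven by finitely many compact sets `K^i_j` with polytopal convex hulls and similarities
`φ^I`), there is `γ > 0` such that for every word `I` and every `x ∈ Γ(I)`,
`dist(x, ∂ conv Γ(I)) ≥ γ · dist(x, Γ(I) ∩ ∂ conv Γ(I))`. -/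
theorem stmt2 (k m d : ℕ) (hk : 1 ≤ k) (hm : 1 ≤ m) (hd : 1 ≤ d)
    (Kij : Fin k → Fin m → Set (EuclideanSpace ℝ (Fin d)))
    (hKc : ∀ i j, IsCompact (Kij i j)) (hKne : ∀ i j, (Kij i j).Nonempty)
    (hKpoly : ∀ i j, ∃ F : Finset (EuclideanSpace ℝ (Fin d)),
      (convexHull ℝ (Kij i j) : Set (EuclideanSpace ℝ (Fin d))) =
        convexHull ℝ (F : Set (EuclideanSpace ℝ (Fin d))))
    (Γ : List (Fin k) → Set (EuclideanSpace ℝ (Fin d)))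
    (hΓc : ∀ I, IsCompact (Γ I)) (hΓne : ∀ I, (Γ I).Nonempty)
    (c q : ℝ) (hc : 0 < c) (hq0 : 0 < q) (hq1 : q < 1)
    (φ : List (Fin k) → EuclideanSpace ℝ (Fin d) → EuclideanSpace ℝ (Fin d))
    (s : List (Fin k) → ℝ) (hs : ∀ I, 0 < s I)
    (hφ : ∀ I x y, dist (φ I x) (φ I y) = s I * dist x y)
    (j : List (Fin k) → Fin m)
    (ha : ∀ I, Γ I = ⋃ i : Fin k, Γ (I ++ [i]))
    (hb : ∀ I (i : Fin k), Γ (I ++ [i]) = φ I '' Kij i (j I))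
    (hdiam : ∀ I, Metric.diam (Γ I) ≤ c * q ^ I.length) :
    ∃ γ : ℝ, 0 < γ ∧ ∀ I : List (Fin k), ∀ x ∈ Γ I,
      Metric.infDist x (frontier (convexHull ℝ (Γ I))) ≥
        γ * Metric.infDist x (Γ I ∩ frontier (convexHull ℝ (Γ I))) := by
  choose F hF using hKpoly
  choose V hVfin hVK hKV using fun i j =>
    exists_finite_subset_convexHull_eq (F i j).finite_toSet (hF i j)
  choose A hA using fun I => exists_affineMap_eq_of_similarity (hs I) (hφ I)
  have hΓL : ∀ I, Γ I = A I '' ⋃ i, Kij i (j I) := fun I => by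
    rw [image_iUnion, ha I]
    exact iUnion_congr fun i => by rw [hb, hA]
  have hLfin : ∀ j, (⋃ i, V i j).Finite := fun j => finite_iUnion fun i => hVfin i j
  have hVL : ∀ j, ⋃ i, V i j ⊆ ⋃ i, Kij i j := fun j => iUnion_mono fun i => hVK i j
  have hLV : ∀ j, ⋃ i, Kij i j ⊆ convexHull ℝ (⋃ i, V i j) := fun j =>
    iUnion_subset fun i => (hKV i j).trans (convexHull_mono (subset_iUnion (fun i => V i j) i))
  have hev := eventually_all.2 fun i => eventually_all.2 fun j =>
    exists_faceSeparated (hLfin j) (hVfin i j) (hVL j) (hLV j)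
      (isCompact_iUnion fun i => hKc i j).isBounded
  obtain ⟨κ, hκ, hκ0, hκ1⟩ := (hev.and (Ioo_mem_nhdsGT one_pos)).exists
  refine ⟨κ ^ (Module.finrank ℝ (EuclideanSpace ℝ (Fin d)) + 1), by positivity, fun I x hx => ?_⟩
  set P := convexHull ℝ (Γ I)
  by_cases hxf : x ∈ frontier P
  · rw [infDist_zero_of_mem (show x ∈ Γ I ∩ frontier P from ⟨hx, hxf⟩), mul_zero]
    exact infDist_nonneg
  rcases (frontier P).eq_empty_or_nonempty with hemp | hne
  · simp [hemp]
  have hxi : x ∈ interior P := by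
    by_contra h
    exact hxf ⟨subset_closure (subset_convexHull ℝ _ hx), h⟩
  obtain ⟨f, hf, ⟨w, hw, hfw⟩, hfP, hb1, hfx⟩ :=
    exists_facet_functional (V := A I '' ⋃ i, V i (j I)) ((hLfin _).image _)
      (by rw [hΓL]; exact image_mono (hVL _))
      (by rw [hΓL, ← AffineMap.image_convexHull]; exact image_mono (hLV _)) hxi hne
  refine le_trans ?_ hfx
  have h := infDist_zeros_le_of_tree (fun I => (hΓc I).isBounded) ha hc hq0 hq1 hdiam
    (V := fun I i => A I '' V i (j I))
    (fun I i => by rw [hb, ← hA]; exact image_mono (hVK _ _))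
    (fun I i => by rw [hb, ← hA, ← AffineMap.image_convexHull]; exact image_mono (hKV _ _))
    hκ0 hκ1.le
    (fun I i f hf => by
      rw [hΓL] at hf ⊢
      refine hκ i (j I) (A I) (s I) (hs I) (fun x y => ?_) f hf
      rw [← dist_eq_norm, ← dist_eq_norm, hA, hφ])
    zero_le_one hf ⟨w, hw, hfw⟩ hb1 hx
  rw [one_mul] at h
  refine le_trans ?_ h
  gcongr
  exact infDist_le_infDist_of_subset (fun v hv => ⟨hv.1, hfP v hv.1 hv.2⟩) ⟨w, hw, hfw⟩
end

section
/- Let n, k ≥ 1 and let K ⊆ ℝ^n be a self-similar set generated by contracting similarities φ_1,…,φ_k such that the convex hull of K is a polytope. Then for every open set S ⊆ ℝ^n with S ∩ K = ∅ that is strictly convex with smooth boundary, the set K ∩ closure(S) is finite. -/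
/-- An open set `S ⊆ ℝⁿ` is strictly convex with smooth boundary: `S` is convex, the open
segment joining any two distinct points of `closure S` lies in `S`, and every frontier point
of `S` admits a unique supporting hyperplane of `closure S` (expressed via a unique supporting
unit functional). -/
def StrictlyConvexSmoothOpen {n : ℕ} (S : Set (EuclideanSpace ℝ (Fin n))) : Prop :=
  IsOpen S ∧ Convex ℝ S ∧
    (∀ x ∈ closure S, ∀ y ∈ closure S, x ≠ y → openSegment ℝ x y ⊆ S) ∧
    (∀ z ∈ frontier S, ∃! f : EuclideanSpace ℝ (Fin n) →L[ℝ] ℝ,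
      ‖f‖ = 1 ∧ ∀ y ∈ closure S, f y ≤ f z)

namespace SelfSimilarPolytope

open Set Filter Topology Module

variable {X : Type*} [NormedAddCommGroup X] [InnerProductSpace ℝ X]

/-- `G` is the (possibly empty) face of `convexHull ℝ V` on which some nonnegative affine
functional vanishes. -/
def IsFace (V : Finset X) (G : Set X) : Prop :=
  ∃ l : X →ᵃ[ℝ] ℝ, (∀ v ∈ V, 0 ≤ l v) ∧ G = {p ∈ convexHull ℝ (V : Set X) | l p = 0}

theorem le_affine_of_mem_convexHull {V : Set X} {l : X →ᵃ[ℝ] ℝ} {c : ℝ}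
    (h : ∀ v ∈ V, c ≤ l v) {p : X} (hp : p ∈ convexHull ℝ V) : c ≤ l p :=
  convexHull_min (t := l ⁻¹' Ici c) h ((convex_Ici c).affine_preimage l) hp

theorem exists_pos_gap {X : Type*} (V : Finset X) (l : X → ℝ) (h0 : ∀ v ∈ V, 0 ≤ l v) :
    ∃ m > 0, ∀ v ∈ V, l v = 0 ∨ m ≤ l v := by
  have : ∀ᶠ m in 𝓝[>] (0 : ℝ), ∀ v ∈ V, l v = 0 ∨ m ≤ l v := by
    rw [eventually_all_finset]
    intro v hv
    rcases (h0 v hv).eq_or_lt with h | h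
    · exact Eventually.of_forall fun _ => Or.inl h.symm
    · filter_upwards [Ioo_mem_nhdsGT h] with m hm using Or.inr hm.2.le
  obtain ⟨m, hm, hm0⟩ := (this.and self_mem_nhdsWithin).exists
  exact ⟨m, hm0, hm⟩

theorem exists_face_point_near {V : Finset X} {l : X →ᵃ[ℝ] ℝ} {D m : ℝ}
    (hD : ∀ p ∈ convexHull ℝ (V : Set X), ∀ q ∈ convexHull ℝ (V : Set X), dist p q ≤ D)
    (hm0 : 0 ≤ m) (hm : ∀ v ∈ V, l v = 0 ∨ m ≤ l v) {v₀ : X} (hv₀ : v₀ ∈ V) (hlv₀ : l v₀ = 0)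
    {p : X} (hp : p ∈ convexHull ℝ (V : Set X)) :
    ∃ q ∈ convexHull ℝ (V : Set X), l q = 0 ∧ m * dist p q ≤ D * l p := by
  have hVs : (V : Set X) ⊆ convexHull ℝ (V : Set X) := subset_convexHull ℝ _
  have hD0 : 0 ≤ D := dist_nonneg.trans (hD v₀ (hVs hv₀) v₀ (hVs hv₀))
  refine convexHull_min (t := {p | ∃ q ∈ convexHull ℝ (V : Set X), l q = 0 ∧
    m * dist p q ≤ D * l p}) ?_ ?_ hp
  · intro v hv
    rcases hm v hv with h | h
    · exact ⟨v, hVs hv, h, by simp [h]⟩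
    · exact ⟨v₀, hVs hv₀, hlv₀, by
        have := hD v (hVs hv) v₀ (hVs hv₀)
        calc m * dist v v₀ ≤ m * D := by gcongr
          _ ≤ D * l v := by rw [mul_comm]; gcongr⟩
  · rintro x ⟨q, hq, hlq, h1⟩ x' ⟨q', hq', hlq', h2⟩ a b ha hb hab
    refine ⟨a • q + b • q', convex_convexHull ℝ _ hq hq' ha hb hab, ?_, ?_⟩
    · rw [Convex.combo_affine_apply hab, hlq, hlq']; simp
    · rw [Convex.combo_affine_apply hab]
      have : dist (a • x + b • x') (a • q + b • q') ≤ a * dist x q + b * dist x' q' := by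
        refine (dist_add_add_le _ _ _ _).trans ?_
        rw [dist_smul₀, dist_smul₀, Real.norm_of_nonneg ha, Real.norm_of_nonneg hb]
      simp only [smul_eq_mul]
      have h3 := mul_le_mul_of_nonneg_left this hm0
      have h4 := mul_le_mul_of_nonneg_left h1 ha
      have h5 := mul_le_mul_of_nonneg_left h2 hb
      nlinarith

theorem isFace_eq_convexHull {V : Finset X} {l : X →ᵃ[ℝ] ℝ} (h0 : ∀ v ∈ V, 0 ≤ l v) :
    {p ∈ convexHull ℝ (V : Set X) | l p = 0} = convexHull ℝ {v ∈ (V : Set X) | l v = 0} := by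
  apply Subset.antisymm
  · rintro p ⟨hp, hlp⟩
    have : p ∈ {p | 0 < l p ∨ (l p = 0 ∧ p ∈ convexHull ℝ {v ∈ (V : Set X) | l v = 0})} := by
      refine convexHull_min ?_ ?_ hp
      · intro v hv
        rcases (h0 v hv).eq_or_lt with h | h
        · exact Or.inr ⟨h.symm, subset_convexHull ℝ _ ⟨hv, h.symm⟩⟩
        · exact Or.inl h
      · rw [convex_iff_forall_pos]
        rintro x hx y hy a b ha hb hab
        simp only [mem_ofPred_eq, Convex.combo_affine_apply hab, smul_eq_mul] at hx hy ⊢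
        rcases hx with hx | ⟨hx, hx'⟩ <;> rcases hy with hy | ⟨hy, hy'⟩
        · left; positivity
        · left; rw [hy]; nlinarith [mul_pos ha hx]
        · left; rw [hx]; nlinarith [mul_pos hb hy]
        · right
          exact ⟨by rw [hx, hy]; ring, convex_convexHull ℝ _ hx' hy' ha.le hb.le hab⟩
    rcases this with h | h
    · exact absurd hlp h.ne'
    · exact h.2
  · refine convexHull_min (fun v hv => ⟨subset_convexHull ℝ _ hv.1, hv.2⟩) ?_
    exact (convex_convexHull ℝ _).inter ((convex_singleton (0 : ℝ)).affine_preimage l)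

theorem finite_faces (V : Finset X) : {G | IsFace V G}.Finite := by
  refine (V.finite_toSet.finite_subsets.image (fun T => convexHull ℝ T)).subset ?_
  rintro G ⟨l, h0, rfl⟩
  exact ⟨{v ∈ (V : Set X) | l v = 0}, fun v hv => hv.1, (isFace_eq_convexHull h0).symm⟩

theorem IsFace.inter {V : Finset X} {G H : Set X} (hG : IsFace V G) (hH : IsFace V H) :
    IsFace V (G ∩ H) := by
  obtain ⟨l, hl, rfl⟩ := hG
  obtain ⟨m, hm, rfl⟩ := hH
  refine ⟨l + m, fun v hv => add_nonneg (hl v hv) (hm v hv), ?_⟩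
  ext p
  have hlm : (l + m) p = l p + m p := rfl
  simp only [mem_inter_iff, mem_ofPred_eq, hlm]
  constructor
  · rintro ⟨⟨hp, h1⟩, _, h2⟩
    exact ⟨hp, by rw [h1, h2, add_zero]⟩
  · rintro ⟨hp, h⟩
    have h1 := le_affine_of_mem_convexHull hl hp
    have h2 := le_affine_of_mem_convexHull hm hp
    exact ⟨⟨hp, by linarith⟩, hp, by linarith⟩

theorem isFace_convexHull (V : Finset X) : IsFace V (convexHull ℝ (V : Set X)) :=
  ⟨0, by simp, by simp⟩

theorem IsFace.convex {V : Finset X} {G : Set X} (hG : IsFace V G) : Convex ℝ G := by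
  obtain ⟨l, -, rfl⟩ := hG
  exact (convex_convexHull ℝ _).inter ((convex_singleton (0 : ℝ)).affine_preimage l)

theorem IsFace.preimage {V : Finset X} {G : Set X} (hG : IsFace V G) (T : X →ᵃ[ℝ] X)
    (hT : MapsTo T (convexHull ℝ (V : Set X)) (convexHull ℝ (V : Set X))) :
    IsFace V {p ∈ convexHull ℝ (V : Set X) | T p ∈ G} := by
  obtain ⟨l, hl, rfl⟩ := hG
  refine ⟨l.comp T, fun v hv => ?_, ?_⟩
  · exact le_affine_of_mem_convexHull hl (hT (subset_convexHull ℝ _ hv))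
  · ext p
    simp only [mem_ofPred_eq, AffineMap.comp_apply]
    exact ⟨fun h => ⟨h.1, h.2.2⟩, fun h => ⟨h.1, hT h.1, h.2⟩⟩

theorem exists_lipschitz_affine [FiniteDimensional ℝ X] (l : X →ᵃ[ℝ] ℝ) :
    ∃ C > 0, ∀ x y, l x - l y ≤ C * dist x y := by
  refine ⟨‖l.linear.toContinuousLinearMap‖ + 1, by positivity, fun x y => ?_⟩
  have h1 : l x - l y = l.linear.toContinuousLinearMap (x - y) := by
    simpa using (l.linearMap_vsub x y).symm
  rw [h1, dist_eq_norm]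
  have := (le_abs_self _).trans (l.linear.toContinuousLinearMap.le_opNorm (x - y))
  nlinarith [norm_nonneg (x - y)]

theorem eq_zero_of_mem_affineSpan {H : Set X} {l : X →ᵃ[ℝ] ℝ} (h : ∀ p ∈ H, l p = 0) {q : X}
    (hq : q ∈ affineSpan ℝ H) : l q = 0 := by
  have : affineSpan ℝ H ≤ (AffineSubspace.mk' (0 : ℝ) ⊥).comap l := by
    rw [affineSpan_le]
    intro p hp
    simp [h p hp]
  simpa using this hq

theorem finrank_vectorSpan_image {T : X →ᵃ[ℝ] X} (hT : Function.Injective T) (G : Set X) :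
    finrank ℝ (vectorSpan ℝ (T '' G)) = finrank ℝ (vectorSpan ℝ G) := by
  rw [← AffineMap.map_vectorSpan]
  exact (LinearEquiv.finrank_eq (Submodule.equivMapOfInjective _
    ((T.linear_injective_iff).2 hT) _)).symm

/-- A finite family of contracting similarities mapping `convexHull ℝ V` into itself. -/
structure IsContractingSystem {ι : Type*} (V : Finset X) (Φ : ι → X →ᵃ[ℝ] X) (r : ι → ℝ)
    (ρ : ℝ) : Prop where
  pos : ∀ i, 0 < r i
  le : ∀ i, r i ≤ ρ
  lt_one : ρ < 1
  nonneg : 0 ≤ ρ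
  dist_eq : ∀ i x y, dist (Φ i x) (Φ i y) = r i * dist x y
  mapsTo : ∀ i, MapsTo (Φ i) (convexHull ℝ (V : Set X)) (convexHull ℝ (V : Set X))

/-- `T` is a finite composition of the maps `Φ i`, and `s` is its similarity ratio. -/
inductive IsCell {ι : Type*} (Φ : ι → X →ᵃ[ℝ] X) (r : ι → ℝ) : (X →ᵃ[ℝ] X) → ℝ → Prop
  | id : IsCell Φ r (AffineMap.id ℝ X) 1
  | comp {T : X →ᵃ[ℝ] X} {s : ℝ} (h : IsCell Φ r T s) (i : ι) :
      IsCell Φ r (T.comp (Φ i)) (s * r i)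

section Cells

variable {ι : Type*} {V : Finset X} {Φ : ι → X →ᵃ[ℝ] X} {r : ι → ℝ} {ρ : ℝ}

theorem IsCell.pos (hS : IsContractingSystem V Φ r ρ) {T : X →ᵃ[ℝ] X} {s : ℝ}
    (hT : IsCell Φ r T s) : 0 < s := by
  induction hT with
  | id => exact one_pos
  | comp h i ih => exact mul_pos ih (hS.pos i)

theorem IsCell.dist_eq (hS : IsContractingSystem V Φ r ρ) {T : X →ᵃ[ℝ] X} {s : ℝ}
    (hT : IsCell Φ r T s) (x y : X) : dist (T x) (T y) = s * dist x y := by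
  induction hT generalizing x y with
  | id => simp
  | comp h i ih => simp only [AffineMap.comp_apply, ih, hS.dist_eq]; ring

theorem IsCell.injective (hS : IsContractingSystem V Φ r ρ) {T : X →ᵃ[ℝ] X} {s : ℝ}
    (hT : IsCell Φ r T s) : Function.Injective T := by
  intro x y h
  have := hT.dist_eq hS x y
  rw [h, dist_self] at this
  exact dist_eq_zero.1 ((mul_eq_zero.1 this.symm).resolve_left (hT.pos hS).ne')

theorem IsCell.mapsTo {A : Set X} (hA : ∀ i, MapsTo (Φ i) A A) {T : X →ᵃ[ℝ] X} {s : ℝ}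
    (hT : IsCell Φ r T s) : MapsTo T A A := by
  induction hT with
  | id => exact fun x hx => hx
  | comp h i ih => exact fun x hx => ih (hA i hx)

theorem IsContractingSystem.injective (hS : IsContractingSystem V Φ r ρ) (i : ι) :
    Function.Injective (Φ i) := by
  intro x y h
  have := hS.dist_eq i x y
  rw [h, dist_self] at this
  exact dist_eq_zero.1 ((mul_eq_zero.1 this.symm).resolve_left (hS.pos i).ne')

/-- Linear regularity of the pairs (first level cell, affine span of a face), with a uniform
constant. -/
theorem exists_regularity_constant [FiniteDimensional ℝ X] [Finite ι]
    (hS : IsContractingSystem V Φ r ρ) {D : ℝ} (hD0 : 0 < D)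
    (hD : ∀ p ∈ convexHull ℝ (V : Set X), ∀ q ∈ convexHull ℝ (V : Set X), dist p q ≤ D) :
    ∃ κ > 0, κ ≤ 1 ∧ ∀ G, IsFace V G → ∀ i, ∀ p ∈ convexHull ℝ (V : Set X),
      ∀ q ∈ affineSpan ℝ G,
        (∃ q' ∈ convexHull ℝ (V : Set X), Φ i q' ∈ G ∧ κ * dist p q' ≤ dist (Φ i p) q) ∨
        ((∀ q' ∈ convexHull ℝ (V : Set X), Φ i q' ∉ G) ∧ κ ≤ dist (Φ i p) q) := by
  have key : ∀ᶠ κ in 𝓝[>] (0 : ℝ), ∀ G ∈ {G | IsFace V G}, ∀ i, ∀ p ∈ convexHull ℝ (V : Set X),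
      ∀ q ∈ affineSpan ℝ G,
        (∃ q' ∈ convexHull ℝ (V : Set X), Φ i q' ∈ G ∧ κ * dist p q' ≤ dist (Φ i p) q) ∨
        ((∀ q' ∈ convexHull ℝ (V : Set X), Φ i q' ∉ G) ∧ κ ≤ dist (Φ i p) q) := by
    rw [eventually_all_finite (finite_faces V)]
    rintro G ⟨l, hl, rfl⟩
    rw [eventually_all]
    intro i
    obtain ⟨C, hC0, hC⟩ := exists_lipschitz_affine l
    have hl' : ∀ v ∈ V, 0 ≤ l.comp (Φ i) v := fun v hv =>
      le_affine_of_mem_convexHull hl (hS.mapsTo i (subset_convexHull ℝ _ hv))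
    obtain ⟨m, hm0, hm⟩ := exists_pos_gap V (l.comp (Φ i)) hl'
    have hlq : ∀ q ∈ affineSpan ℝ {p ∈ convexHull ℝ (V : Set X) | l p = 0}, l q = 0 :=
      fun q hq => eq_zero_of_mem_affineSpan (fun p hp => hp.2) hq
    by_cases hne : ∃ v₀ ∈ V, l.comp (Φ i) v₀ = 0
    · obtain ⟨v₀, hv₀, hlv₀⟩ := hne
      filter_upwards [Ioo_mem_nhdsGT (show 0 < m / (D * C) by positivity)] with κ hκ p hp q hq
      left
      obtain ⟨q', hq', hlq', h⟩ := exists_face_point_near hD hm0.le hm hv₀ hlv₀ hp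
      refine ⟨q', hq', ⟨hS.mapsTo i hq', hlq'⟩, ?_⟩
      have h1 := hC (Φ i p) q
      rw [hlq q hq, sub_zero] at h1
      have h2 : κ * (D * C) ≤ m := ((lt_div_iff₀ (by positivity)).1 hκ.2).le
      have h3 : D * l.comp (Φ i) p ≤ D * (C * dist (Φ i p) q) := by
        gcongr; exact h1
      have h4 := mul_le_mul_of_nonneg_right h2 (dist_nonneg (x := p) (y := q'))
      have h5 : (D * C) * (κ * dist p q') ≤ (D * C) * dist (Φ i p) q := by linarith
      exact le_of_mul_le_mul_left h5 (by positivity)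
    · push Not at hne
      filter_upwards [Ioo_mem_nhdsGT (show 0 < m / C by positivity)] with κ hκ p hp q hq
      right
      have hlb : ∀ p ∈ convexHull ℝ (V : Set X), m ≤ l (Φ i p) := fun p hp =>
        le_affine_of_mem_convexHull (l := l.comp (Φ i))
          (fun v hv => (hm v hv).resolve_left (hne v hv)) hp
      refine ⟨fun q' hq' h => ?_, ?_⟩
      · have := hlb q' hq'
        linarith [h.2]
      · have h1 := hC (Φ i p) q
        rw [hlq q hq, sub_zero] at h1
        have h2 : κ * C ≤ m := ((lt_div_iff₀ hC0).1 hκ.2).le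
        have h5 : C * κ ≤ C * dist (Φ i p) q := by linarith [hlb p hp]
        exact le_of_mul_le_mul_left h5 hC0
  obtain ⟨κ, hκ, hκ0⟩ := (key.and (Ioo_mem_nhdsGT (one_pos : (0 : ℝ) < 1))).exists
  exact ⟨κ, hκ0.1, hκ0.2.le, hκ⟩

/-- The functional `l` grows at rate at least `c` away from the affine span of its zero set in
`convexHull ℝ V`. -/
def GrowsFromZeros (V : Finset X) (c : ℝ) (l : X →ᵃ[ℝ] ℝ) : Prop :=
  ∀ p ∈ convexHull ℝ (V : Set X),
    ∃ q ∈ affineSpan ℝ {x ∈ convexHull ℝ (V : Set X) | l x = 0}, c * dist p q ≤ l p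

theorem GrowsFromZeros.comp [FiniteDimensional ℝ X] (hS : IsContractingSystem V Φ r ρ)
    {κ : ℝ} (hκ0 : 0 < κ) (hκ1 : κ ≤ 1) (hκ : ∀ G, IsFace V G → ∀ i, ∀ p ∈ convexHull ℝ (V : Set X),
      ∀ q ∈ affineSpan ℝ G,
        (∃ q' ∈ convexHull ℝ (V : Set X), Φ i q' ∈ G ∧ κ * dist p q' ≤ dist (Φ i p) q) ∨
        ((∀ q' ∈ convexHull ℝ (V : Set X), Φ i q' ∉ G) ∧ κ ≤ dist (Φ i p) q))
    {l : X →ᵃ[ℝ] ℝ} (hl : ∀ v ∈ V, 0 ≤ l v) {c : ℝ} (hc : 0 ≤ c)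
    (h : GrowsFromZeros V
      (c * κ ^ (finrank ℝ X - finrank ℝ (vectorSpan ℝ {x ∈ convexHull ℝ (V : Set X) | l x = 0}))) l)
    (i : ι) (hne : ∃ x ∈ convexHull ℝ (V : Set X), l (Φ i x) = 0) :
    GrowsFromZeros V (c * r i * κ ^ (finrank ℝ X -
      finrank ℝ (vectorSpan ℝ {x ∈ convexHull ℝ (V : Set X) | l.comp (Φ i) x = 0})))
      (l.comp (Φ i)) := by
  set H := {x ∈ convexHull ℝ (V : Set X) | l x = 0} with hH
  set H' := {x ∈ convexHull ℝ (V : Set X) | l.comp (Φ i) x = 0} with hH'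
  have hface : IsFace V H := ⟨l, hl, rfl⟩
  have himage : Φ i '' H' ⊆ H := by
    rintro _ ⟨x, hx, rfl⟩
    exact ⟨hS.mapsTo i hx.1, hx.2⟩
  have hfr : finrank ℝ (vectorSpan ℝ (Φ i '' H')) = finrank ℝ (vectorSpan ℝ H') :=
    finrank_vectorSpan_image (hS.injective i) H'
  have hle : vectorSpan ℝ (Φ i '' H') ≤ vectorSpan ℝ H := vectorSpan_mono ℝ himage
  have hfle := Submodule.finrank_mono hle
  have hHX := Submodule.finrank_le (vectorSpan ℝ H)
  have hri := hS.pos i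
  have hri1 : r i ≤ 1 := (hS.le i).trans hS.lt_one.le
  intro p hp
  obtain ⟨q, hq, hcq⟩ := h (Φ i p) (hS.mapsTo i hp)
  rcases (hfr ▸ hfle).eq_or_lt with heq | hlt
  · have hspan : affineSpan ℝ (Φ i '' H') = affineSpan ℝ H := by
      apply AffineSubspace.eq_of_direction_eq_of_nonempty_of_le
      · rw [direction_affineSpan, direction_affineSpan]
        exact Submodule.eq_of_le_of_finrank_eq hle (hfr.trans heq)
      · obtain ⟨x, hx, hlx⟩ := hne
        exact ⟨Φ i x, subset_affineSpan ℝ _ ⟨x, ⟨hx, hlx⟩, rfl⟩⟩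
      · exact affineSpan_mono ℝ himage
    rw [← hspan, ← AffineSubspace.map_span] at hq
    obtain ⟨q', hq', rfl⟩ := hq
    refine ⟨q', hq', ?_⟩
    rw [hS.dist_eq, ← heq] at hcq
    rw [AffineMap.comp_apply]
    linarith
  · obtain ⟨x, hx, hlx⟩ := hne
    rcases hκ H hface i p hp q hq with ⟨q', hq', hq'H, hd⟩ | ⟨hno, -⟩
    · refine ⟨q', subset_affineSpan ℝ _ ⟨hq', hq'H.2⟩, ?_⟩
      rw [AffineMap.comp_apply]
      refine le_trans ?_ hcq
      have hpow : κ ^ (finrank ℝ X - finrank ℝ (vectorSpan ℝ H')) ≤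
          κ ^ (finrank ℝ X - finrank ℝ (vectorSpan ℝ H)) * κ := by
        rw [← pow_succ]
        exact pow_le_pow_of_le_one hκ0.le hκ1 (by omega)
      calc c * r i * κ ^ (finrank ℝ X - finrank ℝ (vectorSpan ℝ H')) * dist p q'
          ≤ c * 1 * (κ ^ (finrank ℝ X - finrank ℝ (vectorSpan ℝ H)) * κ) * dist p q' := by
            gcongr
        _ = c * κ ^ (finrank ℝ X - finrank ℝ (vectorSpan ℝ H)) * (κ * dist p q') := by ring
        _ ≤ _ := by gcongr
    · exact absurd ⟨hS.mapsTo i hx, hlx⟩ (hno x hx)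

/-- If `y` is not on the zero face of `l`, some cell around `y` still meets that face while `y`
is far from it relative to the size of the cell. -/
theorem exists_cell_separating [FiniteDimensional ℝ X] (hS : IsContractingSystem V Φ r ρ)
    {D : ℝ} (hD : ∀ p ∈ convexHull ℝ (V : Set X), ∀ q ∈ convexHull ℝ (V : Set X), dist p q ≤ D)
    {K : Set X} (hKV : K ⊆ convexHull ℝ (V : Set X)) (hK : ∀ x ∈ K, ∃ i, ∃ x' ∈ K, Φ i x' = x)
    {κ : ℝ} (hκ0 : 0 < κ) (hκ1 : κ ≤ 1) (hκ : ∀ G, IsFace V G → ∀ i, ∀ p ∈ convexHull ℝ (V : Set X),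
      ∀ q ∈ affineSpan ℝ G,
        (∃ q' ∈ convexHull ℝ (V : Set X), Φ i q' ∈ G ∧ κ * dist p q' ≤ dist (Φ i p) q) ∨
        ((∀ q' ∈ convexHull ℝ (V : Set X), Φ i q' ∉ G) ∧ κ ≤ dist (Φ i p) q))
    {l : X →ᵃ[ℝ] ℝ} (hl : ∀ v ∈ V, 0 ≤ l v) {c : ℝ} (hc : 0 ≤ c) (h : GrowsFromZeros V c l)
    (hne : ∃ x ∈ convexHull ℝ (V : Set X), l x = 0) {y : X} (hy : y ∈ K) (hly : 0 < l y) :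
    ∃ T s, IsCell Φ r T s ∧ (∃ y' ∈ K, T y' = y) ∧
      (∃ p ∈ convexHull ℝ (V : Set X), l (T p) = 0) ∧
      c * κ ^ (finrank ℝ X + 1) * s ≤ l y := by
  by_contra! hcon
  have track : ∀ N : ℕ, ∃ T s, IsCell Φ r T s ∧ s ≤ ρ ^ N ∧ (∃ y' ∈ K, T y' = y) ∧
      (∃ p ∈ convexHull ℝ (V : Set X), l (T p) = 0) ∧
      GrowsFromZeros V (c * s * κ ^ (finrank ℝ X - finrank ℝ (vectorSpan ℝ
        {x ∈ convexHull ℝ (V : Set X) | l.comp T x = 0}))) (l.comp T) := by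
    intro N
    induction N with
    | zero =>
      refine ⟨AffineMap.id ℝ X, 1, .id, by simp, ⟨y, hy, rfl⟩, hne, ?_⟩
      rw [AffineMap.comp_id]
      intro p hp
      obtain ⟨q, hq, hcq⟩ := h p hp
      refine ⟨q, hq, le_trans ?_ hcq⟩
      have := pow_le_one₀ (n := finrank ℝ X - finrank ℝ (vectorSpan ℝ
        {x ∈ convexHull ℝ (V : Set X) | l x = 0})) hκ0.le hκ1
      calc _ ≤ c * 1 * 1 * dist p q := by gcongr
        _ = c * dist p q := by ring
    | succ N ih =>
      obtain ⟨T, s, hT, hs, ⟨y', hy', rfl⟩, hp, hgrow⟩ := ih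
      have hs0 := hT.pos hS
      obtain ⟨i, y'', hy'', rfl⟩ := hK y' hy'
      have hTl : ∀ v ∈ V, 0 ≤ l.comp T v := fun v hv =>
        le_affine_of_mem_convexHull hl (hT.mapsTo hS.mapsTo (subset_convexHull ℝ _ hv))
      have hne' : ∃ x ∈ convexHull ℝ (V : Set X), l.comp T (Φ i x) = 0 := by
        by_contra! hno
        obtain ⟨q, hq, hcq⟩ := hgrow (Φ i y'') (hS.mapsTo i (hKV hy''))
        rcases hκ _ ⟨l.comp T, hTl, rfl⟩ i y'' (hKV hy'') q hq with ⟨q', hq', h1, -⟩ | ⟨-, h1⟩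
        · exact hno q' hq' h1.2
        · refine (hcon T s hT ⟨_, hy', rfl⟩ hp).not_ge (le_trans ?_ hcq)
          have hpow : κ ^ finrank ℝ X ≤ κ ^ (finrank ℝ X - finrank ℝ (vectorSpan ℝ
              {x ∈ convexHull ℝ (V : Set X) | l.comp T x = 0})) :=
            pow_le_pow_of_le_one hκ0.le hκ1 (Nat.sub_le _ _)
          calc c * κ ^ (finrank ℝ X + 1) * s = c * s * κ ^ finrank ℝ X * κ := by ring
            _ ≤ _ := by gcongr
      refine ⟨T.comp (Φ i), s * r i, hT.comp i, ?_, ⟨y'', hy'', rfl⟩, hne', ?_⟩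
      · rw [pow_succ]
        exact mul_le_mul hs (hS.le i) (hS.pos i).le (pow_nonneg hS.nonneg _)
      · have := hgrow.comp hS hκ0 hκ1 hκ hTl (mul_nonneg hc hs0.le) i hne'
        rw [AffineMap.comp_assoc, mul_assoc c] at this
        exact this
  obtain ⟨C, hC0, hC⟩ := exists_lipschitz_affine l
  have hlim : Tendsto (fun N : ℕ => C * (ρ ^ N * D)) atTop (𝓝 (C * (0 * D))) :=
    ((tendsto_pow_atTop_nhds_zero_of_lt_one hS.nonneg hS.lt_one).mul_const D).const_mul C
  rw [zero_mul, mul_zero] at hlim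
  obtain ⟨N, hN⟩ := (hlim.eventually (gt_mem_nhds hly)).exists
  obtain ⟨T, s, hT, hs, ⟨y', hy', rfl⟩, ⟨p, hp, hlp⟩, -⟩ := track N
  have h1 := hC (T y') (T p)
  rw [hlp, sub_zero, hT.dist_eq hS] at h1
  have h2 : s * dist y' p ≤ ρ ^ N * D :=
    mul_le_mul hs (hD y' (hKV hy') p hp) dist_nonneg (pow_nonneg hS.nonneg _)
  have h3 := mul_le_mul_of_nonneg_left h2 hC0.le
  linarith

end Cells

theorem exists_tilt_constant (V : Finset X) :
    ∃ C > 0, ∀ T ⊆ V, T.Nonempty → ∀ (L : X →ₗ[ℝ] ℝ) (η : ℝ), 0 ≤ η →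
      (∀ p ∈ T, ∀ q ∈ T, |L (p - q)| ≤ η) →
        ∀ a ∈ vectorSpan ℝ (T : Set X), |L a| ≤ C * η * ‖a‖ := by
  have key : ∀ᶠ C in atTop, ∀ T ∈ V.powerset, T.Nonempty → ∀ (L : X →ₗ[ℝ] ℝ) (η : ℝ), 0 ≤ η →
      (∀ p ∈ T, ∀ q ∈ T, |L (p - q)| ≤ η) →
        ∀ a ∈ vectorSpan ℝ (T : Set X), |L a| ≤ C * η * ‖a‖ := by
    rw [eventually_all_finset]
    intro T _
    by_cases hne : T.Nonempty
    swap
    · exact Eventually.of_forall fun _ h => absurd h hne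
    obtain ⟨p₀, hp₀⟩ := hne
    set A : (T → ℝ) →ₗ[ℝ] X := Fintype.linearCombination ℝ (fun p : T => (p : X) - p₀) with hA
    have hrange : vectorSpan ℝ (T : Set X) = LinearMap.range A := by
      rw [vectorSpan_eq_span_vsub_set_right ℝ (p := p₀) (by simpa using hp₀), hA,
        Fintype.range_linearCombination]
      congr 1
      ext x
      simp
    obtain ⟨R, hR⟩ := A.rangeRestrict.exists_rightInverse_of_surjective A.range_rangeRestrict
    filter_upwards [eventually_ge_atTop (T.card * ‖R.toContinuousLinearMap‖)] with C hC _ L η hη hL a ha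
    rw [hrange] at ha
    set c := R ⟨a, ha⟩ with hc
    have hAc : A c = a := by
      have := LinearMap.congr_fun hR ⟨a, ha⟩
      simpa using congrArg Subtype.val this
    have hcn : ‖c‖ ≤ ‖R.toContinuousLinearMap‖ * ‖a‖ :=
      R.toContinuousLinearMap.le_opNorm ⟨a, ha⟩
    have hLa : L a = ∑ p : T, c p * L ((p : X) - p₀) := by
      rw [← hAc, hA, Fintype.linearCombination_apply, map_sum]
      simp
    rw [hLa]
    calc |∑ p : T, c p * L ((p : X) - p₀)| ≤ ∑ p : T, |c p * L ((p : X) - p₀)| :=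
          Finset.abs_sum_le_sum_abs _ _
      _ ≤ ∑ p : T, ‖R.toContinuousLinearMap‖ * ‖a‖ * η := by
          refine Finset.sum_le_sum fun p _ => ?_
          rw [abs_mul]
          exact mul_le_mul ((norm_le_pi_norm c p).trans hcn) (hL p p.2 p₀ hp₀) (abs_nonneg _)
            (by positivity)
      _ = T.card * ‖R.toContinuousLinearMap‖ * η * ‖a‖ := by
          simp; ring
      _ ≤ C * η * ‖a‖ := by gcongr
  obtain ⟨C, hC, hC0⟩ := (key.and (eventually_gt_atTop 0)).exists
  exact ⟨C, hC0, fun T hT => hC T (Finset.mem_powerset.2 hT)⟩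

theorem exists_stable_threshold {X : Type*} (V : Finset X) {τ : ℕ → Finset X} (hτ : ∀ j, τ j ⊆ V)
    (hmono : ∀ j, τ j ⊆ τ (j + 1)) : ∃ k ≤ V.card, τ (k + 1) ⊆ τ k := by
  by_contra! h
  have hcard : ∀ j ≤ V.card + 1, j ≤ (τ j).card := by
    intro j
    induction j with
    | zero => simp
    | succ j ih =>
      intro hj
      have h1 := ih (by omega)
      have h2 : (τ j).card < (τ (j + 1)).card :=
        Finset.card_lt_card ⟨hmono j, h j (by omega)⟩
      omega
  have h1 := hcard _ le_rfl
  have h2 := Finset.card_le_card (hτ (V.card + 1))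
  omega

/-- If `y` almost minimizes `g` on every cell around it, relative to the size of the cell, then
`y` lies exactly on a face along which `g` is almost constant. -/
theorem exists_flat_face [FiniteDimensional ℝ X] {ι : Type*} [Finite ι] {V : Finset X}
    {Φ : ι → X →ᵃ[ℝ] X} {r : ι → ℝ} {ρ : ℝ} (hS : IsContractingSystem V Φ r ρ) {D : ℝ}
    (hD0 : 0 < D)
    (hD : ∀ p ∈ convexHull ℝ (V : Set X), ∀ q ∈ convexHull ℝ (V : Set X), dist p q ≤ D)
    (hV : V.Nonempty) {K : Set X} (hKV : K ⊆ convexHull ℝ (V : Set X))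
    (hK : ∀ x ∈ K, ∃ i, ∃ x' ∈ K, Φ i x' = x) :
    ∃ M > 0, ∀ (g : X →ᵃ[ℝ] ℝ) (δ : ℝ), 0 < δ → ∀ y ∈ K,
      (∀ T s, IsCell Φ r T s → (∃ y' ∈ K, T y' = y) → ∀ v ∈ V, g y - δ * s ≤ g (T v)) →
      ∃ G, IsFace V G ∧ y ∈ G ∧ ∀ a ∈ vectorSpan ℝ G, |g.linear a| ≤ M * δ * ‖a‖ := by
  obtain ⟨C, hC0, hC⟩ := exists_tilt_constant V
  obtain ⟨κ, hκ0, hκ1, hκ⟩ := exists_regularity_constant hS hD0 hD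
  set M' : ℝ := D * (C * D + 2) / κ ^ (finrank ℝ X + 1) with hM'
  have hM'0 : 0 < M' := by positivity
  set M : ℝ := 1 + C * D + M' with hM
  have hM1 : 1 ≤ M := by
    have : 0 < C * D := by positivity
    linarith
  refine ⟨C * M ^ V.card, by positivity, fun g δ hδ y hy hNM => ?_⟩
  obtain ⟨v₀, hv₀, hmin⟩ := V.exists_min_image g hV
  obtain ⟨k, hk, hgap⟩ := exists_stable_threshold V
    (τ := fun j => {v ∈ V | g v ≤ g v₀ + δ * M ^ j}) (fun j => Finset.filter_subset _ _)
    (fun j v hv => by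
      rw [Finset.mem_filter] at hv ⊢
      refine ⟨hv.1, hv.2.trans ?_⟩
      gcongr
      omega)
  set η := δ * M ^ k with hη
  have hδη : δ ≤ η := by
    have := one_le_pow₀ hM1 (n := k)
    nlinarith
  have hη0 : 0 < η := hδ.trans_le hδη
  set T : Finset X := {v ∈ V | g v ≤ g v₀ + η} with hT
  have hTV : T ⊆ V := Finset.filter_subset _ _
  have hv₀T : v₀ ∈ T := by
    rw [hT, Finset.mem_filter]
    exact ⟨hv₀, by linarith⟩
  have hgT : ∀ v ∈ V, v ∉ T → g v₀ + η * M < g v := by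
    intro v hv hvT
    by_contra! hle
    refine hvT (hgap ?_)
    rw [Finset.mem_filter]
    refine ⟨hv, hle.trans (le_of_eq ?_)⟩
    rw [hη]
    ring
  have hglin : ∀ x y, g.linear (x - y) = g x - g y := fun x y => by
    simpa using g.linearMap_vsub x y
  have htilt : ∀ a ∈ vectorSpan ℝ (T : Set X), |g.linear a| ≤ C * η * ‖a‖ := by
    refine hC T hTV ⟨v₀, hv₀T⟩ g.linear η hη0.le fun p hp q hq => ?_
    rw [hglin, abs_le]
    rw [hT, Finset.mem_filter] at hp hq
    have h1 := hmin p hp.1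
    have h2 := hmin q hq.1
    constructor <;> linarith
  set W := vectorSpan ℝ (T : Set X) with hW
  have hproj : ∀ a, |g.linear (W.starProjection a)| ≤ C * η * ‖a‖ := fun a =>
    (htilt _ (W.starProjection_apply_mem a)).trans
      (mul_le_mul_of_nonneg_left (W.norm_starProjection_apply_le a) (by positivity))
  set L : X →ₗ[ℝ] ℝ := g.linear - g.linear ∘ₗ (W.starProjection : X →ₗ[ℝ] X) with hL
  have hLapp : ∀ a, L a = g.linear a - g.linear (W.starProjection a) := fun a => rfl
  set l : X →ᵃ[ℝ] ℝ := L.toAffineMap - AffineMap.const ℝ X (L v₀) with hl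
  have hlapp : ∀ x, l x = L x - L v₀ := fun x => rfl
  have hlT : ∀ v ∈ T, l v = 0 := by
    intro v hv
    rw [hlapp, ← map_sub, hLapp, Submodule.starProjection_eq_self_iff.2, sub_self]
    exact vsub_mem_vectorSpan ℝ hv hv₀T
  have hVs : (V : Set X) ⊆ convexHull ℝ (V : Set X) := subset_convexHull ℝ _
  have hlT' : ∀ v ∈ V, v ∉ T → η * M' ≤ l v := by
    intro v hv hvT
    rw [hlapp, ← map_sub, hLapp, hglin]
    have h1 := hgT v hv hvT
    have h2 := (le_abs_self _).trans (hproj (v - v₀))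
    have h3 : C * η * ‖v - v₀‖ ≤ C * η * D := by
      rw [← dist_eq_norm]
      gcongr
      exact hD v (hVs hv) v₀ (hVs hv₀)
    rw [hM] at h1
    nlinarith
  have hl0 : ∀ v ∈ V, 0 ≤ l v := fun v hv => by
    by_cases hvT : v ∈ T
    · exact (hlT v hvT).ge
    · exact le_trans (by positivity) (hlT' v hv hvT)
  refine ⟨_, ⟨l, hl0, rfl⟩, ?_, ?_⟩
  · refine ⟨hKV hy, ?_⟩
    by_contra hly
    have hly0 : 0 < l y := lt_of_le_of_ne (le_affine_of_mem_convexHull hl0 (hKV hy)) (Ne.symm hly)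
    have hgrow : GrowsFromZeros V (η * M' / D) l := by
      intro p hp
      obtain ⟨q, hq, hlq, h⟩ := exists_face_point_near (m := η * M') hD (by positivity)
        (fun v hv => by
          by_cases hvT : v ∈ T
          · exact Or.inl (hlT v hvT)
          · exact Or.inr (hlT' v hv hvT)) hv₀ (hlT v₀ hv₀T) hp
      refine ⟨q, subset_affineSpan ℝ _ ⟨hq, hlq⟩, ?_⟩
      rw [div_mul_eq_mul_div, div_le_iff₀ hD0]
      linarith
    obtain ⟨U, s, hU, ⟨y', hy', hUy⟩, ⟨p, hp, hlp⟩, hfar⟩ := exists_cell_separating hS hD hKV hK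
      hκ0 hκ1 hκ hl0 (by positivity) hgrow ⟨v₀, hVs hv₀, hlT v₀ hv₀T⟩ hy hly0
    have hs0 := hU.pos hS
    have h1 : g y - δ * s ≤ g (U p) :=
      le_affine_of_mem_convexHull (l := g.comp U) (hNM U s hU ⟨y', hy', hUy⟩) hp
    have h2 : l y = g y - g (U p) - g.linear (W.starProjection (y - U p)) := by
      rw [← hglin, ← hLapp, map_sub]
      rw [hlapp] at hlp ⊢
      linarith
    have h3 := (neg_le_abs _).trans (hproj (y - U p))
    have h4 : C * η * ‖y - U p‖ ≤ C * η * (s * D) := by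
      rw [← dist_eq_norm, ← hUy, hU.dist_eq hS]
      gcongr
      exact hD _ (hKV hy') _ hp
    have h5 : η * M' / D * κ ^ (finrank ℝ X + 1) * s = η * (C * D + 2) * s := by
      rw [hM']
      field_simp
    rw [h5] at hfar
    have h6 : δ * s ≤ η * s := by gcongr
    have h7 : 0 < η * s := by positivity
    linarith
  · intro a ha
    have hsub : vectorSpan ℝ {p ∈ convexHull ℝ (V : Set X) | l p = 0} ≤ W := by
      rw [isFace_eq_convexHull hl0, ← direction_affineSpan, affineSpan_convexHull,
        direction_affineSpan]
      refine vectorSpan_mono ℝ ?_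
      rintro v ⟨hv, hlv⟩
      by_contra hvT
      have := hlT' v hv hvT
      have : 0 < η * M' := by positivity
      linarith
    refine (htilt a (hsub ha)).trans ?_
    rw [hη]
    have : M ^ k ≤ M ^ V.card := pow_le_pow_right₀ hM1 hk
    calc C * (δ * M ^ k) * ‖a‖ ≤ C * (δ * M ^ V.card) * ‖a‖ := by gcongr
      _ = _ := by ring

/-- Unit supporting functionals of a convex open set at outer points near `z` are close to the
unique unit supporting functional at `z`, so outer points near `z` are almost above all of `S`. -/
theorem eventually_almost_supporting [FiniteDimensional ℝ X] {S : Set X} (hSo : IsOpen S)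
    (hSc : Convex ℝ S) {z : X} (hz : z ∈ closure S) {f : X →L[ℝ] ℝ}
    (huniq : ∀ g : X →L[ℝ] ℝ, ‖g‖ = 1 ∧ (∀ y ∈ closure S, g y ≤ g z) → g = f) {ε : ℝ}
    (hε : 0 < ε) :
    ∀ᶠ p in 𝓝 z, p ∉ S → ∀ x ∈ closure S, -(ε * dist p x) ≤ f p - f x := by
  have hclose : ∀ᶠ p in 𝓝 z, ∀ g : X →L[ℝ] ℝ, ‖g‖ = 1 → (∀ y ∈ closure S, g y ≤ g p) →
      dist g f < ε := by
    by_contra hcon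
    obtain ⟨p, hp, hpg⟩ := exists_seq_forall_of_frequently (not_eventually.1 hcon)
    push Not at hpg
    choose g hg1 hgS hgε using hpg
    obtain ⟨g₀, hg₀, θ, hθ, hlim⟩ := (isCompact_sphere (0 : X →L[ℝ] ℝ) 1).tendsto_subseq
      (x := g) (fun m => by simpa using hg1 m)
    have hpθ := hp.comp hθ.tendsto_atTop
    have happ : ∀ y, Tendsto (fun m => g (θ m) y) atTop (𝓝 (g₀ y)) := fun y =>
      ((ContinuousLinearMap.apply ℝ ℝ y).continuous.tendsto g₀).comp hlim
    have happ' : Tendsto (fun m => g (θ m) (p (θ m))) atTop (𝓝 (g₀ z)) :=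
      (isBoundedBilinearMap_apply.continuous.tendsto (g₀, z)).comp (hlim.prodMk_nhds hpθ)
    have hg₀f : g₀ = f := by
      refine huniq g₀ ⟨by simpa using hg₀, fun y hy => ?_⟩
      exact le_of_tendsto_of_tendsto' (happ y) happ' fun m => hgS _ y hy
    rw [hg₀f] at hlim
    obtain ⟨m, hm⟩ := (Metric.tendsto_nhds.1 hlim ε hε).exists
    exact (hgε (θ m)).not_gt hm
  filter_upwards [hclose] with p hp hpS x hx
  obtain ⟨g, hg⟩ := geometric_hahn_banach_open_point hSc hSo hpS
  obtain ⟨s, hs⟩ := closure_nonempty_iff.1 ⟨z, hz⟩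
  have hg0 : g ≠ 0 := by
    rintro rfl
    simpa using hg s hs
  have hgn : 0 < ‖g‖ := norm_pos_iff.2 hg0
  have hgcl : ∀ y ∈ closure S, g y ≤ g p := fun y hy =>
    closure_minimal (fun s hs => (hg s hs).le) (isClosed_le g.continuous continuous_const) hy
  have hd := hp (‖g‖⁻¹ • g) (by rw [norm_smul, norm_inv, norm_norm, inv_mul_cancel₀ hgn.ne'])
    (fun y hy => by
      simp only [smul_apply, smul_eq_mul]
      exact mul_le_mul_of_nonneg_left (hgcl y hy) (by positivity))
  have h1 := (le_abs_self _).trans ((‖g‖⁻¹ • g - f).le_opNorm (p - x))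
  rw [← dist_eq_norm, ← dist_eq_norm] at h1
  have h2 : 0 ≤ (‖g‖⁻¹ • g) (p - x) := by
    rw [smul_apply, map_sub, smul_eq_mul]
    exact mul_nonneg (by positivity) (sub_nonneg.2 (hgcl x hx))
  have h3 : dist (‖g‖⁻¹ • g) f * dist p x ≤ ε * dist p x := by gcongr
  rw [sub_apply, map_sub f] at h1
  linarith

theorem lt_of_mem_of_supporting {S : Set X} (hSo : IsOpen S) {f : X →L[ℝ] ℝ} (hf : f ≠ 0) {c : ℝ}
    (h : ∀ y ∈ S, f y ≤ c) {s : X} (hs : s ∈ S) : f s < c := by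
  have hopen : IsOpenMap f := f.isOpenMap_of_ne_zero hf
  have hsub : f '' S ⊆ interior (Iic c) :=
    interior_maximal (by rintro _ ⟨y, hy, rfl⟩; exact h y hy) (hopen S hSo)
  rw [interior_Iic] at hsub
  exact hsub ⟨s, hs, rfl⟩

theorem finite_inter_closure [FiniteDimensional ℝ X] {ι : Type*} [Finite ι] {V : Finset X}
    {Φ : ι → X →ᵃ[ℝ] X} {r : ι → ℝ} {ρ : ℝ} (hS : IsContractingSystem V Φ r ρ) {D : ℝ}
    (hD0 : 0 < D)
    (hD : ∀ p ∈ convexHull ℝ (V : Set X), ∀ q ∈ convexHull ℝ (V : Set X), dist p q ≤ D)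
    (hV : V.Nonempty) {K : Set X} (hKc : IsCompact K) (hVK : (V : Set X) ⊆ K)
    (hKV : K ⊆ convexHull ℝ (V : Set X)) (hΦK : ∀ i, MapsTo (Φ i) K K)
    (hK : ∀ x ∈ K, ∃ i, ∃ x' ∈ K, Φ i x' = x) {S : Set X} (hSo : IsOpen S) (hSc : Convex ℝ S)
    (hstrict : ∀ x ∈ closure S, ∀ y ∈ closure S, x ≠ y → openSegment ℝ x y ⊆ S)
    (hsmooth : ∀ z ∈ frontier S, ∃! f : X →L[ℝ] ℝ, ‖f‖ = 1 ∧ ∀ y ∈ closure S, f y ≤ f z)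
    (hSK : S ∩ K = ∅) : (K ∩ closure S).Finite := by
  by_contra hinf
  have hSK' : ∀ x ∈ K, x ∉ S := fun x hxK hxS => by
    have : x ∈ S ∩ K := ⟨hxS, hxK⟩
    simp [hSK] at this
  obtain ⟨z, hz, hacc⟩ := Set.Infinite.exists_accPt_of_subset_isCompact hinf
    (hKc.inter_right isClosed_closure) Subset.rfl
  rw [accPt_iff_frequently_nhdsNE] at hacc
  have hzf : z ∈ frontier S := by
    rw [hSo.frontier_eq]
    exact ⟨hz.2, hSK' z hz.1⟩
  obtain ⟨f, ⟨hf1, hfS⟩, hfu⟩ := hsmooth z hzf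
  have hf0 : f ≠ 0 := by
    rintro rfl
    simp at hf1
  have hlt : ∀ s ∈ S, f s < f z := fun s hs =>
    lt_of_mem_of_supporting hSo hf0 (fun y hy => hfS y (subset_closure hy)) hs
  obtain ⟨M, hM0, hM⟩ := exists_flat_face hS hD0 hD hV hKV hK
  set Bad : (X →ᵃ[ℝ] X) → Set X → Prop := fun T G =>
    ∃ᶠ x in 𝓝[≠] z, x ∈ T '' (K ∩ G) ∩ closure S with hBad
  have hex : ∃ d, ∃ T s G, IsCell Φ r T s ∧ IsFace V G ∧ Bad T G ∧
      finrank ℝ (vectorSpan ℝ G) = d := by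
    refine ⟨_, AffineMap.id ℝ X, 1, _, .id, isFace_convexHull V, ?_, rfl⟩
    refine hacc.mono fun x hx => ⟨⟨x, ⟨hx.1, hKV hx.1⟩, rfl⟩, hx.2⟩
  classical
  obtain ⟨T₀, s₀, G₀, hT₀, hG₀, hbad₀, hd₀⟩ := Nat.find_spec hex
  have hminimal := fun {m : ℕ} (hm : m < Nat.find hex) => Nat.find_min hex hm
  rw [← hd₀] at hminimal
  have hs₀ := hT₀.pos hS
  have hconv₀ : Convex ℝ (T₀ '' G₀) := hG₀.convex.affine_image T₀
  obtain ⟨a, ha, hfa⟩ : ∃ a ∈ vectorSpan ℝ (T₀ '' G₀), 0 < f a := by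
    have himg : ∀ x ∈ T₀ '' (K ∩ G₀), x ∈ T₀ '' G₀ := fun x hx =>
      image_mono inter_subset_right hx
    obtain ⟨x₁, hx₁, hx₁z⟩ := (hbad₀.and_eventually self_mem_nhdsWithin).exists
    have hne : ∀ᶠ x in 𝓝[≠] z, x ≠ x₁ :=
      mem_nhdsWithin_of_mem_nhds (isOpen_ne.mem_nhds (Ne.symm hx₁z))
    obtain ⟨x₂, hx₂, hx₂₁⟩ := (hbad₀.and_eventually hne).exists
    have hmid : midpoint ℝ x₁ x₂ ∈ openSegment ℝ x₁ x₂ :=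
      ⟨1 / 2, 1 / 2, by norm_num, by norm_num, by norm_num, by
        rw [midpoint_eq_smul_add, smul_add]; norm_num⟩
    have hmS := hstrict x₁ hx₁.2 x₂ hx₂.2 (Ne.symm hx₂₁) hmid
    have hmG : midpoint ℝ x₁ x₂ ∈ T₀ '' G₀ :=
      hconv₀.openSegment_subset (himg _ hx₁.1) (himg _ hx₂.1) hmid
    have hgt : ∀ᶠ x in 𝓝[≠] z, f (midpoint ℝ x₁ x₂) < f x :=
      mem_nhdsWithin_of_mem_nhds (f.continuous.continuousAt.eventually (lt_mem_nhds (hlt _ hmS)))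
    obtain ⟨x₃, hx₃, hfx₃⟩ := (hbad₀.and_eventually hgt).exists
    refine ⟨x₃ - midpoint ℝ x₁ x₂, vsub_mem_vectorSpan ℝ (himg _ hx₃.1) hmG, ?_⟩
    rw [map_sub]
    linarith
  set δ : ℝ := f a / (M * (‖a‖ + 1)) with hδ
  have hδ0 : 0 < δ := by positivity
  have hδa : M * δ * ‖a‖ < f a := by
    have : f a = M * δ * (‖a‖ + 1) := by
      rw [hδ]
      field_simp
    have : 0 < M * δ := by positivity
    linarith
  obtain ⟨t, ht0, ht⟩ := Metric.eventually_nhds_iff.1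
    (eventually_almost_supporting hSo hSc hz.2 hfu (ε := δ / D) (by positivity))
  have hrefine : ∀ N : ℕ, ∃ T s G, IsCell Φ r T s ∧ s ≤ ρ ^ N * s₀ ∧ IsFace V G ∧ Bad T G ∧
      T '' G ⊆ T₀ '' G₀ := by
    intro N
    induction N with
    | zero => exact ⟨T₀, s₀, G₀, hT₀, by simp, hG₀, hbad₀, Subset.rfl⟩
    | succ N ih =>
      obtain ⟨T, s, G, hT, hs, hG, hbad, hsub⟩ := ih
      have : ∃ᶠ x in 𝓝[≠] z, ∃ i, x ∈ (T.comp (Φ i)) ''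
          (K ∩ {p ∈ convexHull ℝ (V : Set X) | Φ i p ∈ G}) ∩ closure S := by
        refine hbad.mono ?_
        rintro _ ⟨⟨y, ⟨hyK, hyG⟩, rfl⟩, hcl⟩
        obtain ⟨i, y', hy', rfl⟩ := hK y hyK
        exact ⟨i, ⟨y', ⟨hy', hKV hy', hyG⟩, rfl⟩, hcl⟩
      obtain ⟨i, hi⟩ := frequently_exists.1 this
      refine ⟨T.comp (Φ i), s * r i, _, hT.comp i, ?_, hG.preimage (Φ i) (hS.mapsTo i), hi, ?_⟩
      · calc s * r i ≤ (ρ ^ N * s₀) * ρ :=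
              mul_le_mul hs (hS.le i) (hS.pos i).le
                (mul_nonneg (pow_nonneg hS.nonneg _) hs₀.le)
          _ = ρ ^ (N + 1) * s₀ := by ring
      · rintro _ ⟨p, hp, rfl⟩
        exact hsub ⟨Φ i p, hp.2, rfl⟩
  have hlim : Tendsto (fun N : ℕ => ρ ^ N * s₀ * D) atTop (𝓝 (0 * s₀ * D)) :=
    ((tendsto_pow_atTop_nhds_zero_of_lt_one hS.nonneg hS.lt_one).mul_const s₀).mul_const D
  rw [zero_mul, zero_mul] at hlim
  obtain ⟨N, hN⟩ := (hlim.eventually (gt_mem_nhds (half_pos ht0))).exists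
  obtain ⟨T, s, G, hT, hs, hG, hbad, hsub⟩ := hrefine N
  have hs0 := hT.pos hS
  have hsD : s * D < t / 2 := lt_of_le_of_lt (by gcongr) hN
  have hlin : ∀ x y, T.linear (x - y) = T x - T y := fun x y => by
    simpa using T.linearMap_vsub x y
  have hnorm : ∀ b, ‖T.linear b‖ = s * ‖b‖ := fun b => by
    have := hT.dist_eq hS b 0
    rwa [dist_eq_norm, ← hlin, sub_zero, dist_zero_right] at this
  have hball : ∀ᶠ x in 𝓝[≠] z, dist x z < t / 2 :=
    mem_nhdsWithin_of_mem_nhds (Metric.ball_mem_nhds z (half_pos ht0))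
  have hsmall : ∃ᶠ x in 𝓝[≠] z, ∃ H ∈ {H | IsFace V H ∧
      finrank ℝ (vectorSpan ℝ H) < finrank ℝ (vectorSpan ℝ G₀)}, x ∈ T '' (K ∩ H) ∩ closure S := by
    refine (hbad.and_eventually hball).mono ?_
    rintro _ ⟨⟨⟨y, ⟨hyK, hyG⟩, rfl⟩, hcl⟩, hyz⟩
    obtain ⟨H, hH, hyH, hflat⟩ := hM (s⁻¹ • (f : X →ₗ[ℝ] ℝ).toAffineMap.comp T) δ hδ0 y hyK (by
      rintro U u hU ⟨y', hy', rfl⟩ v hv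
      have hvK : U v ∈ K := hU.mapsTo hΦK (hVK hv)
      have hd : dist (T (U v)) (T (U y')) ≤ s * D := by
        rw [hT.dist_eq hS]
        gcongr
        exact hD _ (hKV hvK) _ (hKV hyK)
      have h1 := ht (y := T (U v)) (by
        have := dist_triangle (T (U v)) (T (U y')) z
        linarith) (hSK' _ (hT.mapsTo hΦK hvK)) _ hcl
      have h2 : δ / D * dist (T (U v)) (T (U y')) ≤ δ / D * (s * (u * D)) := by
        rw [hT.dist_eq hS, hU.dist_eq hS]
        have := hU.pos hS
        gcongr
        exact hD _ (hKV (hVK hv)) _ (hKV hy')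
      have h3 : δ / D * (s * (u * D)) = s * (δ * u) := by field_simp
      change s⁻¹ * f (T (U y')) - δ * u ≤ s⁻¹ * f (T (U v))
      have h4 : s⁻¹ * (f (T (U y')) - s * (δ * u)) ≤ s⁻¹ * f (T (U v)) := by
        gcongr
        linarith
      rwa [mul_sub, inv_mul_cancel_left₀ hs0.ne'] at h4)
    refine ⟨H ∩ G, ⟨hH.inter hG, ?_⟩, ⟨y, ⟨hyK, hyH, hyG⟩, rfl⟩, hcl⟩
    by_contra! hge
    have hsub' : T '' (H ∩ G) ⊆ T₀ '' G₀ := (image_mono inter_subset_right).trans hsub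
    have heq : vectorSpan ℝ (T '' (H ∩ G)) = vectorSpan ℝ (T₀ '' G₀) := by
      refine Submodule.eq_of_le_of_finrank_le (vectorSpan_mono ℝ hsub') ?_
      rwa [finrank_vectorSpan_image (hT.injective hS),
        finrank_vectorSpan_image (hT₀.injective hS)]
    rw [← heq, ← AffineMap.map_vectorSpan] at ha
    obtain ⟨b, hb, rfl⟩ := ha
    have h1 : |s⁻¹ * f (T.linear b)| ≤ M * δ * ‖b‖ :=
      hflat b (vectorSpan_mono ℝ inter_subset_left hb)
    have h2 := mul_le_mul_of_nonneg_left ((le_abs_self _).trans h1) hs0.le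
    rw [mul_inv_cancel_left₀ hs0.ne'] at h2
    rw [hnorm] at hδa
    linarith
  obtain ⟨H, ⟨hH, hHd⟩, hHbad⟩ := (frequently_exists_finite
    ((finite_faces V).subset fun H hH => hH.1)).1 hsmall
  exact hminimal hHd ⟨T, s, H, hT, hH, hHbad, rfl⟩

theorem exists_affineMap_of_dist_eq {r : ℝ} (hr : 0 < r) {φ : X → X}
    (hφ : ∀ x y, dist (φ x) (φ y) = r * dist x y) : ∃ Φ : X →ᵃ[ℝ] X, ∀ x, Φ x = φ x := by
  have hiso : Isometry fun x => r⁻¹ • φ x := Isometry.of_dist_eq fun x y => by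
    rw [dist_smul₀, hφ, norm_inv, Real.norm_of_nonneg hr.le, inv_mul_cancel_left₀ hr.ne']
  refine ⟨r • hiso.affineIsometryOfStrictConvexSpace.toAffineMap, fun x => ?_⟩
  change r • (r⁻¹ • φ x) = φ x
  rw [smul_inv_smul₀ hr.ne']

theorem exists_vertices {K : Set X} {F : Finset X} (hKF : convexHull ℝ K = convexHull ℝ (F : Set X)) :
    ∃ V : Finset X, (V : Set X) ⊆ K ∧ convexHull ℝ (V : Set X) = convexHull ℝ K := by
  have hsub : (convexHull ℝ K).extremePoints ℝ ⊆ F := by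
    rw [hKF]
    exact extremePoints_convexHull_subset
  have hfin := F.finite_toSet.subset hsub
  refine ⟨hfin.toFinset, ?_, ?_⟩
  · rw [hfin.coe_toFinset]
    exact extremePoints_convexHull_subset
  · rw [hfin.coe_toFinset, ← (hfin.isClosed_convexHull ℝ).closure_eq]
    refine closure_convexHull_extremePoints ?_ (convex_convexHull ℝ K)
    rw [hKF]
    exact F.finite_toSet.isCompact_convexHull ℝ

end SelfSimilarPolytope


/-- **Lemma.** If `K ⊆ ℝⁿ` is a self-similar set whose convex hull is a polytope, then for
every open, strictly convex `S` with smooth boundary disjoint from `K`, the set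
`K ∩ closure S` is finite. -/
theorem stmt3 (n k : ℕ) (hn : 1 ≤ n) (hk : 1 ≤ k)
    (φ : Fin k → EuclideanSpace ℝ (Fin n) → EuclideanSpace ℝ (Fin n))
    (r : Fin k → ℝ) (hr : ∀ i, r i ∈ Set.Ioo (0:ℝ) 1)
    (hφ : ∀ i x y, dist (φ i x) (φ i y) = r i * dist x y)
    (K : Set (EuclideanSpace ℝ (Fin n))) (hKc : IsCompact K) (hKne : K.Nonempty)
    (hKeq : K = ⋃ i : Fin k, φ i '' K)
    (huniq : ∀ K' : Set (EuclideanSpace ℝ (Fin n)), IsCompact K' → K'.Nonempty →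
      K' = ⋃ i : Fin k, φ i '' K' → K' = K)
    (hpoly : ∃ F : Finset (EuclideanSpace ℝ (Fin n)),
      (convexHull ℝ K : Set (EuclideanSpace ℝ (Fin n))) =
        convexHull ℝ (F : Set (EuclideanSpace ℝ (Fin n)))) :
    ∀ S : Set (EuclideanSpace ℝ (Fin n)), StrictlyConvexSmoothOpen S → S ∩ K = ∅ →
      (K ∩ closure S).Finite := by
  rintro S ⟨hSo, hSc, hstrict, hsmooth⟩ hSK
  obtain ⟨F, hF⟩ := hpoly
  obtain ⟨V, hVK, hV⟩ := SelfSimilarPolytope.exists_vertices hF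
  have hKV : K ⊆ convexHull ℝ (V : Set (EuclideanSpace ℝ (Fin n))) :=
    hV ▸ subset_convexHull ℝ K
  have hVne : V.Nonempty := by
    obtain ⟨x, hx⟩ := hKne
    exact Finset.coe_nonempty.1 (convexHull_nonempty_iff.1 ⟨x, hKV hx⟩)
  choose Φ hΦ using fun i => SelfSimilarPolytope.exists_affineMap_of_dist_eq (hr i).1 (hφ i)
  have hΦK : ∀ i, Set.MapsTo (Φ i) K K := fun i x hx => by
    rw [hKeq, hΦ]
    exact Set.mem_iUnion.2 ⟨i, x, hx, rfl⟩
  have hK : ∀ x ∈ K, ∃ i, ∃ x' ∈ K, Φ i x' = x := fun x hx => by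
    rw [hKeq] at hx
    obtain ⟨i, x', hx', rfl⟩ := Set.mem_iUnion.1 hx
    exact ⟨i, x', hx', hΦ i x'⟩
  have : Nonempty (Fin k) := ⟨⟨0, hk⟩⟩
  obtain ⟨i₀, hi₀⟩ := Finite.exists_max r
  have hS : SelfSimilarPolytope.IsContractingSystem V Φ r (r i₀) :=
    { pos := fun i => (hr i).1
      le := hi₀
      lt_one := (hr i₀).2
      nonneg := (hr i₀).1.le
      dist_eq := fun i x y => by rw [hΦ, hΦ, hφ]
      mapsTo := fun i => by
        rw [hV, Set.mapsTo_iff_image_subset, (Φ i).image_convexHull]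
        exact convexHull_mono (hΦK i).image_subset }
  have hbdd := (V.finite_toSet.isCompact_convexHull ℝ).isBounded
  refine SelfSimilarPolytope.finite_inter_closure hS
    (D := Metric.diam (convexHull ℝ (V : Set (EuclideanSpace ℝ (Fin n)))) + 1)
    (by positivity) (fun p hp q hq => ?_) hVne hKc hVK hKV hΦK hK hSo hSc hstrict hsmooth hSK
  linarith [Metric.dist_le_diam_of_mem hbdd hp hq]
end

section
/- Let r₀ > 0 and set U = {(t,y) ∈ ℝ² : 0 < t < r₀ and √(r₀² − t²) ≤ y < r₀}. Let S ⊆ U be relatively closed in U and suppose (0, r₀) belongs to the closure of S. Then there exists a concave, continuously differentiable function h : (0, r₀) → ℝ such that (i) for every t ∈ (0, r₀) and every y with (t,y) ∈ S one has h(t) ≤ y, and (ii) (0, r₀) belongs to the closure of the set S ∩ {(t, h(t)) : t ∈ (0, r₀)}. -/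
open Set Filter Topology

/-- A `C¹` convex function vanishing on `(-∞, 1/6]` and tangent to `u ↦ u * √u` at `u = 1`. -/
noncomputable def cornerProfile (u : ℝ) : ℝ :=
  (max (6 * u - 1) 0 ^ 2 - max (6 * u - 3) 0 ^ 2) / 16

/-- The derivative of `cornerProfile`. -/
noncomputable def cornerSlope (u : ℝ) : ℝ :=
  3 / 4 * (max (6 * u - 1) 0 - max (6 * u - 3) 0)

lemma hasDerivAt_max_zero_sq (x : ℝ) :
    HasDerivAt (fun y : ℝ => max y 0 ^ 2) (2 * max x 0) x := by
  rcases lt_trichotomy x 0 with hx | rfl | hx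
  · rw [max_eq_right hx.le, mul_zero]
    refine (hasDerivAt_const x (0 : ℝ)).congr_of_eventuallyEq ?_
    filter_upwards [Iio_mem_nhds hx] with y hy
    simp [max_eq_right (le_of_lt (mem_Iio.1 hy))]
  · rw [max_self, mul_zero, hasDerivAt_iff_isLittleO]
    have h : (fun y : ℝ => y ^ 2) =o[𝓝 0] fun y : ℝ => y := by
      simpa using (Asymptotics.isLittleO_pow_pow (𝕜 := ℝ) (m := 1) (n := 2) (by norm_num))
    simp only [max_self, sub_zero, smul_zero, ne_eq, OfNat.ofNat_ne_zero, not_false_eq_true,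
      zero_pow]
    refine (Asymptotics.IsBigO.of_bound 1 (Eventually.of_forall fun y => ?_)).trans_isLittleO h
    rw [one_mul, Real.norm_of_nonneg (sq_nonneg _), Real.norm_of_nonneg (sq_nonneg _)]
    rcases le_total y 0 with hy | hy
    · rw [max_eq_right hy]; nlinarith [sq_nonneg y]
    · rw [max_eq_left hy]
  · rw [max_eq_left hx.le]
    refine HasDerivAt.congr_of_eventuallyEq (f := fun y : ℝ => y ^ 2)
      (by simpa using hasDerivAt_pow 2 x) ?_
    filter_upwards [Ioi_mem_nhds hx] with y hy
    simp [max_eq_left (le_of_lt (mem_Ioi.1 hy))]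

lemma hasDerivAt_cornerProfile (u : ℝ) : HasDerivAt cornerProfile (cornerSlope u) u := by
  have h1 : HasDerivAt (fun u : ℝ => 6 * u - 1) 6 u := by
    simpa using ((hasDerivAt_id u).const_mul 6).sub_const 1
  have h3 : HasDerivAt (fun u : ℝ => 6 * u - 3) 6 u := by
    simpa using ((hasDerivAt_id u).const_mul 6).sub_const 3
  have := (((hasDerivAt_max_zero_sq (6 * u - 1)).comp u h1).sub
    ((hasDerivAt_max_zero_sq (6 * u - 3)).comp u h3)).div_const 16
  refine this.congr_deriv ?_
  unfold cornerSlope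
  ring

lemma continuous_cornerSlope : Continuous cornerSlope := by
  unfold cornerSlope; fun_prop

lemma monotone_cornerSlope : Monotone cornerSlope := by
  intro x y hxy
  unfold cornerSlope
  rcases max_cases (6 * x - 1) 0 with h1 | h1 <;> rcases max_cases (6 * x - 3) 0 with h2 | h2 <;>
  rcases max_cases (6 * y - 1) 0 with h3 | h3 <;> rcases max_cases (6 * y - 3) 0 with h4 | h4 <;>
  linarith

lemma cornerProfile_one : cornerProfile 1 = 1 := by
  unfold cornerProfile; norm_num

lemma cornerSlope_one : cornerSlope 1 = 3 / 2 := by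
  unfold cornerSlope; norm_num

lemma cornerProfile_of_le {u : ℝ} (hu : u ≤ 1 / 6) : cornerProfile u = 0 := by
  unfold cornerProfile
  rw [max_eq_right (by linarith), max_eq_right (by linarith)]; norm_num

lemma cornerSlope_of_le {u : ℝ} (hu : u ≤ 1 / 6) : cornerSlope u = 0 := by
  unfold cornerSlope
  rw [max_eq_right (by linarith), max_eq_right (by linarith)]; norm_num

lemma cornerProfile_nonneg (u : ℝ) : 0 ≤ cornerProfile u := by
  unfold cornerProfile
  have : max (6 * u - 3) 0 ≤ max (6 * u - 1) 0 := max_le_max (by linarith) le_rfl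
  have := pow_le_pow_left₀ (le_max_right _ _) this 2
  linarith

lemma cornerProfile_lt {u : ℝ} (hu : 0 < u) (hu1 : u < 1) : cornerProfile u < u * √u := by
  have hv : 0 < √u := Real.sqrt_pos.2 hu
  have hv1 : √u < 1 := by rw [Real.sqrt_lt' one_pos]; simpa using hu1
  have hvu : √u ^ 2 = u := Real.sq_sqrt hu.le
  set v := √u
  rw [← hvu]
  unfold cornerProfile
  rcases max_cases (6 * v ^ 2 - 1) 0 with h1 | h1 <;>
    rcases max_cases (6 * v ^ 2 - 3) 0 with h2 | h2 <;> rw [h1.1, h2.1]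
  · nlinarith [mul_pos (pow_pos (sub_pos.2 hv1) 2) (by linarith : 0 < 2 * v + 1)]
  · nlinarith [mul_nonneg (sq_nonneg (2 * v - 1)) (by linarith : 0 ≤ 4 * v + 1),
      mul_nonneg h1.2 (by linarith : 0 ≤ 2 - (6 * v ^ 2 - 1))]
  · linarith
  · have : 0 < v ^ 2 * v := by positivity
    linarith

lemma hasDerivAt_mul_sqrt {t : ℝ} (ht : 0 < t) :
    HasDerivAt (fun t : ℝ => t * √t) (3 / 2 * √t) t := by
  have := (hasDerivAt_id t).mul (Real.hasDerivAt_sqrt ht.ne')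
  refine this.congr_deriv ?_
  have hs : 0 < √t := Real.sqrt_pos.2 ht
  have hvu : √t ^ 2 = t := Real.sq_sqrt ht.le
  simp only [id]
  field_simp
  nlinarith

/-- `cornerProfile` rescaled so as to be tangent to `t ↦ t * √t` at `δ`. -/
noncomputable def scaledCorner (δ t : ℝ) : ℝ := δ * √δ * cornerProfile (t / δ)

/-- The derivative of `scaledCorner δ`. -/
noncomputable def scaledCornerSlope (δ t : ℝ) : ℝ := √δ * cornerSlope (t / δ)

section scaledCorner

variable {δ : ℝ}

lemma hasDerivAt_scaledCorner (hδ : 0 < δ) (t : ℝ) :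
    HasDerivAt (scaledCorner δ) (scaledCornerSlope δ t) t := by
  have h1 : HasDerivAt (fun t : ℝ => t / δ) (1 / δ) t := (hasDerivAt_id t).div_const δ
  have := ((hasDerivAt_cornerProfile (t / δ)).comp t h1).const_mul (δ * √δ)
  refine this.congr_deriv ?_
  unfold scaledCornerSlope
  field_simp

lemma continuous_scaledCorner (hδ : 0 < δ) : Continuous (scaledCorner δ) :=
  continuous_iff_continuousAt.2 fun t => (hasDerivAt_scaledCorner hδ t).continuousAt

lemma continuous_scaledCornerSlope (δ : ℝ) : Continuous (scaledCornerSlope δ) :=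
  (continuous_cornerSlope.comp (continuous_id.div_const δ)).const_mul _

lemma monotone_scaledCornerSlope (hδ : 0 < δ) : Monotone (scaledCornerSlope δ) := by
  intro x y hxy
  exact mul_le_mul_of_nonneg_left (monotone_cornerSlope (by gcongr)) (Real.sqrt_nonneg δ)

lemma scaledCorner_self (hδ : 0 < δ) : scaledCorner δ δ = δ * √δ := by
  rw [scaledCorner, div_self hδ.ne', cornerProfile_one, mul_one]

lemma scaledCornerSlope_self (hδ : 0 < δ) : scaledCornerSlope δ δ = 3 / 2 * √δ := by
  rw [scaledCornerSlope, div_self hδ.ne', cornerSlope_one, mul_comm]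

lemma scaledCorner_of_le (hδ : 0 < δ) {t : ℝ} (ht : t ≤ δ / 6) : scaledCorner δ t = 0 := by
  rw [scaledCorner, cornerProfile_of_le, mul_zero]
  rw [div_le_iff₀ hδ]; linarith

lemma scaledCornerSlope_of_le (hδ : 0 < δ) {t : ℝ} (ht : t ≤ δ / 6) :
    scaledCornerSlope δ t = 0 := by
  rw [scaledCornerSlope, cornerSlope_of_le, mul_zero]
  rw [div_le_iff₀ hδ]; linarith

lemma scaledCorner_nonneg (hδ : 0 < δ) (t : ℝ) : 0 ≤ scaledCorner δ t :=
  mul_nonneg (by positivity) (cornerProfile_nonneg _)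

lemma scaledCorner_lt {t : ℝ} (ht : 0 < t) (htδ : t < δ) : scaledCorner δ t < t * √t := by
  have hδ := ht.trans htδ
  have h := cornerProfile_lt (div_pos ht hδ) ((div_lt_one hδ).2 htδ)
  have hs : 0 < √δ := Real.sqrt_pos.2 hδ
  rw [scaledCorner]
  calc δ * √δ * cornerProfile (t / δ) < δ * √δ * (t / δ * √(t / δ)) :=
        mul_lt_mul_of_pos_left h (by positivity)
    _ = t * √t := by
        rw [Real.sqrt_div ht.le]; field_simp

end scaledCorner

/-- A convex `C¹` majorant of the reflected set `{(t, r₀ - y) : (t, y) ∈ S}` that agrees with a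
multiple of `t * √t` near the origin, where it dominates `t ^ 2 / r₀` strictly. -/
structure ConvexMajorant (r₀ : ℝ) (S : Set (ℝ × ℝ)) where
  /-- the majorant -/
  k : ℝ → ℝ
  /-- its derivative -/
  d : ℝ → ℝ
  /-- the multiple of `t * √t` -/
  a : ℝ
  /-- the point up to which the majorant is a multiple of `t * √t` -/
  δ : ℝ
  a_pos : 0 < a
  δ_pos : 0 < δ
  δ_lt : δ < r₀
  sqrt_lt : √δ < a * r₀
  continuous_d : Continuous d
  monotone_d : Monotone d
  hasDerivAt : ∀ t, 0 < t → HasDerivAt k (d t) t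
  k_eq : ∀ t, 0 < t → t ≤ δ → k t = a * (t * √t)
  d_eq : ∀ t, t ≤ δ → d t = a * (3 / 2 * √t)
  le : ∀ p ∈ S, r₀ - p.2 ≤ k p.1

lemma sub_sq_div_le_sqrt {r t : ℝ} (hr : 0 < r) (ht : 0 ≤ t) (htr : t ≤ r) :
    r - t ^ 2 / r ≤ √(r ^ 2 - t ^ 2) := by
  apply Real.le_sqrt_of_sq_le
  have h : t ^ 2 / r ≤ t := by
    rw [div_le_iff₀ hr]; nlinarith
  have h2 : t ^ 2 / r * r = t ^ 2 := div_mul_cancel₀ _ hr.ne'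
  have h3 : 0 ≤ t ^ 2 / r := by positivity
  nlinarith

lemma sq_div_lt_mul_sqrt {r a t : ℝ} (hr : 0 < r) (ht : 0 < t) (h : √t < a * r) :
    t ^ 2 / r < a * (t * √t) := by
  have hs : 0 < √t := Real.sqrt_pos.2 ht
  have hvu : √t ^ 2 = t := Real.sq_sqrt ht.le
  rw [div_lt_iff₀ hr]
  have := mul_lt_mul_of_pos_left h (mul_pos ht hs)
  nlinarith

/-- Replace `f` by `g` on `(-∞, δ]`. -/
lemma hasDerivAt_glue {f g f' g' : ℝ → ℝ} {δ t : ℝ} (hfg : g δ = f δ) (hfg' : g' δ = f' δ)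
    (hf : HasDerivAt f (f' t) t) (hg : HasDerivAt g (g' t) t) :
    HasDerivAt (fun s => if s ≤ δ then g s else f s) (if t ≤ δ then g' t else f' t) t := by
  rcases lt_trichotomy t δ with h | rfl | h
  · rw [if_pos h.le]
    refine hg.congr_of_eventuallyEq ?_
    filter_upwards [Iio_mem_nhds h] with y hy
    rw [if_pos (le_of_lt hy)]
  · rw [if_pos le_rfl, ← hasDerivWithinAt_univ, ← Iic_union_Ici (a := t)]
    refine HasDerivWithinAt.union ?_ ?_
    · exact hg.hasDerivWithinAt.congr (fun y hy => if_pos hy) (if_pos le_rfl)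
    · rw [hfg']
      refine hf.hasDerivWithinAt.congr (fun y hy => ?_) (by rw [if_pos le_rfl, hfg])
      rcases eq_or_lt_of_le (mem_Ici.1 hy) with rfl | hy
      · rw [if_pos le_rfl, hfg]
      · rw [if_neg hy.not_ge]
  · rw [if_neg h.not_ge]
    refine hf.congr_of_eventuallyEq ?_
    filter_upwards [Ioi_mem_nhds h] with y hy
    rw [if_neg (not_le.2 hy)]

lemma monotone_glue {f g : ℝ → ℝ} {δ : ℝ} (hfg : g δ = f δ) (hf : Monotone f)
    (hg : Monotone g) : Monotone fun s => if s ≤ δ then g s else f s := by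
  intro x y hxy
  dsimp only
  split_ifs with h1 h2 h2
  · exact hg hxy
  · exact (hg h1).trans (hfg.le.trans (hf (not_le.1 h2).le))
  · exact absurd (hxy.trans h2) h1
  · exact hf hxy

section Refinement

variable {r₀ : ℝ} {S : Set (ℝ × ℝ)}

/-- Some element of `S` over `(0, δ)` maximizes the factor `μ` for which
`a * ((1 - μ) * scaledCorner δ t + μ * (t * √t))` passes through it. -/
lemma exists_contact {a δ : ℝ} (ha : 0 < a) (hδ : 0 < δ) (hδr : δ < r₀) (hδa : √δ < a * r₀)
    (hS : ∀ p ∈ S, 0 < p.1 ∧ p.1 < r₀ ∧ √(r₀ ^ 2 - p.1 ^ 2) ≤ p.2 ∧ p.2 < r₀)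
    (hcl : ∃ C : Set (ℝ × ℝ), IsClosed C ∧ ∀ p, p ∈ S ↔ (0 < p.1 ∧ p.1 < r₀ ∧
      √(r₀ ^ 2 - p.1 ^ 2) ≤ p.2 ∧ p.2 < r₀) ∧ p ∈ C)
    (h0 : ((0 : ℝ), r₀) ∈ closure S) :
    ∃ p ∈ S, p.1 < δ ∧ ∃ μ, 0 < μ ∧ μ ≤ 1 ∧
      r₀ - p.2 = a * ((1 - μ) * scaledCorner δ p.1 + μ * (p.1 * √p.1)) ∧
      ∀ q ∈ S, q.1 ≤ δ → r₀ - q.2 ≤ a * ((1 - μ) * scaledCorner δ q.1 + μ * (q.1 * √q.1)) := by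
  have hr : 0 < r₀ := hδ.trans hδr
  have hup : ∀ p ∈ S, r₀ - p.2 ≤ p.1 ^ 2 / r₀ := fun p hp => by
    obtain ⟨h1, h2, h3, -⟩ := hS p hp
    linarith [sub_sq_div_le_sqrt hr h1.le h2.le]
  have hlt : ∀ p ∈ S, p.1 ≤ δ → r₀ - p.2 < a * (p.1 * √p.1) := fun p hp hpδ =>
    (hup p hp).trans_lt (sq_div_lt_mul_sqrt hr (hS p hp).1
      ((Real.sqrt_le_sqrt hpδ).trans_lt hδa))
  obtain ⟨p₀, hp₀, hp₀δ⟩ : ∃ p ∈ S, p.1 < δ / 6 := by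
    have hopen : IsOpen {p : ℝ × ℝ | p.1 < δ / 6} := isOpen_lt continuous_fst continuous_const
    obtain ⟨p, hp, hpS⟩ := mem_closure_iff.1 h0 _ hopen (by simp [hδ])
    exact ⟨p, hpS, hp⟩
  obtain ⟨hs0, -, -, hy0⟩ := hS p₀ hp₀
  have hw0 : 0 < p₀.1 * √p₀.1 := mul_pos hs0 (Real.sqrt_pos.2 hs0)
  set R : ℝ := (r₀ - p₀.2) / a / (p₀.1 * √p₀.1) with hR
  have hRpos : 0 < R := div_pos (div_pos (sub_pos.2 hy0) ha) hw0
  have hp₀R : r₀ - p₀.2 = a * (R * (p₀.1 * √p₀.1)) := by rw [hR]; field_simp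
  have hR1 : R < 1 := by
    have := hlt p₀ hp₀ (by linarith)
    rw [hp₀R] at this
    have := lt_of_mul_lt_mul_left this ha.le
    nlinarith
  set m : ℝ := min (δ / 6) ((R * a * r₀) ^ 2) with hm
  have hmpos : 0 < m := by positivity
  obtain ⟨C, hC, hSC⟩ := hcl
  -- the part of `S` with parameter at least `R`
  set A : Set (ℝ × ℝ) := {p | p ∈ S ∧ p.1 ≤ δ ∧
    a * ((1 - R) * scaledCorner δ p.1 + R * (p.1 * √p.1)) ≤ r₀ - p.2} with hA
  have hAm : ∀ p ∈ A, m ≤ p.1 := by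
    rintro p ⟨hpS, hpδ, hp⟩
    by_contra! hlt'
    have h1 := hS p hpS
    have h6 : p.1 ≤ δ / 6 := hlt'.le.trans (min_le_left _ _)
    have h7 : p.1 < (R * a * r₀) ^ 2 := hlt'.trans_le (min_le_right _ _)
    rw [scaledCorner_of_le hδ h6] at hp
    have h8 : √p.1 < (R * a) * r₀ := by
      rw [Real.sqrt_lt' (by positivity)]; exact h7
    have h9 := sq_div_lt_mul_sqrt hr h1.1 h8
    have := hup p hpS
    nlinarith
  have hwpos : ∀ t, 0 < t → 0 < (1 - R) * scaledCorner δ t + R * (t * √t) := fun t ht => by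
    have h1 := mul_nonneg (sub_nonneg.2 hR1.le) (scaledCorner_nonneg hδ t)
    have h2 : 0 < R * (t * √t) := mul_pos hRpos (mul_pos ht (Real.sqrt_pos.2 ht))
    linarith
  have hcq := continuous_scaledCorner hδ
  have hAeq : A = C ∩ ({p | m ≤ p.1} ∩ {p | p.1 ≤ δ} ∩ {p | √(r₀ ^ 2 - p.1 ^ 2) ≤ p.2} ∩
      {p | a * ((1 - R) * scaledCorner δ p.1 + R * (p.1 * √p.1)) ≤ r₀ - p.2}) := by
    ext p
    constructor
    · intro hp
      have h := (hSC p).1 hp.1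
      exact ⟨h.2, ⟨⟨hAm p hp, hp.2.1⟩, h.1.2.2.1⟩, hp.2.2⟩
    · rintro ⟨hpC, ⟨⟨h1, h2⟩, h3⟩, h4⟩
      simp only [mem_ofPred_eq] at h1 h2 h3 h4
      have h5 := mul_pos ha (hwpos p.1 (hmpos.trans_le h1))
      exact ⟨(hSC p).2 ⟨⟨hmpos.trans_le h1, h2.trans_lt hδr, h3, by linarith⟩, hpC⟩, h2, h4⟩
  have hAclosed : IsClosed A := by
    rw [hAeq]
    refine hC.inter (((IsClosed.inter ?_ ?_).inter ?_).inter ?_)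
    · exact isClosed_le continuous_const continuous_fst
    · exact isClosed_le continuous_fst continuous_const
    · exact isClosed_le (by fun_prop) continuous_snd
    · exact isClosed_le (by fun_prop) (by fun_prop)
  have hAcomp : IsCompact A := by
    refine (isCompact_Icc (a := ((0 : ℝ), (0 : ℝ))) (b := (δ, r₀))).of_isClosed_subset hAclosed ?_
    rintro p ⟨hpS, hpδ, -⟩
    obtain ⟨h1, -, h3, h4⟩ := hS p hpS
    exact ⟨⟨h1.le, (Real.sqrt_nonneg _).trans h3⟩, ⟨hpδ, h4.le⟩⟩
  have hAlt : ∀ p ∈ A, p.1 < δ := by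
    rintro p ⟨hpS, hpδ, hp⟩
    refine lt_of_le_of_ne hpδ fun h => ?_
    have := hlt p hpS hpδ
    rw [h, scaledCorner_self hδ] at hp
    rw [h] at this
    linarith
  have hden : ∀ p ∈ S, p.1 < δ → 0 < p.1 * √p.1 - scaledCorner δ p.1 := fun p hp hpδ =>
    sub_pos.2 (scaledCorner_lt (hS p hp).1 hpδ)
  let F : ℝ × ℝ → ℝ := fun p => ((r₀ - p.2) / a - scaledCorner δ p.1) /
    (p.1 * √p.1 - scaledCorner δ p.1)
  have hFle : ∀ p ∈ S, p.1 < δ → ∀ x,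
      (F p ≤ x ↔ r₀ - p.2 ≤ a * ((1 - x) * scaledCorner δ p.1 + x * (p.1 * √p.1))) := by
    intro p hp hpδ x
    rw [div_le_iff₀ (hden p hp hpδ), sub_le_iff_le_add, div_le_iff₀ ha]
    constructor <;> intro h <;> linarith
  have hFge : ∀ p ∈ S, p.1 < δ → ∀ x,
      (x ≤ F p ↔ a * ((1 - x) * scaledCorner δ p.1 + x * (p.1 * √p.1)) ≤ r₀ - p.2) := by
    intro p hp hpδ x
    rw [le_div_iff₀ (hden p hp hpδ), le_sub_iff_add_le, le_div_iff₀ ha]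
    constructor <;> intro h <;> linarith
  have hFcont : ContinuousOn F A := by
    refine ContinuousOn.div (by fun_prop) (by fun_prop) fun p hp => ?_
    exact (hden p hp.1 (hAlt p hp)).ne'
  have hp₀A : p₀ ∈ A := by
    refine ⟨hp₀, by linarith, ?_⟩
    rw [scaledCorner_of_le hδ hp₀δ.le, hp₀R, mul_zero, zero_add]
  obtain ⟨p, hpA, hmax⟩ := hAcomp.exists_isMaxOn ⟨p₀, hp₀A⟩ hFcont
  have hpδ := hAlt p hpA
  have hRF : R ≤ F p := (hFge p hpA.1 hpδ R).2 hpA.2.2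
  have hF1 : F p ≤ 1 := by
    rw [hFle p hpA.1 hpδ]
    linarith [hlt p hpA.1 hpδ.le]
  refine ⟨p, hpA.1, hpδ, F p, hRpos.trans_le hRF, hF1, ?_, fun q hqS hqδ => ?_⟩
  · exact le_antisymm ((hFle p hpA.1 hpδ _).1 le_rfl) ((hFge p hpA.1 hpδ _).1 le_rfl)
  · rcases eq_or_lt_of_le hqδ with hq | hq
    · have := hlt q hqS hqδ
      rw [hq] at this ⊢
      rw [scaledCorner_self hδ]
      linarith
    · rw [← hFle q hqS hq]
      by_cases hqA : q ∈ A
      · exact hmax hqA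
      · have : ¬ R ≤ F q := fun h => hqA ⟨hqS, hqδ, (hFge q hqS hq R).1 h⟩
        linarith

lemma ConvexMajorant.exists_refine (K : ConvexMajorant r₀ S)
    (hS : ∀ p ∈ S, 0 < p.1 ∧ p.1 < r₀ ∧ √(r₀ ^ 2 - p.1 ^ 2) ≤ p.2 ∧ p.2 < r₀)
    (hcl : ∃ C : Set (ℝ × ℝ), IsClosed C ∧ ∀ p, p ∈ S ↔ (0 < p.1 ∧ p.1 < r₀ ∧
      √(r₀ ^ 2 - p.1 ^ 2) ≤ p.2 ∧ p.2 < r₀) ∧ p ∈ C)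
    (h0 : ((0 : ℝ), r₀) ∈ closure S) :
    ∃ L : ConvexMajorant r₀ S, L.δ ≤ K.δ / 6 ∧ (∀ t, K.δ ≤ t → L.k t = K.k t ∧ L.d t = K.d t) ∧
      ∃ p ∈ S, L.δ ≤ p.1 ∧ p.1 < K.δ ∧ r₀ - p.2 = L.k p.1 := by
  obtain ⟨p, hpS, hpδ, μ, hμ, hμ1, hp, hq⟩ :=
    exists_contact K.a_pos K.δ_pos K.δ_lt K.sqrt_lt hS hcl h0
  have hδ := K.δ_pos
  have ha := K.a_pos
  have hr : 0 < r₀ := hδ.trans K.δ_lt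
  have hp1 := (hS p hpS).1
  have hkδ : K.a * ((1 - μ) * scaledCorner K.δ K.δ + μ * (K.δ * √K.δ)) = K.k K.δ := by
    rw [scaledCorner_self hδ, K.k_eq _ hδ le_rfl]; ring
  have hdδ : K.a * ((1 - μ) * scaledCornerSlope K.δ K.δ + μ * (3 / 2 * √K.δ)) = K.d K.δ := by
    rw [scaledCornerSlope_self hδ, K.d_eq _ le_rfl]; ring
  set ε : ℝ := min (p.1) (min (K.δ / 6) ((K.a * μ * r₀) ^ 2 / 4)) with hε
  have hεp : ε ≤ p.1 := min_le_left _ _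
  have hεδ : ε ≤ K.δ / 6 := (min_le_right _ _).trans (min_le_left _ _)
  have hεa : ε ≤ (K.a * μ * r₀) ^ 2 / 4 := (min_le_right _ _).trans (min_le_right _ _)
  have hεpos : 0 < ε := by positivity
  have hcd := K.continuous_d
  have hcs := continuous_scaledCornerSlope K.δ
  let L : ConvexMajorant r₀ S :=
    { k := fun t => if t ≤ K.δ then
        K.a * ((1 - μ) * scaledCorner K.δ t + μ * (t * √t)) else K.k t
      d := fun t => if t ≤ K.δ then
        K.a * ((1 - μ) * scaledCornerSlope K.δ t + μ * (3 / 2 * √t)) else K.d t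
      a := K.a * μ
      δ := ε
      a_pos := mul_pos ha hμ
      δ_pos := hεpos
      δ_lt := by linarith [K.δ_lt]
      sqrt_lt := by
        have : 0 < K.a * μ * r₀ := by positivity
        rw [Real.sqrt_lt' this]
        nlinarith
      continuous_d := Continuous.if_le (by fun_prop) hcd continuous_id continuous_const
        (by rintro x rfl; exact hdδ)
      monotone_d := by
        refine monotone_glue hdδ K.monotone_d fun x y hxy => ?_
        have h1 := monotone_scaledCornerSlope hδ hxy
        have h2 := Real.sqrt_le_sqrt hxy
        have h3 := sub_nonneg.2 hμ1
        gcongr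
      hasDerivAt := fun t ht => hasDerivAt_glue
        (g := fun t => K.a * ((1 - μ) * scaledCorner K.δ t + μ * (t * √t)))
        (g' := fun t => K.a * ((1 - μ) * scaledCornerSlope K.δ t + μ * (3 / 2 * √t)))
        hkδ hdδ (K.hasDerivAt t ht)
        ((((hasDerivAt_scaledCorner hδ t).const_mul (1 - μ)).add
          ((hasDerivAt_mul_sqrt ht).const_mul μ)).const_mul K.a)
      k_eq := fun t _ ht => by
        rw [if_pos (by linarith), scaledCorner_of_le hδ (by linarith)]; ring
      d_eq := fun t ht => by
        rw [if_pos (by linarith), scaledCornerSlope_of_le hδ (by linarith)]; ring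
      le := fun q hqS => by
        split_ifs with h
        · exact hq q hqS h
        · exact K.le q hqS }
  refine ⟨L, hεδ, fun t ht => ?_, p, hpS, hεp, hpδ, ?_⟩
  · rcases eq_or_lt_of_le ht with rfl | ht
    · exact ⟨(if_pos le_rfl).trans hkδ, (if_pos le_rfl).trans hdδ⟩
    · exact ⟨if_neg ht.not_ge, if_neg ht.not_ge⟩
  · exact hp.trans (if_pos hpδ.le).symm

lemma ConvexMajorant.nonempty (hr : 0 < r₀)
    (hS : ∀ p ∈ S, 0 < p.1 ∧ p.1 < r₀ ∧ √(r₀ ^ 2 - p.1 ^ 2) ≤ p.2 ∧ p.2 < r₀) :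
    Nonempty (ConvexMajorant r₀ S) := by
  have ha : 0 < (1 + √r₀) / r₀ := by positivity
  have har : (1 + √r₀) / r₀ * r₀ = 1 + √r₀ := div_mul_cancel₀ _ hr.ne'
  have hlt : ∀ t ≤ r₀, √t < (1 + √r₀) / r₀ * r₀ := fun t ht => by
    rw [har]; linarith [Real.sqrt_le_sqrt ht]
  exact ⟨{
    k := fun t => (1 + √r₀) / r₀ * (t * √t)
    d := fun t => (1 + √r₀) / r₀ * (3 / 2 * √t)
    a := (1 + √r₀) / r₀
    δ := r₀ / 2
    a_pos := ha
    δ_pos := by positivity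
    δ_lt := by linarith
    sqrt_lt := hlt _ (by linarith)
    continuous_d := by fun_prop
    monotone_d := fun x y hxy => by
      have h2 := Real.sqrt_le_sqrt hxy
      dsimp only
      gcongr
    hasDerivAt := fun t ht => (hasDerivAt_mul_sqrt ht).const_mul _
    k_eq := fun _ _ _ => rfl
    d_eq := fun _ _ => rfl
    le := fun p hp => by
      obtain ⟨h1, h2, h3, -⟩ := hS p hp
      linarith [sub_sq_div_le_sqrt hr h1.le h2.le, sq_div_lt_mul_sqrt hr h1 (hlt _ h2.le)] }⟩

end Refinement


/-- **Lemma.** Let `r₀ > 0` and `U = {(t,y) : 0 < t < r₀, √(r₀² − t²) ≤ y < r₀}`. If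
`S ⊆ U` is relatively closed in `U` and `(0, r₀) ∈ closure S`, then there is a concave,
continuously differentiable function `h` on `(0, r₀)` such that `h(t) ≤ y` whenever
`(t,y) ∈ S`, and `(0, r₀)` belongs to the closure of `S ∩ graph h`. -/
theorem stmt4 (r₀ : ℝ) (hr₀ : 0 < r₀)
    (U : Set (ℝ × ℝ))
    (hU : U = {p : ℝ × ℝ | 0 < p.1 ∧ p.1 < r₀ ∧
      Real.sqrt (r₀ ^ 2 - p.1 ^ 2) ≤ p.2 ∧ p.2 < r₀})
    (S : Set (ℝ × ℝ)) (hSU : S ⊆ U)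
    (hScl : ∃ C : Set (ℝ × ℝ), IsClosed C ∧ S = U ∩ C)
    (h0 : ((0 : ℝ), r₀) ∈ closure S) :
    ∃ h : ℝ → ℝ,
      ConcaveOn ℝ (Set.Ioo 0 r₀) h ∧
      ContDiffOn ℝ 1 h (Set.Ioo 0 r₀) ∧
      (∀ t ∈ Set.Ioo (0:ℝ) r₀, ∀ y : ℝ, (t, y) ∈ S → h t ≤ y) ∧
      ((0 : ℝ), r₀) ∈ closure (S ∩ {p : ℝ × ℝ | p.1 ∈ Set.Ioo (0:ℝ) r₀ ∧ p.2 = h p.1}) := by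
  have hS : ∀ p ∈ S, 0 < p.1 ∧ p.1 < r₀ ∧ √(r₀ ^ 2 - p.1 ^ 2) ≤ p.2 ∧ p.2 < r₀ := by
    intro p hp
    have := hSU hp
    rwa [hU] at this
  have hcl : ∃ C : Set (ℝ × ℝ), IsClosed C ∧ ∀ p, p ∈ S ↔ (0 < p.1 ∧ p.1 < r₀ ∧
      √(r₀ ^ 2 - p.1 ^ 2) ≤ p.2 ∧ p.2 < r₀) ∧ p ∈ C := by
    obtain ⟨C, hC, hSC⟩ := hScl
    refine ⟨C, hC, fun p => ?_⟩
    rw [hSC, hU]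
    rfl
  obtain ⟨K₀⟩ := ConvexMajorant.nonempty hr₀ hS
  choose next hnext_δ hnext_eq hnext using
    fun K : ConvexMajorant r₀ S => K.exists_refine hS hcl h0
  let M : ℕ → ConvexMajorant r₀ S := fun n => next^[n] K₀
  have hM : ∀ n, M (n + 1) = next (M n) := fun n => Function.iterate_succ_apply' next n K₀
  have hanti : Antitone fun n => (M n).δ := by
    refine antitone_nat_of_succ_le fun n => ?_
    rw [hM]
    linarith [hnext_δ (M n), (M n).δ_pos]
  have hgeom : ∀ n, (M n).δ ≤ K₀.δ * (1 / 6) ^ n := by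
    intro n
    induction n with
    | zero => simp [M]
    | succ n ih =>
      rw [hM, pow_succ]
      linarith [hnext_δ (M n)]
  have hlim : Tendsto (fun n => (M n).δ) atTop (𝓝 0) := by
    refine squeeze_zero (fun n => (M n).δ_pos.le) hgeom ?_
    simpa using (tendsto_pow_atTop_nhds_zero_of_lt_one (r := (1 / 6 : ℝ)) (by norm_num)
      (by norm_num)).const_mul K₀.δ
  have hsmall : ∀ t : ℝ, 0 < t → ∃ n, (M n).δ < t := fun t ht =>
    (hlim.eventually_lt_const ht).exists
  have hstab : ∀ n j, n ≤ j → ∀ t, (M n).δ ≤ t →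
      (M j).k t = (M n).k t ∧ (M j).d t = (M n).d t := by
    intro n j hnj t ht
    induction j, hnj using Nat.le_induction with
    | base => exact ⟨rfl, rfl⟩
    | succ j hj ih =>
      have h := hnext_eq (M j) t ((hanti hj).trans ht)
      rw [hM]
      exact ⟨h.1.trans ih.1, h.2.trans ih.2⟩
  choose! N hN using hsmall
  let k : ℝ → ℝ := fun t => (M (N t)).k t
  let d : ℝ → ℝ := fun t => (M (N t)).d t
  have hk : ∀ n t, (M n).δ ≤ t → k t = (M n).k t ∧ d t = (M n).d t := by
    intro n t ht
    have hNt := (hN t ((M n).δ_pos.trans_le ht)).le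
    rcases le_total n (N t) with h | h
    · exact hstab _ _ h t ht
    · exact ⟨(hstab _ _ h t hNt).1.symm, (hstab _ _ h t hNt).2.symm⟩
  have hev : ∀ t, 0 < t → ∃ n, k =ᶠ[𝓝 t] (M n).k ∧ d =ᶠ[𝓝 t] (M n).d := by
    intro t ht
    refine ⟨N t, ?_, ?_⟩ <;> filter_upwards [Ioi_mem_nhds (hN t ht)] with s hs
    · exact (hk _ s (le_of_lt hs)).1
    · exact (hk _ s (le_of_lt hs)).2
  have hderiv : ∀ t, 0 < t → HasDerivAt k (d t) t := by
    intro t ht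
    obtain ⟨n, hn, hn'⟩ := hev t ht
    rw [hn'.eq_of_nhds]
    exact ((M n).hasDerivAt t ht).congr_of_eventuallyEq hn
  have hderiv' : ∀ t, 0 < t → HasDerivAt (fun t => r₀ - k t) (-d t) t := fun t ht =>
    (hderiv t ht).const_sub r₀
  have hcont : ContinuousOn d (Ioo 0 r₀) := by
    intro t ht
    obtain ⟨n, -, hn'⟩ := hev t ht.1
    exact ((M n).continuous_d.continuousAt.congr hn'.symm).continuousWithinAt
  refine ⟨fun t => r₀ - k t, ?_, ?_, ?_, ?_⟩
  · refine AntitoneOn.concaveOn_of_deriv (convex_Ioo 0 r₀)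
      (fun t ht => (hderiv' t ht.1).continuousAt.continuousWithinAt) ?_ ?_
    · rw [interior_Ioo]
      exact fun t ht => (hderiv' t ht.1).differentiableAt.differentiableWithinAt
    · rw [interior_Ioo]
      intro s hs t ht hst
      rw [(hderiv' s hs.1).deriv, (hderiv' t ht.1).deriv, neg_le_neg_iff]
      have h := (hN s hs.1).le
      rw [(hk _ s h).2, (hk _ t (h.trans hst)).2]
      exact (M (N s)).monotone_d hst
  · rw [show (1 : WithTop ℕ∞) = 0 + 1 from (zero_add 1).symm,
      contDiffOn_succ_iff_deriv_of_isOpen isOpen_Ioo]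
    refine ⟨fun t ht => (hderiv' t ht.1).differentiableAt.differentiableWithinAt, by simp, ?_⟩
    rw [contDiffOn_zero]
    exact hcont.neg.congr fun t ht => (hderiv' t ht.1).deriv
  · intro t _ y hty
    have := (M (N t)).le _ hty
    change r₀ - k t ≤ y
    change r₀ - y ≤ k t at this
    linarith
  · choose p hpS hpδ hpδ' hpk using fun n => hnext (M n)
    refine mem_closure_of_tendsto (f := p) (b := atTop) ?_ (Eventually.of_forall fun n => ?_)
    · have h1 : Tendsto (fun n => (p n).1) atTop (𝓝 0) :=
        squeeze_zero (fun n => (hS _ (hpS n)).1.le) (fun n => (hpδ' n).le) hlim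
      have h2 : Tendsto (fun n => (p n).2) atTop (𝓝 r₀) := by
        have h3 : Tendsto (fun n => √(r₀ ^ 2 - (p n).1 ^ 2)) atTop (𝓝 r₀) := by
          have := ((h1.pow 2).const_sub (r₀ ^ 2)).sqrt
          simpa [Real.sqrt_sq hr₀.le] using this
        exact tendsto_of_tendsto_of_tendsto_of_le_of_le h3 tendsto_const_nhds
          (fun n => (hS _ (hpS n)).2.2.1) (fun n => (hS _ (hpS n)).2.2.2.le)
      exact h1.prodMk_nhds h2
    · refine ⟨hpS n, ⟨(hS _ (hpS n)).1, (hS _ (hpS n)).2.1⟩, ?_⟩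
      have h := hpk n
      rw [← hM] at h
      change (p n).2 = r₀ - k (p n).1
      rw [(hk (n + 1) _ (by rw [hM]; exact hpδ n)).1, ← h]
      ring
end
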